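/- arXiv:math/0512335 — 3 statements merged into one kernel-verified Lean document; each statement's English description precedes it below -/
import Mathlib

section
/- Let n ≥ 1, let f : ℝⁿ → ℝⁿ be a real analytic open map, and let Y ⊆ ℝⁿ be a connected set. Suppose that every point of Y has a neighborhood N in Y (i.e., a set of the form Y ∩ W with W open containing the point) on which the Jacobian det(df_·) does not change sign (it is ≥ 0 throughout N or ≤ 0 throughout N). Then det(df_·) does not change sign on the closure of Y: either det(df_p) ≥ 0 for all p ∈ closure(Y), or det(df_p) ≤ 0 for all p ∈ closure(Y). -/
open Set Filter Topology

def OneSign {X : Type} (J : X → ℝ) (S : Set X) : Prop :=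
  (∀ x ∈ S, 0 ≤ J x) ∨ (∀ x ∈ S, J x ≤ 0)

def LocSign {X : Type} [TopologicalSpace X] (J : X → ℝ) (p : X) : Prop :=
  ∃ V ∈ 𝓝 p, OneSign J V

theorem OneSign.mono {X : Type} {J : X → ℝ} {S T : Set X} (h : OneSign J T) (hST : S ⊆ T) :
    OneSign J S := h.imp (fun h x hx => h x (hST hx)) (fun h x hx => h x (hST hx))

theorem oneSign_of_locSign {X : Type} [TopologicalSpace X] {J : X → ℝ} {U : Set X}
    (hU : IsOpen U) (hc : IsPreconnected U) (hl : ∀ p ∈ U, LocSign J p)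
    (hz : ∀ V ⊆ U, IsOpen V → V.Nonempty → ∃ x ∈ V, J x ≠ 0) : OneSign J U := by
  set A : Set X := interior {x | 0 ≤ J x} with hA
  set B : Set X := interior {x | J x ≤ 0} with hB
  have hcov : U ⊆ A ∪ B := by
    intro p hp
    obtain ⟨V, hV, h | h⟩ := hl p hp
    · left; exact mem_interior_iff_mem_nhds.2 (mem_of_superset hV h)
    · right; exact mem_interior_iff_mem_nhds.2 (mem_of_superset hV h)
  by_cases h1 : (U ∩ A).Nonempty
  · by_cases h2 : (U ∩ B).Nonempty
    · exfalso
      have h3 := hc A B isOpen_interior isOpen_interior hcov h1 h2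
      obtain ⟨x, hx, hx0⟩ := hz _ inter_subset_left
        (hU.inter (isOpen_interior.inter isOpen_interior)) h3
      have e1 : x ∈ {x | 0 ≤ J x} := interior_subset hx.2.1
      have e2 : x ∈ {x | J x ≤ 0} := interior_subset hx.2.2
      exact hx0 (le_antisymm e2 e1)
    · left
      intro x hx
      rcases hcov hx with h | h
      · exact (interior_subset h : x ∈ {x | 0 ≤ J x})
      · exact absurd ⟨x, hx, h⟩ h2
  · right
    intro x hx
    rcases hcov hx with h | h
    · exact absurd ⟨x, hx, h⟩ h1
    · exact (interior_subset h : x ∈ {x | J x ≤ 0})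

/-- real analytic open map on an open set -/
structure GoodMap {E F : Type} [NormedAddCommGroup E] [NormedSpace ℝ E]
    [NormedAddCommGroup F] [NormedSpace ℝ F] (f : E → F) (U : Set E) : Prop where
  isOpen : IsOpen U
  an : AnalyticOnNhd ℝ f U
  op : ∀ V ⊆ U, IsOpen V → IsOpen (f '' V)

theorem GoodMap.mono {E F : Type} [NormedAddCommGroup E] [NormedSpace ℝ E]
    [NormedAddCommGroup F] [NormedSpace ℝ F] {f : E → F} {U V : Set E}
    (h : GoodMap f U) (hV : IsOpen V) (hVU : V ⊆ U) : GoodMap f V :=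
  ⟨hV, h.an.mono hVU, fun W hW => h.op W (hW.trans hVU)⟩

theorem GoodMap.exists_det_ne_zero {E : Type} [NormedAddCommGroup E] [NormedSpace ℝ E]
    [FiniteDimensional ℝ E] {f : E → E} {U : Set E} (h : GoodMap f U)
    (V : Set E) (hVU : V ⊆ U) (hV : IsOpen V) (hne : V.Nonempty) :
    ∃ x ∈ V, (fderiv ℝ f x).det ≠ 0 := by
  by_contra! hcon
  let _ : MeasurableSpace E := borel E
  have : BorelSpace E := ⟨rfl⟩
  have h0 := MeasureTheory.addHaar_image_eq_zero_of_det_fderivWithin_eq_zero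
    (MeasureTheory.Measure.addHaar : MeasureTheory.Measure E) (s := V) (f := f)
    (f' := fun x => fderiv ℝ f x)
    (fun x hx => ((h.an x (hVU hx)).differentiableAt.hasFDerivAt).hasFDerivWithinAt) hcon
  have h1 := (h.op V hVU hV).measure_pos
    (MeasureTheory.Measure.addHaar : MeasureTheory.Measure E) (hne.image f)
  exact h1.ne' h0

theorem AnalyticAt.eventually_zero_of_flat {E F : Type} [NormedAddCommGroup E] [NormedSpace ℝ E]
    [NormedAddCommGroup F] [NormedSpace ℝ F] [CompleteSpace F] {g : E → F} {p : E}
    (h : AnalyticAt ℝ g p) (hz : ∀ k, iteratedFDeriv ℝ k g p = 0) : ∀ᶠ x in 𝓝 p, g x = 0 := by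
  obtain ⟨P, r, hP⟩ := h
  have : Metric.eball p r ∈ 𝓝 p := Metric.eball_mem_nhds p hP.r_pos
  filter_upwards [this] with x hx
  have hy : x - p ∈ Metric.eball (0:E) r := by
    simpa [Metric.mem_eball, edist_eq_enorm_sub] using hx
  have h2 := hP.hasSum_iteratedFDeriv hy
  simp only [hz] at h2
  have h3 : HasSum (fun _ : ℕ => (0:F)) (g x) := by
    convert h2 using 1
    · ext n; simp
    · simp
  exact h3.unique hasSum_zero

/-- linear coordinates adapted to a functional -/
theorem exists_coord {E : Type} [NormedAddCommGroup E] [NormedSpace ℝ E]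
    [FiniteDimensional ℝ E] {n : ℕ} (hE : Module.finrank ℝ E = n + 1) (l : E →L[ℝ] ℝ)
    (hl : l ≠ 0) : ∃ S : E ≃L[ℝ] ℝ × EuclideanSpace ℝ (Fin n), ∀ x, (S x).1 = l x := by
  have hsurj : LinearMap.range (l : E →ₗ[ℝ] ℝ) = ⊤ := 
    LinearMap.range_eq_top.2 (LinearMap.surjective (fun h => hl (by ext x; exact congrArg (fun g => g x) h)))
  have hk : Module.finrank ℝ (LinearMap.ker (l : E →ₗ[ℝ] ℝ)) = n := by
    have := LinearMap.finrank_range_add_finrank_ker (l : E →ₗ[ℝ] ℝ)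
    rw [hsurj, finrank_top, hE, Module.finrank_self] at this
    omega
  obtain ⟨e⟩ : Nonempty (LinearMap.ker (l : E →ₗ[ℝ] ℝ) ≃ₗ[ℝ] EuclideanSpace ℝ (Fin n)) :=
    FiniteDimensional.nonempty_linearEquiv_of_finrank_eq (by simp [hk])
  obtain ⟨π, hπ⟩ := (LinearMap.ker (l : E →ₗ[ℝ] ℝ)).subtype.exists_leftInverse_of_injective
    (Submodule.ker_subtype _)
  let L : E →ₗ[ℝ] ℝ × EuclideanSpace ℝ (Fin n) :=
    (l : E →ₗ[ℝ] ℝ).prod ((e : _ →ₗ[ℝ] _) ∘ₗ π)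
  have hinj : Function.Injective L := by
    rw [← LinearMap.ker_eq_bot, LinearMap.ker_eq_bot']
    intro x hx
    have h1 : l x = 0 := congrArg Prod.fst hx
    have h2 : e (π x) = 0 := congrArg Prod.snd hx
    have h3 : π x = 0 := by simpa using h2
    have h4 : π x = ⟨x, h1⟩ := congrArg (fun g => g ⟨x, h1⟩) hπ
    rw [h3] at h4
    exact (congrArg Subtype.val h4).symm
  have hfr : Module.finrank ℝ E = Module.finrank ℝ (ℝ × EuclideanSpace ℝ (Fin n)) := by
    simp [hE, add_comm]
  refine ⟨(LinearMap.linearEquivOfInjective L hinj hfr).toContinuousLinearEquiv, fun x => ?_⟩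
  rfl

theorem straighten {E : Type} [NormedAddCommGroup E] [NormedSpace ℝ E]
    [FiniteDimensional ℝ E] {n : ℕ} (hE : Module.finrank ℝ E = n + 1) {h : E → ℝ} {U : Set E}
    (hU : IsOpen U) (hh : AnalyticOnNhd ℝ h U) {p : E} (hp : p ∈ U) (hd : fderiv ℝ h p ≠ 0) :
    ∃ Φ : OpenPartialHomeomorph E (ℝ × EuclideanSpace ℝ (Fin n)), p ∈ Φ.source ∧ Φ.source ⊆ U ∧
      (∀ y, (Φ y).1 = h y) ∧ AnalyticOnNhd ℝ Φ Φ.source ∧ AnalyticOnNhd ℝ Φ.symm Φ.target := by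
  obtain ⟨S, hS⟩ := exists_coord hE _ hd
  let g : E → ℝ × EuclideanSpace ℝ (Fin n) := fun y => (h y, (S y).2)
  have hg : AnalyticOnNhd ℝ g U := by
    intro y hy
    refine (hh y hy).prod ?_
    exact ((ContinuousLinearMap.snd ℝ ℝ (EuclideanSpace ℝ (Fin n))).comp
      (S : E →L[ℝ] ℝ × EuclideanSpace ℝ (Fin n))).analyticAt y
  have hgS : fderiv ℝ g p = (S : E →L[ℝ] ℝ × EuclideanSpace ℝ (Fin n)) := by
    have h1 : HasFDerivAt g ((fderiv ℝ h p).prod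
      ((ContinuousLinearMap.snd ℝ ℝ (EuclideanSpace ℝ (Fin n))).comp
      (S : E →L[ℝ] ℝ × EuclideanSpace ℝ (Fin n)))) p :=
      ((hh p hp).differentiableAt.hasFDerivAt).prodMk
      ((ContinuousLinearMap.snd ℝ ℝ (EuclideanSpace ℝ (Fin n))).comp
      (S : E →L[ℝ] ℝ × EuclideanSpace ℝ (Fin n))).hasFDerivAt
    rw [h1.fderiv]
    ext x
    · exact (hS x).symm
    · rfl
  have hstrict : HasStrictFDerivAt g (S : E →L[ℝ] ℝ × EuclideanSpace ℝ (Fin n)) p := by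
    rw [← hgS]; exact (hg p hp).hasStrictFDerivAt
  let Φ₀ := hstrict.toOpenPartialHomeomorph g
  let R : Set (E →L[ℝ] ℝ × EuclideanSpace ℝ (Fin n)) :=
    range ((↑) : (E ≃L[ℝ] ℝ × EuclideanSpace ℝ (Fin n)) → (E →L[ℝ] ℝ × EuclideanSpace ℝ (Fin n)))
  have hRo : IsOpen R := ContinuousLinearEquiv.isOpen
  let V : Set E := U ∩ (fderiv ℝ g) ⁻¹' R
  have hV : IsOpen V := hg.fderiv.continuousOn.isOpen_inter_preimage hU hRo
  have hpV : p ∈ V := ⟨hp, S, hgS.symm⟩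
  refine ⟨Φ₀.restrOpen V hV, ⟨hstrict.mem_toOpenPartialHomeomorph_source, hpV⟩, ?_, ?_, ?_, ?_⟩
  · intro y hy; exact hy.2.1
  · intro y; rfl
  · intro y hy; exact hg y hy.2.1
  · intro z hz
    have hy := (Φ₀.restrOpen V hV).map_target hz
    obtain ⟨i, hi⟩ := hy.2.2
    exact OpenPartialHomeomorph.analyticAt_symm _ (i := i) hz (hg _ hy.2.1) hi.symm

/-- iterated derivative in the first variable -/
noncomputable def Dt {G E : Type} [NormedAddCommGroup G] [NormedSpace ℝ G] [NormedAddCommGroup E]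
    [NormedSpace ℝ E] (F : ℝ × G → E) : ℕ → (ℝ × G → E)
  | 0 => F
  | i + 1 => fun z => fderiv ℝ (Dt F i) z (1, 0)

section cone
variable {G E : Type} [NormedAddCommGroup G] [NormedSpace ℝ G] [NormedAddCommGroup E]
    [NormedSpace ℝ E] [CompleteSpace E]

theorem Dt_analytic {F : ℝ × G → E} {N : Set (ℝ × G)} (hF : AnalyticOnNhd ℝ F N) (i : ℕ) :
    AnalyticOnNhd ℝ (Dt F i) N := by
  induction i with
  | zero => exact hF
  | succ i ih =>
    intro z hz
    exact ((ContinuousLinearMap.apply ℝ E ((1, 0) : ℝ × G)).analyticAt _).comp (ih.fderiv z hz)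

theorem Dt_hasDerivAt {F : ℝ × G → E} {N : Set (ℝ × G)} (hF : AnalyticOnNhd ℝ F N) (i : ℕ)
    {t : ℝ} {w : G} (h : (t, w) ∈ N) :
    HasDerivAt (fun s => Dt F i (s, w)) (Dt F (i + 1) (t, w)) t := by
  have h1 : HasFDerivAt (Dt F i) (fderiv ℝ (Dt F i) (t, w)) (t, w) :=
    (Dt_analytic hF i (t, w) h).differentiableAt.hasFDerivAt
  have h2 : HasDerivAt (fun s : ℝ => (s, w)) ((1, 0) : ℝ × G) t :=
    (hasDerivAt_id t).prodMk (hasDerivAt_const t w)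
  exact h1.comp_hasDerivAt t h2

theorem Dt_iteratedDeriv {F : ℝ × G → E} {N : Set (ℝ × G)} (hN : IsOpen N)
    (hF : AnalyticOnNhd ℝ F N) (w : G) (i : ℕ) : ∀ t : ℝ, (t, w) ∈ N →
    iteratedDeriv i (fun s => F (s, w)) t = Dt F i (t, w) := by
  induction i with
  | zero => intro t _; simp [Dt]
  | succ i ih =>
    intro t ht
    rw [iteratedDeriv_succ]
    have hev : iteratedDeriv i (fun s => F (s, w)) =ᶠ[𝓝 t] fun s => Dt F i (s, w) := by
      have hc : ContinuousAt (fun s : ℝ => (s, w)) t := by fun_prop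
      filter_upwards [hc.preimage_mem_nhds (hN.mem_nhds ht)] with s hs
      exact ih s hs
    rw [hev.deriv_eq]
    exact (Dt_hasDerivAt hF i ht).deriv

/-- Rolle -/
theorem rolle_iter (g : ℕ → ℝ → ℝ) (I : Set ℝ) (hI : I.OrdConnected) (h0 : (0:ℝ) ∈ I)
    (hd : ∀ i, ∀ t ∈ I, HasDerivAt (g i) (g (i + 1) t) t) (j : ℕ) :
    ∀ k, (∀ i < j, g (k + i) 0 = 0) → (∀ t ∈ I, g (k + j) t ≠ 0) →
    ∀ t ∈ I, t ≠ 0 → g k t ≠ 0 := by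
  induction j with
  | zero => intro k _ h t ht _; exact h t ht
  | succ j ih =>
    intro k hz hne t ht ht0 hgt
    have ih' := ih (k + 1) (fun i hi => by
      have := hz (i + 1) (by omega)
      rwa [show k + 1 + i = k + (i + 1) by ring]) (by
      rwa [show k + 1 + j = k + (j + 1) by ring])
    have hgk : g k 0 = 0 := hz 0 (by omega)
    rcases lt_or_gt_of_ne ht0 with hlt | hgt'
    · have hsub : Icc t 0 ⊆ I := hI.out ht h0
      obtain ⟨c, hc, hc'⟩ := exists_hasDerivAt_eq_zero (f := g k) (f' := g (k+1)) hlt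
        (fun x hx => (hd k x (hsub hx)).continuousAt.continuousWithinAt) (by rw [hgt, hgk])
        (fun x hx => hd k x (hsub (Ioo_subset_Icc_self hx)))
      exact ih' c (hsub (Ioo_subset_Icc_self hc)) hc.2.ne hc'
    · have hsub : Icc 0 t ⊆ I := hI.out h0 ht
      obtain ⟨c, hc, hc'⟩ := exists_hasDerivAt_eq_zero (f := g k) (f' := g (k+1)) hgt'
        (fun x hx => (hd k x (hsub hx)).continuousAt.continuousWithinAt) (by rw [hgt, hgk])
        (fun x hx => hd k x (hsub (Ioo_subset_Icc_self hx)))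
      exact ih' c (hsub (Ioo_subset_Icc_self hc)) hc.1.ne' hc'

theorem cone_lemma [FiniteDimensional ℝ E] (hE : 2 ≤ Module.finrank ℝ E) {F : ℝ × G → E} {w₀ : G}
    {r : ℝ} (hr : 0 < r) (hF : GoodMap F (Metric.ball ((0:ℝ), w₀) r)) {c : E}
    (hc : ∀ w ∈ Metric.ball w₀ r, F (0, w) = c) : False := by
  have hmem : ∀ t : ℝ, ∀ w : G, (t, w) ∈ Metric.ball ((0:ℝ), w₀) r ↔
      t ∈ Metric.ball (0:ℝ) r ∧ w ∈ Metric.ball w₀ r := by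
    intro t w; rw [← ball_prod_same]; rfl
  have h0r : (0:ℝ) ∈ Metric.ball (0:ℝ) r := Metric.mem_ball_self hr
  have : Nontrivial E := Module.nontrivial_of_finrank_pos (R := ℝ) (by omega)
  -- openness consequence
  have hopen : ∀ V ⊆ Metric.ball ((0:ℝ), w₀) r, IsOpen V → ∀ w ∈ Metric.ball w₀ r, (0, w) ∈ V →
      ∀ z : E, ∃ s : ℝ, s ≠ 0 ∧ c + s • z ∈ F '' V := by
    intro V hV hVo w hw hwV z
    have h1 : F '' V ∈ 𝓝 c := (hF.op V hV hVo).mem_nhds ⟨_, hwV, hc w hw⟩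
    have h2 : Tendsto (fun s : ℝ => c + s • z) (𝓝[≠] 0) (𝓝 c) := by
      have : Continuous (fun s : ℝ => c + s • z) := by fun_prop
      have h3 := this.tendsto 0
      simp only [zero_smul, add_zero] at h3
      exact h3.mono_left nhdsWithin_le_nhds
    obtain ⟨s, hs, hs0⟩ := ((h2.eventually h1).and self_mem_nhdsWithin).exists
    exact ⟨s, hs0, hs⟩
  have hex : ∃ j, ∃ w ∈ Metric.ball w₀ r, Dt F (j + 1) (0, w) ≠ 0 := by
    by_contra! hcon
    have hconst : ∀ t ∈ Metric.ball (0:ℝ) r, ∀ w ∈ Metric.ball w₀ r, F (t, w) = c := by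
      intro t ht w hw
      have han : AnalyticOnNhd ℝ (fun s : ℝ => F (s, w) - c) (Metric.ball 0 r) := by
        intro s hs
        have h1 : AnalyticAt ℝ (fun s : ℝ => (s, w)) s := analyticAt_id.prod analyticAt_const
        exact (AnalyticAt.comp_of_eq (hF.an (s, w) ((hmem s w).2 ⟨hs, hw⟩)) h1 rfl).sub analyticAt_const
      have hev : ∀ᶠ s in 𝓝 (0:ℝ), F (s, w) - c = 0 := by
        refine (han 0 h0r).eventually_zero_of_flat fun k => ?_
        rw [← norm_eq_zero, norm_iteratedFDeriv_eq_norm_iteratedDeriv, norm_eq_zero]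
        cases k with
        | zero => simp [hc w hw]
        | succ k =>
          have : iteratedDeriv (k+1) (fun s : ℝ => F (s, w) - c) = iteratedDeriv (k+1) (fun s : ℝ => F (s, w)) := by
            rw [iteratedDeriv_succ', iteratedDeriv_succ']
            congr 1
            ext s
            simp
          rw [this, Dt_iteratedDeriv hF.isOpen hF.an w (k+1) 0 ((hmem 0 w).2 ⟨h0r, hw⟩)]
          exact hcon k w hw
      have := han.eqOn_zero_of_preconnected_of_eventuallyEq_zero
        (convex_ball (0:ℝ) r).isPreconnected h0r hev ht
      exact sub_eq_zero.1 this
    obtain ⟨z, hz⟩ := exists_ne (0:E)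
    obtain ⟨s, hs, ⟨t, w⟩, htw, he⟩ := hopen _ subset_rfl hF.isOpen w₀ (Metric.mem_ball_self hr)
      (Metric.mem_ball_self hr) z
    have h1 := (hmem t w).1 htw
    rw [hconst t h1.1 w h1.2] at he
    simp [hs, hz] at he
  classical
  obtain ⟨w₁, hw₁, hne⟩ := Nat.find_spec hex
  set j := Nat.find hex with hj
  have hmin : ∀ i < j, ∀ w ∈ Metric.ball w₀ r, Dt F (i + 1) (0, w) = 0 := by
    intro i hi w hw
    by_contra h
    exact Nat.find_min hex hi ⟨w, hw, h⟩
  obtain ⟨φ, -, hφ⟩ := exists_dual_vector ℝ _ (norm_ne_zero_iff.2 hne)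
  have hφne : φ (Dt F (j + 1) (0, w₁)) ≠ 0 := by
    rw [hφ]; simpa using hne
  obtain ⟨z, hz0, hz⟩ : ∃ z : E, z ≠ 0 ∧ φ z = 0 := by
    have h1 : 0 < Module.finrank ℝ (LinearMap.ker (φ : E →ₗ[ℝ] ℝ)) := by
      have h2 := LinearMap.finrank_range_add_finrank_ker (φ : E →ₗ[ℝ] ℝ)
      have h3 := Submodule.finrank_le (LinearMap.range (φ : E →ₗ[ℝ] ℝ))
      rw [Module.finrank_self] at h3
      omega
    have := Module.nontrivial_of_finrank_pos h1
    obtain ⟨z, hz⟩ := exists_ne (0 : LinearMap.ker (φ : E →ₗ[ℝ] ℝ))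
    exact ⟨z, by simpa using hz, z.2⟩
  have hca : ContinuousAt (fun x => φ (Dt F (j + 1) x)) (0, w₁) :=
    φ.continuous.continuousAt.comp (Dt_analytic hF.an (j+1) _ ((hmem 0 w₁).2 ⟨h0r, hw₁⟩)).continuousAt
  have hev := (hca.eventually_ne hφne).and (hF.isOpen.mem_nhds ((hmem 0 w₁).2 ⟨h0r, hw₁⟩))
  obtain ⟨ε, hε, hball⟩ := Metric.eventually_nhds_iff_ball.1 hev
  obtain ⟨s, hs, ⟨t, w⟩, htw, he⟩ := hopen (Metric.ball (0, w₁) ε) (fun x hx => (hball x hx).2)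
    Metric.isOpen_ball w₁ hw₁ (Metric.mem_ball_self hε) z
  have hmem' : ∀ t : ℝ, ∀ w : G, (t, w) ∈ Metric.ball ((0:ℝ), w₁) ε ↔
      t ∈ Metric.ball (0:ℝ) ε ∧ w ∈ Metric.ball w₁ ε := by
    intro t w; rw [← ball_prod_same]; rfl
  have htw' := (hmem' t w).1 htw
  have hw : w ∈ Metric.ball w₀ r := ((hmem t w).1 (hball _ htw).2).2
  have ht0 : t ≠ 0 := by
    rintro rfl
    rw [hc w hw] at he
    simp [hs, hz0] at he
  let g : ℕ → ℝ → ℝ := fun i s => φ (Dt F i (s, w)) - (if i = 0 then φ c else 0)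
  refine rolle_iter g (Metric.ball 0 ε) (by rw [Real.ball_eq_Ioo]; exact ordConnected_Ioo)
    (Metric.mem_ball_self hε) ?_ (j + 1) 0 ?_ ?_ t htw'.1 ht0 ?_
  · intro i s hs
    have h1 := Dt_hasDerivAt hF.an i (hball _ ((hmem' s w).2 ⟨hs, htw'.2⟩)).2
    have h2 := (φ.hasFDerivAt.comp_hasDerivAt s h1).sub_const (if i = 0 then φ c else 0)
    simpa [g] using h2
  · intro i hi
    cases i with
    | zero => simp [g, Dt, hc w hw]
    | succ i => simp [g, hmin i (by omega) w hw]
  · intro s hs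
    have := (hball _ ((hmem' s w).2 ⟨hs, htw'.2⟩)).1
    simpa [g] using this
  · simp [g, Dt, he, hz]

end cone

theorem LocSign.comp {X Y : Type} [TopologicalSpace X] [TopologicalSpace Y] {J : Y → ℝ} {g : X → Y}
    {x : X} (h : LocSign J (g x)) (hg : ContinuousAt g x) : LocSign (fun z => J (g z)) x := by
  obtain ⟨V, hV, hs⟩ := h
  exact ⟨g ⁻¹' V, hg.preimage_mem_nhds hV,
    hs.imp (fun h z hz => h _ hz) (fun h z hz => h _ hz)⟩

theorem LocSign.congr {X : Type} [TopologicalSpace X] {J K : X → ℝ} {x : X}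
    (h : LocSign J x) (hJK : J =ᶠ[𝓝 x] K) : LocSign K x := by
  obtain ⟨V, hV, hs⟩ := h
  refine ⟨V ∩ {y | J y = K y}, inter_mem hV hJK, ?_⟩
  exact hs.imp (fun h z hz => by rw [← hz.2]; exact h _ hz.1)
    (fun h z hz => by rw [← hz.2]; exact h _ hz.1)

theorem locSign_symm_iff {X Y : Type} [TopologicalSpace X] [TopologicalSpace Y]
    (Φ : OpenPartialHomeomorph X Y) {J : X → ℝ} {z : Y} (hz : z ∈ Φ.target) :
    LocSign (fun z => J (Φ.symm z)) z ↔ LocSign J (Φ.symm z) := by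
  constructor
  · intro h
    have h1 : LocSign (fun z => J (Φ.symm z)) (Φ (Φ.symm z)) := by rwa [Φ.right_inv hz]
    have h2 := h1.comp (Φ.continuousAt (Φ.map_target hz))
    refine h2.congr ?_
    filter_upwards [Φ.open_source.mem_nhds (Φ.map_target hz)] with y hy
    rw [Φ.left_inv hy]
  · intro h
    exact h.comp (Φ.symm.continuousAt hz)

theorem LocSign.neg {X : Type} [TopologicalSpace X] {J : X → ℝ} {x : X} (h : LocSign J x) :
    LocSign (fun x => - J x) x := by
  obtain ⟨V, hV, hs⟩ := h
  refine ⟨V, hV, hs.symm.imp (fun h z hz => ?_) (fun h z hz => ?_)⟩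
  · have := h z hz; simpa using this
  · have := h z hz; simpa using this

theorem LocSign.of_neg {X : Type} [TopologicalSpace X] {J : X → ℝ} {x : X}
    (h : LocSign (fun x => - J x) x) : LocSign J x := by
  simpa using h.neg

theorem sides_aux {G : Type} [NormedAddCommGroup G] [NormedSpace ℝ G] {K : ℝ × G → ℝ} {w₀ : G}
    {r : ℝ} (hr : 0 < r) (hK : ContinuousOn K (Metric.ball ((0:ℝ), w₀) r))
    (hz : ∀ V ⊆ Metric.ball ((0:ℝ), w₀) r, IsOpen V → V.Nonempty → ∃ x ∈ V, K x ≠ 0)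
    {w₁ : G} (hw₁ : w₁ ∈ Metric.ball w₀ r)
    (hl : LocSign K (0, w₁))
    (hp : ∀ z ∈ (Metric.ball (0:ℝ) r ∩ Ioi 0) ×ˢ Metric.ball w₀ r, 0 ≤ K z)
    (hm : OneSign K ((Metric.ball (0:ℝ) r ∩ Iio 0) ×ˢ Metric.ball w₀ r)) : LocSign K (0, w₀) := by
  have hNe : Metric.ball ((0:ℝ), w₀) r = Metric.ball (0:ℝ) r ×ˢ Metric.ball w₀ r :=
    (ball_prod_same _ _ _).symm
  rw [hNe] at hK hz
  -- if `K ≥ 0` and one-signed on an overlap then nonnegative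
  have agree : ∀ A B : Set (ℝ × G), (∀ z ∈ A, 0 ≤ K z) → OneSign K B →
      (∃ V ⊆ A ∩ B, V ⊆ Metric.ball (0:ℝ) r ×ˢ Metric.ball w₀ r ∧ IsOpen V ∧ V.Nonempty) →
      ∀ z ∈ B, 0 ≤ K z := by
    rintro A B hA (hB | hB) ⟨V, hV, hVN, hVo, hVn⟩
    · exact hB
    · exfalso
      obtain ⟨x, hx, hx0⟩ := hz V hVN hVo hVn
      exact hx0 (le_antisymm (hB x (hV hx).2) (hA x (hV hx).1))
  obtain ⟨V, hV, hVs⟩ := hl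
  obtain ⟨V', hV'V, hV'o, hV'm⟩ := mem_nhds_iff.1 hV
  have hVs' := hVs.mono hV'V
  have hcont : Continuous (fun s : ℝ => (s, w₁)) := by fun_prop
  have hev : ∀ᶠ s in 𝓝 (0:ℝ), (s, w₁) ∈ V' ∧ s ∈ Metric.ball (0:ℝ) r :=
    inter_mem (hcont.continuousAt.preimage_mem_nhds (hV'o.mem_nhds hV'm)) (Metric.ball_mem_nhds 0 hr)
  have hV'p : ∀ z ∈ V', 0 ≤ K z := by
    refine agree _ _ hp hVs' ⟨((Metric.ball (0:ℝ) r ∩ Ioi 0) ×ˢ Metric.ball w₀ r) ∩ V',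
      subset_rfl, fun z hz => ⟨hz.1.1.1, hz.1.2⟩,
      ((Metric.isOpen_ball.inter isOpen_Ioi).prod Metric.isOpen_ball).inter hV'o, ?_⟩
    obtain ⟨s, hs, hs0⟩ := ((hev.filter_mono nhdsWithin_le_nhds).and
      (self_mem_nhdsWithin (a := (0:ℝ)) (s := Ioi 0))).exists
    exact ⟨(s, w₁), ⟨⟨hs.2, hs0⟩, hw₁⟩, hs.1⟩
  have hmp : ∀ z ∈ (Metric.ball (0:ℝ) r ∩ Iio 0) ×ˢ Metric.ball w₀ r, 0 ≤ K z := by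
    refine agree _ _ hV'p hm ⟨V' ∩ ((Metric.ball (0:ℝ) r ∩ Iio 0) ×ˢ Metric.ball w₀ r),
      subset_rfl, fun z hz => ⟨hz.2.1.1, hz.2.2⟩,
      hV'o.inter ((Metric.isOpen_ball.inter isOpen_Iio).prod Metric.isOpen_ball), ?_⟩
    obtain ⟨s, hs, hs0⟩ := ((hev.filter_mono nhdsWithin_le_nhds).and
      (self_mem_nhdsWithin (a := (0:ℝ)) (s := Iio 0))).exists
    exact ⟨(s, w₁), hs.1, ⟨⟨hs.2, hs0⟩, hw₁⟩⟩
  refine ⟨Metric.ball (0:ℝ) r ×ˢ Metric.ball w₀ r, ?_, Or.inl ?_⟩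
  · rw [← hNe]; exact Metric.ball_mem_nhds _ hr
  · rintro ⟨t, w⟩ ⟨ht, hw⟩
    rcases lt_trichotomy t 0 with h | h | h
    · exact hmp _ ⟨⟨ht, h⟩, hw⟩
    · subst h
      have hca : ContinuousAt K (0, w) :=
        hK.continuousAt ((Metric.isOpen_ball.prod Metric.isOpen_ball).mem_nhds ⟨ht, hw⟩)
      have hcont : Continuous (fun s : ℝ => (s, w)) := by fun_prop
      have ht' : Tendsto (fun s : ℝ => K (s, w)) (𝓝[>] 0) (𝓝 (K (0, w))) :=
        (ContinuousAt.comp_of_eq hca (hcont.continuousAt (x := 0)) rfl).tendsto.mono_left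
          nhdsWithin_le_nhds
      refine ge_of_tendsto ht' ?_
      filter_upwards [self_mem_nhdsWithin, mem_nhdsWithin_of_mem_nhds (Metric.ball_mem_nhds 0 hr)]
        with s hs hs'
      exact hp _ ⟨⟨hs', hs⟩, hw⟩
    · exact hp _ ⟨⟨ht, h⟩, hw⟩

theorem sides {G : Type} [NormedAddCommGroup G] [NormedSpace ℝ G] {K : ℝ × G → ℝ} {w₀ : G}
    {r : ℝ} (hr : 0 < r) (hK : ContinuousOn K (Metric.ball ((0:ℝ), w₀) r))
    (hz : ∀ V ⊆ Metric.ball ((0:ℝ), w₀) r, IsOpen V → V.Nonempty → ∃ x ∈ V, K x ≠ 0)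
    (hoff : ∀ z ∈ Metric.ball ((0:ℝ), w₀) r, z.1 ≠ 0 → LocSign K z)
    (hp : ¬ LocSign K (0, w₀)) {w₁ : G} (hw₁ : w₁ ∈ Metric.ball w₀ r) : ¬ LocSign K (0, w₁) := by
  intro hl
  have hNe : Metric.ball ((0:ℝ), w₀) r = Metric.ball (0:ℝ) r ×ˢ Metric.ball w₀ r :=
    (ball_prod_same _ _ _).symm
  have h1 : OneSign K ((Metric.ball (0:ℝ) r ∩ Ioi 0) ×ˢ Metric.ball w₀ r) := by
    have hs : (Metric.ball (0:ℝ) r ∩ Ioi 0) ×ˢ Metric.ball w₀ r ⊆ Metric.ball ((0:ℝ), w₀) r := by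
      rw [hNe]; exact fun z hz => ⟨hz.1.1, hz.2⟩
    exact oneSign_of_locSign ((Metric.isOpen_ball.inter isOpen_Ioi).prod Metric.isOpen_ball)
      (((convex_ball _ _).inter (convex_Ioi _)).prod (convex_ball _ _)).isPreconnected
      (fun z hz => hoff z (hs hz) hz.1.2.ne') (fun V hV => hz V (hV.trans hs))
  have h2 : OneSign K ((Metric.ball (0:ℝ) r ∩ Iio 0) ×ˢ Metric.ball w₀ r) := by
    have hs : (Metric.ball (0:ℝ) r ∩ Iio 0) ×ˢ Metric.ball w₀ r ⊆ Metric.ball ((0:ℝ), w₀) r := by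
      rw [hNe]; exact fun z hz => ⟨hz.1.1, hz.2⟩
    exact oneSign_of_locSign ((Metric.isOpen_ball.inter isOpen_Iio).prod Metric.isOpen_ball)
      (((convex_ball _ _).inter (convex_Iio _)).prod (convex_ball _ _)).isPreconnected
      (fun z hz => hoff z (hs hz) hz.1.2.ne) (fun V hV => hz V (hV.trans hs))
  rcases h1 with h1 | h1
  · exact hp (sides_aux hr hK hz hw₁ hl h1 h2)
  · refine hp (LocSign.of_neg (sides_aux hr hK.neg ?_ hw₁ hl.neg ?_ ?_))
    · intro V a b c
      obtain ⟨x, hx, h⟩ := hz V a b c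
      exact ⟨x, hx, neg_ne_zero.2 h⟩
    · intro z hz; have := h1 z hz; simpa using this
    · refine h2.symm.imp (fun h z hz => ?_) (fun h z hz => ?_)
      · have := h z hz; simpa using this
      · have := h z hz; simpa using this

theorem GoodMap.comp_symm {E F X : Type} [NormedAddCommGroup E] [NormedSpace ℝ E]
    [NormedAddCommGroup F] [NormedSpace ℝ F] [NormedAddCommGroup X] [NormedSpace ℝ X]
    {f : E → F} {U : Set E} (h : GoodMap f U) (Φ : OpenPartialHomeomorph E X)
    (hΦ : Φ.source ⊆ U) (ha : AnalyticOnNhd ℝ Φ.symm Φ.target) :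
    GoodMap (fun z => f (Φ.symm z)) Φ.target := by
  refine ⟨Φ.open_target, fun z hz => ?_, fun V hV hVo => ?_⟩
  · exact (h.an _ (hΦ (Φ.map_target hz))).comp (ha z hz)
  · have : (fun z => f (Φ.symm z)) '' V = f '' (Φ.symm '' V) := by rw [image_image]
    rw [this]
    refine h.op _ ?_ (Φ.isOpen_image_symm_of_subset_target hVo hV)
    rintro _ ⟨z, hz, rfl⟩
    exact hΦ (Φ.map_target (hV hz))

theorem continuous_det {E : Type} [NormedAddCommGroup E] [NormedSpace ℝ E]
    [FiniteDimensional ℝ E] : Continuous (fun A : E →L[ℝ] E => A.det) :=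
  ContinuousLinearMap.continuous_det

theorem rankzero_step {E : Type} [NormedAddCommGroup E] [NormedSpace ℝ E]
    [FiniteDimensional ℝ E] {n : ℕ} (hE : Module.finrank ℝ E = n + 1) (hn : 1 ≤ n)
    {f : E → E} {U : Set E} (hf : GoodMap f U)
    (hB : ∀ p ∈ U, ¬ LocSign (fun x => (fderiv ℝ f x).det) p → fderiv ℝ f p = 0) :
    ∀ p ∈ U, LocSign (fun x => (fderiv ℝ f x).det) p := by
  intro p₀ hp₀
  by_contra hp₀B
  set J : E → ℝ := fun x => (fderiv ℝ f x).det with hJ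
  have hg := hf.an.fderiv
  have hex : ∃ k, ∃ p ∈ U, ¬ LocSign J p ∧ iteratedFDeriv ℝ k (fderiv ℝ f) p ≠ 0 := by
    by_contra! hcon
    have := (hg p₀ hp₀).eventually_zero_of_flat (fun k => hcon k p₀ hp₀ hp₀B)
    refine hp₀B ⟨_, this, Or.inl fun x hx => ?_⟩
    have hx' : fderiv ℝ f x = 0 := hx
    simp only [hJ, hx']
    rw [ContinuousLinearMap.det]
    simp [hE]
  classical
  obtain ⟨p, hp, hpB, hne⟩ := Nat.find_spec hex
  have hmin : ∀ m < Nat.find hex, ∀ q ∈ U, ¬ LocSign J q → iteratedFDeriv ℝ m (fderiv ℝ f) q = 0 := by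
    intro m hm q hq hqB
    by_contra h
    exact Nat.find_min hex hm ⟨q, hq, hqB, h⟩
  generalize Nat.find hex = k at hne hmin
  cases k with
  | zero =>
    apply hne
    ext m
    simp [hB p hp hpB]
  | succ m =>
  have hz := hmin m (by omega)
  set g₀ := iteratedFDeriv ℝ m (fderiv ℝ f) with hg₀
  have hg₀a : AnalyticOnNhd ℝ g₀ U := hg.iteratedFDeriv m
  have hd : fderiv ℝ g₀ p ≠ 0 := by
    intro h
    apply hne
    refine ContinuousMultilinearMap.ext fun v => ?_
    rw [iteratedFDeriv_succ_apply_left, ← hg₀, h]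
    rfl
  obtain ⟨e, he⟩ : ∃ e, fderiv ℝ g₀ p e ≠ 0 := by
    by_contra! h
    exact hd (ContinuousLinearMap.ext h)
  obtain ⟨φ, -, hφ⟩ := exists_dual_vector ℝ _ (norm_ne_zero_iff.2 he)
  have hφne : φ (fderiv ℝ g₀ p e) ≠ 0 := by
    rw [hφ]; simpa using he
  let h : E → ℝ := fun x => φ (g₀ x)
  have hh : AnalyticOnNhd ℝ h U := fun x hx => (φ.analyticAt _).comp (hg₀a x hx)
  have hhd : fderiv ℝ h p ≠ 0 := by
    have h1 : HasFDerivAt h (φ.comp (fderiv ℝ g₀ p)) p :=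
      φ.hasFDerivAt.comp p (hg₀a p hp).differentiableAt.hasFDerivAt
    rw [h1.fderiv]
    intro h2
    exact hφne (by simpa using congrArg (fun l => l e) h2)
  have hh0 : ∀ q ∈ U, ¬ LocSign J q → h q = 0 := by
    intro q hq hqB
    simp [h, hz q hq hqB]
  obtain ⟨Φ, hpΦ, hΦU, hΦ1, hΦa, hΨa⟩ := straighten hE hf.isOpen hh hp hhd
  obtain ⟨w₀, hw₀⟩ : ∃ w₀, Φ p = (0, w₀) :=
    ⟨(Φ p).2, Prod.ext ((hΦ1 p).trans (hh0 p hp hpB)) rfl⟩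
  obtain ⟨r, hr, hrN⟩ := Metric.isOpen_iff.1 Φ.open_target (Φ p) (Φ.map_source hpΦ)
  rw [hw₀] at hrN
  have hmem : ∀ t : ℝ, ∀ w, (t, w) ∈ Metric.ball ((0:ℝ), w₀) r ↔
      t ∈ Metric.ball (0:ℝ) r ∧ w ∈ Metric.ball w₀ r := by
    intro t w; rw [← ball_prod_same]; rfl
  have hΨU : ∀ z ∈ Metric.ball ((0:ℝ), w₀) r, Φ.symm z ∈ U := fun z hz =>
    hΦU (Φ.map_target (hrN hz))
  have hJc : ContinuousOn J U := continuous_det.comp_continuousOn hg.continuousOn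
  have hM : ∀ w ∈ Metric.ball w₀ r, ¬ LocSign (fun z => J (Φ.symm z)) (0, w) := by
    intro w hw
    refine sides hr ?_ ?_ ?_ ?_ hw
    · exact hJc.comp (Φ.continuousOn_symm.mono hrN) hΨU
    · intro V hV hVo hVn
      obtain ⟨x, ⟨z, hz, rfl⟩, hx⟩ := hf.exists_det_ne_zero (Φ.symm '' V)
        (by rintro _ ⟨z, hz, rfl⟩; exact hΨU z (hV hz))
        (Φ.isOpen_image_symm_of_subset_target hVo (hV.trans hrN)) (hVn.image _)
      exact ⟨z, hz, hx⟩
    · intro z hz hz1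
      rw [locSign_symm_iff Φ (hrN hz)]
      by_contra hcon
      apply hz1
      rw [← Φ.right_inv (hrN hz), hΦ1]
      exact hh0 _ (hΨU z hz) hcon
    · rw [locSign_symm_iff Φ (hrN (Metric.mem_ball_self hr)), ← hw₀, Φ.left_inv hpΦ]
      exact hpB
  have hF := (hf.comp_symm Φ hΦU hΨa).mono Metric.isOpen_ball hrN
  have hz0 : (0:ℝ) ∈ Metric.ball (0:ℝ) r := Metric.mem_ball_self hr
  have hder : ∀ w ∈ Metric.ball w₀ r, HasFDerivAt (fun w => f (Φ.symm ((0:ℝ), w)))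
      (0 : EuclideanSpace ℝ (Fin n) →L[ℝ] E) w := by
    intro w hw
    have hN := (hmem 0 w).2 ⟨hz0, hw⟩
    have h0 : fderiv ℝ f (Φ.symm (0, w)) = 0 := by
      refine hB _ (hΨU _ hN) ?_
      have := hM w hw
      rwa [locSign_symm_iff Φ (hrN hN)] at this
    have h1 : HasFDerivAt f (0 : E →L[ℝ] E) (Φ.symm (0, w)) := by
      rw [← h0]; exact (hf.an _ (hΨU _ hN)).differentiableAt.hasFDerivAt
    have h2 := (hΨa _ (hrN hN)).differentiableAt.hasFDerivAt
    have h3 : HasFDerivAt (fun w : EuclideanSpace ℝ (Fin n) => ((0:ℝ), w))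
      (ContinuousLinearMap.inr ℝ ℝ (EuclideanSpace ℝ (Fin n))) w :=
      (ContinuousLinearMap.inr ℝ ℝ (EuclideanSpace ℝ (Fin n))).hasFDerivAt
    have h4 := h1.comp w (HasFDerivAt.comp (x := w) h2 h3)
    simpa using! h4
  obtain ⟨c, hc⟩ := Metric.isOpen_ball.exists_is_const_of_fderiv_eq_zero (𝕜 := ℝ)
    (f := fun w => f (Φ.symm ((0:ℝ), w)))
    (convex_ball w₀ r).isPreconnected
    (fun w hw => (hder w hw).differentiableAt.differentiableWithinAt)
    (fun w hw => (hder w hw).fderiv)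
  exact cone_lemma (by omega) hr hF hc

def PProp (n : ℕ) : Prop :=
  ∀ (E : Type) [NormedAddCommGroup E] [NormedSpace ℝ E] [FiniteDimensional ℝ E],
    Module.finrank ℝ E = n → ∀ (f : E → E) (U : Set E), GoodMap f U →
    ∀ p ∈ U, LocSign (fun x => (fderiv ℝ f x).det) p

theorem det_triangular {G : Type} [NormedAddCommGroup G] [NormedSpace ℝ G]
    [FiniteDimensional ℝ G] (M : ℝ × G →L[ℝ] ℝ × G) (hM : ∀ x, (M x).1 = x.1) :
    M.det = ((ContinuousLinearMap.snd ℝ ℝ G).comp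
      (M.comp (ContinuousLinearMap.inr ℝ ℝ G))).det := by
  set L := (ContinuousLinearMap.snd ℝ ℝ G).comp (M.comp (ContinuousLinearMap.inr ℝ ℝ G)) with hL
  have h1 : (M : ℝ × G →ₗ[ℝ] ℝ × G) =
      (LinearMap.transvection (LinearMap.fst ℝ ℝ G) ((0:ℝ), (M (1, 0)).2)) ∘ₗ
      (LinearMap.prodMap (LinearMap.id : ℝ →ₗ[ℝ] ℝ) (L : G →ₗ[ℝ] G)) := by
    apply LinearMap.ext
    rintro ⟨a, b⟩
    have h2 : ((a, b) : ℝ × G) = a • ((1:ℝ), (0:G)) + (0, b) := by simp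
    apply Prod.ext
    · simp [LinearMap.transvection, hM]
    · have : (M (a, b)).2 = a • (M (1, 0)).2 + (M (0, b)).2 := by
        rw [h2, map_add, map_smul]; rfl
      simp [LinearMap.transvection, this, hL, add_comm]
  rw [ContinuousLinearMap.det, h1, LinearMap.det_comp, LinearMap.transvection.det,
    LinearMap.det_prodMap]
  simp [ContinuousLinearMap.det]

theorem slices {G : Type} [NormedAddCommGroup G] [NormedSpace ℝ G] {k : ℝ × G → ℝ} {t₀ : ℝ}
    {w₀ : G} {r : ℝ} (hk : ContinuousOn k (Metric.ball (t₀, w₀) r))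
    (h1 : ∀ t ∈ Metric.ball t₀ r, OneSign (fun w => k (t, w)) (Metric.ball w₀ r))
    (h2 : ∀ t ∈ Metric.ball t₀ r, ∃ w ∈ Metric.ball w₀ r, k (t, w) ≠ 0) :
    OneSign k (Metric.ball (t₀, w₀) r) := by
  have hmem : ∀ t : ℝ, ∀ w : G, (t, w) ∈ Metric.ball (t₀, w₀) r ↔
      t ∈ Metric.ball t₀ r ∧ w ∈ Metric.ball w₀ r := by
    intro t w; rw [← ball_prod_same]; rfl
  set N := Metric.ball (t₀, w₀) r with hN
  have hP : IsOpen (Prod.fst '' (N ∩ k ⁻¹' Ioi 0)) :=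
    isOpenMap_fst _ (hk.isOpen_inter_preimage Metric.isOpen_ball isOpen_Ioi)
  have hQ : IsOpen (Prod.fst '' (N ∩ k ⁻¹' Iio 0)) :=
    isOpenMap_fst _ (hk.isOpen_inter_preimage Metric.isOpen_ball isOpen_Iio)
  by_contra hcon
  simp only [OneSign, not_or, not_forall, not_le] at hcon
  obtain ⟨⟨⟨a, wa⟩, haN, ha⟩, ⟨⟨b, wb⟩, hbN, hb⟩⟩ := hcon
  obtain ⟨t, ht, ⟨⟨t', w⟩, ⟨h3, h4⟩, rfl⟩, ⟨⟨t'', w'⟩, ⟨h5, h6⟩, h7⟩⟩ :=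
    (convex_ball t₀ r).isPreconnected _ _ hP hQ (by
    intro t ht
    obtain ⟨w, hw, hne⟩ := h2 t ht
    rcases lt_or_gt_of_ne hne with h | h
    · right; exact ⟨(t, w), ⟨(hmem t w).2 ⟨ht, hw⟩, h⟩, rfl⟩
    · left; exact ⟨(t, w), ⟨(hmem t w).2 ⟨ht, hw⟩, h⟩, rfl⟩)
    ⟨b, ((hmem _ _).1 hbN).1, (b, wb), ⟨hbN, hb⟩, rfl⟩
    ⟨a, ((hmem _ _).1 haN).1, (a, wa), ⟨haN, ha⟩, rfl⟩
  simp only at h7 ht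
  subst h7
  rcases h1 _ ht with h | h
  · exact absurd (h w' ((hmem _ _).1 h5).2) (not_le.2 h6)
  · exact absurd (h w ((hmem _ _).1 h3).2) (not_le.2 h4)

theorem reduce_step {n : ℕ} (ih : PProp n) {E : Type} [NormedAddCommGroup E] [NormedSpace ℝ E]
    [FiniteDimensional ℝ E] (hE : Module.finrank ℝ E = n + 1)
    {f : E → E} {U : Set E} (hf : GoodMap f U) {p : E} (hp : p ∈ U) (hd : fderiv ℝ f p ≠ 0) :
    LocSign (fun x => (fderiv ℝ f x).det) p := by
  obtain ⟨e, he⟩ : ∃ e, fderiv ℝ f p e ≠ 0 := by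
    by_contra! h
    exact hd (ContinuousLinearMap.ext h)
  obtain ⟨l, -, hl⟩ := exists_dual_vector ℝ _ (norm_ne_zero_iff.2 he)
  have hlne : l (fderiv ℝ f p e) ≠ 0 := by
    rw [hl]; simpa using he
  have hl0 : l ≠ 0 := by rintro rfl; exact hlne rfl
  obtain ⟨T, hT⟩ := exists_coord hE l hl0
  have hh : AnalyticOnNhd ℝ (fun x => l (f x)) U := fun x hx => (l.analyticAt _).comp (hf.an x hx)
  have hhd : fderiv ℝ (fun x => l (f x)) p ≠ 0 := by
    have h1 : HasFDerivAt (fun x => l (f x)) (l.comp (fderiv ℝ f p)) p :=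
      l.hasFDerivAt.comp p (hf.an p hp).differentiableAt.hasFDerivAt
    rw [h1.fderiv]
    intro h2
    exact hlne (by simpa using congrArg (fun l => l e) h2)
  obtain ⟨Φ, hpΦ, hΦU, hΦ1, hΦa, hΨa⟩ := straighten hE hf.isOpen hh hp hhd
  let G := EuclideanSpace ℝ (Fin n)
  -- the Jacobian factor
  let D : ℝ × G → ℝ := fun z => ((fderiv ℝ Φ.symm z).comp (T : E →L[ℝ] ℝ × G)).det
  have hDc : ContinuousOn D Φ.target := by
    refine continuous_det.comp_continuousOn ?_
    exact hΨa.fderiv.continuousOn.clm_comp continuousOn_const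
  have hD0 : D (Φ p) ≠ 0 := by
    have hcomp : (fderiv ℝ Φ.symm (Φ p)).comp (fderiv ℝ Φ p) = ContinuousLinearMap.id ℝ E := by
      have h1 := (hΨa _ (Φ.map_source hpΦ)).differentiableAt.hasFDerivAt.comp p
        (hΦa p hpΦ).differentiableAt.hasFDerivAt
      have h2 : HasFDerivAt (Φ.symm ∘ Φ) (ContinuousLinearMap.id ℝ E) p := by
        refine (hasFDerivAt_id p).congr_of_eventuallyEq ?_
        filter_upwards [Φ.open_source.mem_nhds hpΦ] with y hy
        exact Φ.left_inv hy
      exact h1.unique h2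
    intro h0
    have h3 : ((fderiv ℝ Φ.symm (Φ p)).comp (T : E →L[ℝ] ℝ × G)).comp
        ((T.symm : ℝ × G →L[ℝ] E).comp (fderiv ℝ Φ p)) = ContinuousLinearMap.id ℝ E := by
      rw [← hcomp]; ext x; simp
    have h4 : (((fderiv ℝ Φ.symm (Φ p)).comp (T : E →L[ℝ] ℝ × G) : E →L[ℝ] E) : E →ₗ[ℝ] E) ∘ₗ
        (((T.symm : ℝ × G →L[ℝ] E).comp (fderiv ℝ Φ p) : E →L[ℝ] E) : E →ₗ[ℝ] E) =
        LinearMap.id := LinearMap.ext fun x => congrArg (fun A : E →L[ℝ] E => A x) h3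
    have h5 := congrArg LinearMap.det h4
    rw [LinearMap.det_comp, LinearMap.det_id] at h5
    have h6 : LinearMap.det
      (((fderiv ℝ Φ.symm (Φ p)).comp (T : E →L[ℝ] ℝ × G) : E →L[ℝ] E) : E →ₗ[ℝ] E) = 0 := h0
    rw [h6, zero_mul] at h5
    exact zero_ne_one h5
  let k : ℝ × G → ℝ := fun z => (fderiv ℝ f (Φ.symm z)).det * D z
  -- choose the box
  have hev : ∀ᶠ z in 𝓝 (Φ p), z ∈ Φ.target ∧ 0 < D z * D (Φ p) := by
    have h0 : ∀ᶠ z in 𝓝 (Φ p), z ∈ Φ.target := Φ.open_target.mem_nhds (Φ.map_source hpΦ)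
    refine h0.and ?_
    have h1 : ContinuousAt (fun z => D z * D (Φ p)) (Φ p) :=
      (hDc.continuousAt (Φ.open_target.mem_nhds (Φ.map_source hpΦ))).mul continuousAt_const
    exact h1.eventually (lt_mem_nhds (mul_self_pos.2 hD0))
  obtain ⟨r, hr, hrN⟩ := Metric.eventually_nhds_iff_ball.1 hev
  obtain ⟨⟨t₀, w₀⟩, htw⟩ : ∃ z, z = Φ p := ⟨_, rfl⟩
  rw [← htw] at hrN hD0
  have hmem : ∀ t : ℝ, ∀ w : G, (t, w) ∈ Metric.ball (t₀, w₀) r ↔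
      t ∈ Metric.ball t₀ r ∧ w ∈ Metric.ball w₀ r := by
    intro t w; rw [← ball_prod_same]; rfl
  have hF := (hf.comp_symm Φ hΦU hΨa).mono Metric.isOpen_ball (fun z hz => (hrN z hz).1)
  let Q : ℝ × G → ℝ × G := fun z => T (f (Φ.symm z))
  have hQ1 : ∀ z ∈ Metric.ball (t₀, w₀) r, (Q z).1 = z.1 := by
    intro z hz
    have : (Q z).1 = l (f (Φ.symm z)) := hT _
    rw [this, ← hΦ1, Φ.right_inv (hrN z hz).1]
  have hQa : AnalyticOnNhd ℝ Q (Metric.ball (t₀, w₀) r) := fun z hz =>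
    ((T : E →L[ℝ] ℝ × G).analyticAt _).comp (hF.an z hz)
  have hQo : ∀ V ⊆ Metric.ball (t₀, w₀) r, IsOpen V → IsOpen (Q '' V) := by
    intro V hV hVo
    have : Q '' V = T '' ((fun z => f (Φ.symm z)) '' V) := by rw [image_image]
    rw [this]
    exact T.toHomeomorph.isOpenMap _ (hF.op V hV hVo)
  -- slices
  have hslice : ∀ t ∈ Metric.ball t₀ r, GoodMap (fun w => (Q (t, w)).2) (Metric.ball w₀ r) := by
    intro t ht
    refine ⟨Metric.isOpen_ball, fun w hw => ?_, fun W hW hWo => ?_⟩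
    · have h1 : AnalyticAt ℝ (fun w : G => (t, w)) w := analyticAt_const.prod analyticAt_id
      have h2 := AnalyticAt.comp_of_eq (hQa (t, w) ((hmem t w).2 ⟨ht, hw⟩)) h1 rfl
      exact ((ContinuousLinearMap.snd ℝ ℝ G).analyticAt _).comp h2
    · have h1 : IsOpen (Q '' (Metric.ball t₀ r ×ˢ W)) :=
        hQo _ (fun z hz => (hmem z.1 z.2).2 ⟨hz.1, hW hz.2⟩) (Metric.isOpen_ball.prod hWo)
      have h2 : (fun w => (Q (t, w)).2) '' W =
          (fun y : G => (t, y)) ⁻¹' (Q '' (Metric.ball t₀ r ×ˢ W)) := by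
        ext y
        constructor
        · rintro ⟨w, hw, rfl⟩
          exact ⟨(t, w), ⟨ht, hw⟩,
            Prod.ext (hQ1 (t, w) ((hmem t w).2 ⟨ht, hW hw⟩)) rfl⟩
        · rintro ⟨⟨t', w⟩, ⟨ht', hw⟩, h⟩
          have h3 := hQ1 (t', w) ((hmem t' w).2 ⟨ht', hW hw⟩)
          rw [h] at h3
          simp only at h3
          subst h3
          exact ⟨w, hw, congrArg Prod.snd h⟩
      rw [h2]
      exact h1.preimage (by fun_prop)
  have hdet : ∀ t ∈ Metric.ball t₀ r, ∀ w ∈ Metric.ball w₀ r,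
      (fderiv ℝ (fun w => (Q (t, w)).2) w).det = k (t, w) := by
    intro t ht w hw
    have hN := (hmem t w).2 ⟨ht, hw⟩
    have hQd : HasFDerivAt Q (fderiv ℝ Q (t, w)) (t, w) :=
      (hQa _ hN).differentiableAt.hasFDerivAt
    have hM1 : ∀ x, (fderiv ℝ Q (t, w) x).1 = x.1 := by
      have h1 : HasFDerivAt (fun z => (Q z).1)
          ((ContinuousLinearMap.fst ℝ ℝ G).comp (fderiv ℝ Q (t, w))) (t, w) :=
        (ContinuousLinearMap.fst ℝ ℝ G).hasFDerivAt.comp _ hQd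
      have h2 : HasFDerivAt (fun z => (Q z).1) (ContinuousLinearMap.fst ℝ ℝ G) (t, w) := by
        refine (ContinuousLinearMap.fst ℝ ℝ G).hasFDerivAt.congr_of_eventuallyEq ?_
        filter_upwards [Metric.isOpen_ball.mem_nhds hN] with z hz
        exact hQ1 z hz
      intro x
      exact congrArg (fun A => A x) (h1.unique h2)
    have hv : HasFDerivAt (fun w => (Q (t, w)).2) ((ContinuousLinearMap.snd ℝ ℝ G).comp
        ((fderiv ℝ Q (t, w)).comp (ContinuousLinearMap.inr ℝ ℝ G))) w := by
      have h3 : HasFDerivAt (fun w : G => (t, w)) (ContinuousLinearMap.inr ℝ ℝ G) w :=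
        hasFDerivAt_prodMk_right t w
      exact (ContinuousLinearMap.snd ℝ ℝ G).hasFDerivAt.comp w (HasFDerivAt.comp (x := w) hQd h3)
    rw [hv.fderiv, ← det_triangular _ hM1]
    have hQ2 : fderiv ℝ Q (t, w) = (T : E →L[ℝ] ℝ × G).comp
        ((fderiv ℝ f (Φ.symm (t, w))).comp (fderiv ℝ Φ.symm (t, w))) := by
      have h1 := (hf.an _ (hΦU (Φ.map_target (hrN _ hN).1))).differentiableAt.hasFDerivAt.comp (t, w)
        (hΨa _ (hrN _ hN).1).differentiableAt.hasFDerivAt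
      exact ((T : E →L[ℝ] ℝ × G).hasFDerivAt.comp (t, w) h1).fderiv
    rw [hQ2]
    set A := fderiv ℝ f (Φ.symm (t, w))
    set B := fderiv ℝ Φ.symm (t, w) with hB
    have h5 := LinearMap.det_conj ((A : E →ₗ[ℝ] E) ∘ₗ ((B : ℝ × G →ₗ[ℝ] E) ∘ₗ
      ((T : E →L[ℝ] ℝ × G) : E →ₗ[ℝ] ℝ × G))) T.toLinearEquiv
    rw [LinearMap.det_comp] at h5
    have h6 : k (t, w) = LinearMap.det (A : E →ₗ[ℝ] E) *
        LinearMap.det ((B : ℝ × G →ₗ[ℝ] E) ∘ₗ ((T : E →L[ℝ] ℝ × G) : E →ₗ[ℝ] ℝ × G)) := rfl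
    rw [h6, ← h5, ContinuousLinearMap.det]
    congr 1
    ext x <;> simp
  have hkc : ContinuousOn k (Metric.ball (t₀, w₀) r) := by
    refine ContinuousOn.mul ?_ (hDc.mono fun z hz => (hrN z hz).1)
    refine continuous_det.comp_continuousOn (hf.an.fderiv.continuousOn.comp
      (Φ.continuousOn_symm.mono fun z hz => (hrN z hz).1)
      (fun z hz => hΦU (Φ.map_target (hrN z hz).1)))
  have hone : OneSign k (Metric.ball (t₀, w₀) r) := by
    refine slices hkc (fun t ht => ?_) (fun t ht => ?_)
    · have h1 : OneSign (fun w => (fderiv ℝ (fun w => (Q (t, w)).2) w).det) (Metric.ball w₀ r) :=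
        oneSign_of_locSign Metric.isOpen_ball (convex_ball _ _).isPreconnected
          (ih G (by simp [G]) _ _ (hslice t ht))
          (fun V hV => (hslice t ht).exists_det_ne_zero V hV)
      exact h1.imp (fun h w hw => by have := h w hw; simp only [hdet t ht w hw] at this; exact this)
        (fun h w hw => by have := h w hw; simp only [hdet t ht w hw] at this; exact this)
    · obtain ⟨w, hw, h⟩ := (hslice t ht).exists_det_ne_zero _ subset_rfl Metric.isOpen_ball
        ⟨w₀, Metric.mem_ball_self hr⟩
      exact ⟨w, hw, by rwa [← hdet t ht w hw]⟩
  have hfin : LocSign (fun z => (fderiv ℝ f (Φ.symm z)).det) (t₀, w₀) := by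
    refine ⟨Metric.ball (t₀, w₀) r, Metric.ball_mem_nhds _ hr, ?_⟩
    rcases lt_or_gt_of_ne hD0 with hneg | hpos
    · have hDn : ∀ z ∈ Metric.ball (t₀, w₀) r, D z < 0 := fun z hz => by
        have := (hrN z hz).2
        by_contra h
        nlinarith
      refine hone.symm.imp (fun h z hz => ?_) (fun h z hz => ?_)
      · have h1 : (fderiv ℝ f (Φ.symm z)).det * D z ≤ 0 := h z hz
        have h2 := hDn z hz
        by_contra h3
        nlinarith
      · have h1 : 0 ≤ (fderiv ℝ f (Φ.symm z)).det * D z := h z hz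
        have h2 := hDn z hz
        by_contra h3
        nlinarith
    · have hDp : ∀ z ∈ Metric.ball (t₀, w₀) r, 0 < D z := fun z hz => by
        have := (hrN z hz).2
        by_contra h
        nlinarith
      refine hone.imp (fun h z hz => ?_) (fun h z hz => ?_)
      · have h1 : 0 ≤ (fderiv ℝ f (Φ.symm z)).det * D z := h z hz
        have h2 := hDp z hz
        by_contra h3
        nlinarith
      · have h1 : (fderiv ℝ f (Φ.symm z)).det * D z ≤ 0 := h z hz
        have h2 := hDp z hz
        by_contra h3
        nlinarith
  rw [htw, locSign_symm_iff Φ (J := fun x => (fderiv ℝ f x).det) (Φ.map_source hpΦ),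
    Φ.left_inv hpΦ] at hfin
  exact hfin

theorem PProp_one : PProp 1 := by
  intro E _ _ _ hE f U hf p hp
  let T : E ≃L[ℝ] ℝ := ContinuousLinearEquiv.ofFinrankEq (by simp [hE])
  let g : ℝ → ℝ := fun t => T (f (T.symm t))
  have hg : ∀ t, T.symm t ∈ U → HasDerivAt g (fderiv ℝ f (T.symm t)).det t := by
    intro t ht
    have h1 := (hf.an _ ht).differentiableAt.hasFDerivAt.comp t
      (T.symm : ℝ →L[ℝ] E).hasFDerivAt
    have h2 := (T : E →L[ℝ] ℝ).hasFDerivAt.comp t h1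
    have h3 := h2.hasDerivAt
    have h5 := LinearMap.det_conj (fderiv ℝ f (T.symm t) : E →ₗ[ℝ] E) T.toLinearEquiv
    rw [LinearMap.det_ring] at h5
    have h6 : (fderiv ℝ f (T.symm t)).det = (T : E →L[ℝ] ℝ) (fderiv ℝ f (T.symm t) (T.symm 1)) :=
      h5.symm
    rw [h6]
    exact h3
  have hopenV : IsOpen (T.symm ⁻¹' U) := hf.isOpen.preimage T.symm.continuous
  obtain ⟨r, hr, hrU⟩ := Metric.isOpen_iff.1 hopenV (T p) (by simpa using hp)
  have hgo : ∀ V ⊆ Metric.ball (T p) r, IsOpen V → IsOpen (g '' V) := by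
    intro V hV hVo
    have : g '' V = T '' (f '' (T.symm '' V)) := by rw [image_image, image_image]
    rw [this]
    refine T.toHomeomorph.isOpenMap _ (hf.op _ ?_ (T.symm.toHomeomorph.isOpenMap _ hVo))
    rintro _ ⟨t, ht, rfl⟩
    exact hrU (hV ht)
  have hnoext : ∀ c ∈ Metric.ball (T p) r, ¬ IsLocalExtr g c := by
    intro c hc hext
    rcases hext with h | h
    · obtain ⟨V, hV, hVo, hcV⟩ := mem_nhds_iff.1 h
      have h1 : IsOpen (g '' (V ∩ Metric.ball (T p) r)) :=
        hgo _ inter_subset_right (hVo.inter Metric.isOpen_ball)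
      have h2 := h1.mem_nhds ⟨c, ⟨hcV, hc⟩, rfl⟩
      obtain ⟨y, hy, hy'⟩ := (Filter.Eventually.and (show ∀ᶠ y in 𝓝[<] (g c),
        y ∈ g '' (V ∩ Metric.ball (T p) r) from mem_nhdsWithin_of_mem_nhds h2)
        self_mem_nhdsWithin).exists
      obtain ⟨x, hx, rfl⟩ := hy
      exact absurd (hV hx.1) (not_le.2 hy')
    · obtain ⟨V, hV, hVo, hcV⟩ := mem_nhds_iff.1 h
      have h1 : IsOpen (g '' (V ∩ Metric.ball (T p) r)) :=
        hgo _ inter_subset_right (hVo.inter Metric.isOpen_ball)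
      have h2 := h1.mem_nhds ⟨c, ⟨hcV, hc⟩, rfl⟩
      obtain ⟨y, hy, hy'⟩ := (Filter.Eventually.and (show ∀ᶠ y in 𝓝[>] (g c),
        y ∈ g '' (V ∩ Metric.ball (T p) r) from mem_nhdsWithin_of_mem_nhds h2)
        self_mem_nhdsWithin).exists
      obtain ⟨x, hx, rfl⟩ := hy
      exact absurd (hV hx.1) (not_le.2 hy')
  have hoc : (Metric.ball (T p) r).OrdConnected := by
    rw [Real.ball_eq_Ioo]; exact ordConnected_Ioo
  have hgc : ContinuousOn g (Metric.ball (T p) r) := fun t ht =>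
    (hg t (hrU ht)).continuousAt.continuousWithinAt
  have hlt : ∀ a ∈ Metric.ball (T p) r, ∀ b ∈ Metric.ball (T p) r, a < b → g a ≠ g b := by
    intro a ha b hb hab he
    have hsub := hoc.out ha hb
    obtain ⟨c, hc, hext⟩ := exists_isLocalExtr_Ioo hab (hgc.mono hsub) he
    exact hnoext c (hsub (Ioo_subset_Icc_self hc)) hext
  have hinj : InjOn g (Metric.ball (T p) r) := by
    intro a ha b hb he
    rcases lt_trichotomy a b with h | h | h
    · exact absurd he (hlt a ha b hb h)
    · exact h
    · exact absurd he.symm (hlt b hb a ha h)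
  have key : ∀ a ∈ Metric.ball (T p) r, ∀ b ∈ Metric.ball (T p) r, a < b →
      ((0 ≤ (fderiv ℝ f (T.symm a)).det ∧ 0 ≤ (fderiv ℝ f (T.symm b)).det) ∨
      ((fderiv ℝ f (T.symm a)).det ≤ 0 ∧ (fderiv ℝ f (T.symm b)).det ≤ 0)) := by
    intro a ha b hb hab
    have hsub := hoc.out ha hb
    have hA : derivWithin g (Icc a b) a = (fderiv ℝ f (T.symm a)).det :=
      (hg a (hrU ha)).hasDerivWithinAt.derivWithin (uniqueDiffOn_Icc hab a (left_mem_Icc.2 hab.le))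
    have hB : derivWithin g (Icc a b) b = (fderiv ℝ f (T.symm b)).det :=
      (hg b (hrU hb)).hasDerivWithinAt.derivWithin (uniqueDiffOn_Icc hab b (right_mem_Icc.2 hab.le))
    rw [← hA, ← hB]
    rcases (hgc.mono hsub).strictMonoOn_of_injOn_Icc' hab.le (hinj.mono hsub) with h | h
    · left; exact ⟨h.monotoneOn.derivWithin_nonneg, h.monotoneOn.derivWithin_nonneg⟩
    · right; exact ⟨h.antitoneOn.derivWithin_nonpos, h.antitoneOn.derivWithin_nonpos⟩
  refine ⟨T ⁻¹' Metric.ball (T p) r,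
    T.continuous.continuousAt.preimage_mem_nhds (Metric.ball_mem_nhds _ hr), ?_⟩
  by_contra hcon
  simp only [OneSign, not_or, not_forall, not_le] at hcon
  obtain ⟨⟨x, hx, hx'⟩, ⟨y, hy, hy'⟩⟩ := hcon
  rcases lt_trichotomy (T x) (T y) with h | h | h
  · have := key _ hx _ hy h
    simp only [ContinuousLinearEquiv.symm_apply_apply] at this
    rcases this with h | h <;> linarith [h.1, h.2]
  · have := T.injective h
    subst this
    linarith
  · have := key _ hy _ hx h
    simp only [ContinuousLinearEquiv.symm_apply_apply] at this
    rcases this with h | h <;> linarith [h.1, h.2]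

theorem PProp_all (n : ℕ) : PProp (n + 1) := by
  induction n with
  | zero => exact PProp_one
  | succ n ih =>
    intro E _ _ _ hE f U hf
    refine rankzero_step hE (by omega) hf fun p hp hpB => ?_
    by_contra h
    exact hpB (reduce_step ih hE hf hp h)

/-- **Lemma 5 (Hirsch).** If the Jacobian of a real analytic open map
`f : ℝⁿ → ℝⁿ` locally does not change sign on a connected set `Y`, then it
does not change sign on the closure of `Y`. -/
theorem local_no_sign_change_implies_no_sign_change_on_closure
    {n : ℕ} (hn : 1 ≤ n)
    (f : EuclideanSpace ℝ (Fin n) → EuclideanSpace ℝ (Fin n))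
    (hf : ∀ p, AnalyticAt ℝ f p) (hopen : IsOpenMap f)
    (Y : Set (EuclideanSpace ℝ (Fin n))) (hY : IsConnected Y)
    (hloc : ∀ p ∈ Y, ∃ W : Set (EuclideanSpace ℝ (Fin n)), IsOpen W ∧ p ∈ W ∧
      ((∀ q ∈ Y ∩ W, 0 ≤ (fderiv ℝ f q).det) ∨ (∀ q ∈ Y ∩ W, (fderiv ℝ f q).det ≤ 0))) :
    (∀ p ∈ closure Y, 0 ≤ (fderiv ℝ f p).det) ∨
      (∀ p ∈ closure Y, (fderiv ℝ f p).det ≤ 0) := by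
  have hgood : GoodMap f univ := ⟨isOpen_univ, fun p _ => hf p, fun V _ hV => hopen V hV⟩
  obtain ⟨m, rfl⟩ : ∃ m, n = m + 1 := ⟨n - 1, by omega⟩
  have h := oneSign_of_locSign isOpen_univ isPreconnected_univ
    (PProp_all m _ (by simp) f univ hgood) (fun V hV => hgood.exists_det_ne_zero V hV)
  exact h.imp (fun h p _ => h p trivial) (fun h p _ => h p trivial)
end

section
/- (Gamboa–Ronga) Let n ≥ 1 and let f : ℝⁿ → ℝⁿ be a polynomial map, i.e., each component of f is given by evaluation of a polynomial in n real variables. Then f is open if and only if both of the following hold: (1) every fiber f⁻¹({q}) is finite, and (2) the Jacobian det(df_p) does not change sign (either det(df_p) ≥ 0 for all p, or det(df_p) ≤ 0 for all p). -/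
namespace GR
open MvPolynomial

abbrev E (n : ℕ) := EuclideanSpace ℝ (Fin n)

/-- evaluation of a polynomial on Euclidean space -/
noncomputable def ev {n : ℕ} (P : MvPolynomial (Fin n) ℝ) (x : E n) : ℝ :=
  eval (fun j => x j) P

@[simp] lemma ev_add {n : ℕ} (P Q : MvPolynomial (Fin n) ℝ) (x : E n) :
    ev (P + Q) x = ev P x + ev Q x := by simp [ev]
@[simp] lemma ev_sub {n : ℕ} (P Q : MvPolynomial (Fin n) ℝ) (x : E n) :
    ev (P - Q) x = ev P x - ev Q x := by simp [ev]
@[simp] lemma ev_mul {n : ℕ} (P Q : MvPolynomial (Fin n) ℝ) (x : E n) :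
    ev (P * Q) x = ev P x * ev Q x := by simp [ev]
@[simp] lemma ev_pow {n : ℕ} (P : MvPolynomial (Fin n) ℝ) (k : ℕ) (x : E n) :
    ev (P ^ k) x = ev P x ^ k := by simp [ev]
@[simp] lemma ev_C {n : ℕ} (c : ℝ) (x : E n) : ev (C c) x = c := by simp [ev]
@[simp] lemma ev_X {n : ℕ} (i : Fin n) (x : E n) : ev (X i) x = x i := by simp [ev]
@[simp] lemma ev_zero {n : ℕ} (x : E n) : ev 0 x = 0 := by simp [ev]
@[simp] lemma ev_one {n : ℕ} (x : E n) : ev 1 x = 1 := by simp [ev]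
@[simp] lemma ev_sum {n : ℕ} {ι : Type*} (s : Finset ι) (P : ι → MvPolynomial (Fin n) ℝ)
    (x : E n) : ev (∑ i ∈ s, P i) x = ∑ i ∈ s, ev (P i) x := by simp [ev]
@[simp] lemma ev_prod {n : ℕ} {ι : Type*} (s : Finset ι) (P : ι → MvPolynomial (Fin n) ℝ)
    (x : E n) : ev (∏ i ∈ s, P i) x = ∏ i ∈ s, ev (P i) x := by simp [ev]

/-- derivative of evaluation -/
noncomputable def dev {n : ℕ} (P : MvPolynomial (Fin n) ℝ) (x : E n) : E n →L[ℝ] ℝ :=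
  ∑ l, ev (pderiv l P) x • (EuclideanSpace.proj l : E n →L[ℝ] ℝ)

lemma dev_apply {n : ℕ} (P : MvPolynomial (Fin n) ℝ) (x v : E n) :
    dev P x v = ∑ l, ev (pderiv l P) x * v l := by
  simp [dev]

lemma ev_hasFDeriv {n : ℕ} (P : MvPolynomial (Fin n) ℝ) (x : E n) :
    HasFDerivAt (ev P) (dev P x) x := by
  induction P using MvPolynomial.induction_on with
  | C a =>
    have : ev (n := n) (C a) = fun _ => a := by ext; simp
    rw [this]
    refine (hasFDerivAt_const a x).congr_fderiv ?_
    ext v; simp [dev_apply]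
  | add p q hp hq =>
    have : ev (p + q) = fun y => ev p y + ev q y := by ext; simp
    rw [this]
    refine (hp.add hq).congr_fderiv ?_
    ext v; simp [dev_apply, add_mul, Finset.sum_add_distrib]
  | mul_X p i hp =>
    have : ev (p * X i) = fun y => ev p y * (EuclideanSpace.proj i : E n →L[ℝ] ℝ) y := by
      ext; simp
    rw [this]
    refine (hp.mul (EuclideanSpace.proj i : E n →L[ℝ] ℝ).hasFDerivAt).congr_fderiv ?_
    symm
    ext v
    simp only [dev_apply, Derivation.leibniz, ev_add, smul_eq_mul, ev_mul, ev_X, add_mul,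
      Finset.sum_add_distrib, add_apply, smul_apply,
      PiLp.proj_apply, Finset.mul_sum]
    congr 1
    · rw [Finset.sum_eq_single i]
      · simp
      · intro b _ hb; simp [pderiv_X, Pi.single_apply, hb]
      · simp
    · exact Finset.sum_congr rfl fun l _ => by ring

lemma ev_contDiff {n : ℕ} {m : WithTop ℕ∞} (P : MvPolynomial (Fin n) ℝ) :
    ContDiff ℝ m (ev P) := by
  induction P using MvPolynomial.induction_on with
  | C a =>
    have : ev (n := n) (C a) = fun _ => a := by ext; simp
    rw [this]; exact contDiff_const
  | add p q hp hq =>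
    have : ev (p + q) = fun y => ev p y + ev q y := by ext; simp
    rw [this]; exact hp.add hq
  | mul_X p i hp =>
    have : ev (p * X i) = fun y => ev p y * (EuclideanSpace.proj i : E n →L[ℝ] ℝ) y := by
      ext; simp
    rw [this]; exact hp.mul (EuclideanSpace.proj i : E n →L[ℝ] ℝ).contDiff

lemma ev_continuous {n : ℕ} (P : MvPolynomial (Fin n) ℝ) : Continuous (ev P) :=
  (ev_contDiff (m := 0) P).continuous

lemma exists_ev_ne_zero {n : ℕ} {P : MvPolynomial (Fin n) ℝ} (hP : P ≠ 0) {U : Set (E n)}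
    (hU : IsOpen U) {x : E n} (hx : x ∈ U) : ∃ y ∈ U, ev P y ≠ 0 := by
  by_contra! hcon
  apply hP
  have hV : IsOpen ((WithLp.toLp 2 : (Fin n → ℝ) → E n) ⁻¹' U) :=
    hU.preimage (PiLp.continuous_toLp 2 _)
  have hxV : x.ofLp ∈ ((WithLp.toLp 2 : (Fin n → ℝ) → E n) ⁻¹' U) := by simpa using hx
  obtain ⟨ε, hε, hb⟩ := Metric.isOpen_iff.1 hV _ hxV
  refine MvPolynomial.funext_set (fun i => Metric.ball (x i) ε) (fun i => ?_) ?_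
  · rw [Real.ball_eq_Ioo]; exact Set.Ioo_infinite (by linarith)
  · intro y hy
    have : y ∈ Metric.ball x.ofLp ε := by
      rw [ball_pi _ hε]; exact hy
    have := hcon _ (hb this)
    simpa [ev] using this

/-- polynomial map -/
noncomputable def pm {n : ℕ} (P : Fin n → MvPolynomial (Fin n) ℝ) : E n → E n :=
  fun x => WithLp.toLp 2 (fun i => ev (P i) x)

@[simp] lemma pm_apply {n : ℕ} (P : Fin n → MvPolynomial (Fin n) ℝ) (x : E n) (i : Fin n) :
    pm P x i = ev (P i) x := rfl

/-- Jacobian matrix -/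
noncomputable def jm {n : ℕ} (P : Fin n → MvPolynomial (Fin n) ℝ) :
    Matrix (Fin n) (Fin n) (MvPolynomial (Fin n) ℝ) :=
  Matrix.of fun k l => pderiv l (P k)

/-- evaluated Jacobian matrix -/
noncomputable def jme {n : ℕ} (P : Fin n → MvPolynomial (Fin n) ℝ) (x : E n) :
    Matrix (Fin n) (Fin n) ℝ :=
  Matrix.of fun k l => ev (pderiv l (P k)) x

lemma ev_det {n : ℕ} (M : Matrix (Fin n) (Fin n) (MvPolynomial (Fin n) ℝ)) (x : E n) :
    ev M.det x = (M.map (fun p => ev p x)).det :=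
  RingHom.map_det (eval (fun j => x j)) M

lemma ev_adjugate {n : ℕ} (M : Matrix (Fin n) (Fin n) (MvPolynomial (Fin n) ℝ)) (x : E n)
    (i j : Fin n) :
    ev (M.adjugate i j) x = (M.map (fun p => ev p x)).adjugate i j := by
  have := RingHom.map_adjugate (eval (fun j => x j)) M
  exact congrFun (congrFun this i) j

lemma ev_jm_det {n : ℕ} (P : Fin n → MvPolynomial (Fin n) ℝ) (x : E n) :
    ev (jm P).det x = (jme P x).det := ev_det _ _

lemma ev_jm_adjugate {n : ℕ} (P : Fin n → MvPolynomial (Fin n) ℝ) (x : E n) (i j : Fin n) :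
    ev ((jm P).adjugate i j) x = (jme P x).adjugate i j := ev_adjugate _ _ _ _

/-- derivative of polynomial map -/
noncomputable def dpm {n : ℕ} (P : Fin n → MvPolynomial (Fin n) ℝ) (x : E n) : E n →L[ℝ] E n :=
  Matrix.toEuclideanCLM (𝕜 := ℝ) (jme P x)

lemma dpm_apply {n : ℕ} (P : Fin n → MvPolynomial (Fin n) ℝ) (x v : E n) (i : Fin n) :
    dpm P x v i = dev (P i) x v := by
  simp [dpm, dev_apply, jme, Matrix.mulVec, dotProduct]

lemma dpm_det {n : ℕ} (P : Fin n → MvPolynomial (Fin n) ℝ) (x : E n) :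
    (dpm P x).det = (jme P x).det := by
  have : ((dpm P x : E n →L[ℝ] E n) : E n →ₗ[ℝ] E n) =
      Matrix.toLin (PiLp.basisFun 2 ℝ (Fin n)) (PiLp.basisFun 2 ℝ (Fin n)) (jme P x) := by
    apply (PiLp.basisFun 2 ℝ (Fin n)).ext
    intro i
    rw [Matrix.toLin_self]
    ext k
    simp [dpm, Pi.single_apply]
  rw [ContinuousLinearMap.det, this, LinearMap.det_toLin]

lemma pm_hasFDeriv {n : ℕ} (P : Fin n → MvPolynomial (Fin n) ℝ) (x : E n) :
    HasFDerivAt (pm P) (dpm P x) x := by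
  rw [← hasFDerivWithinAt_univ, hasFDerivWithinAt_euclidean]
  intro i
  have := (ev_hasFDeriv (P i) x).hasFDerivWithinAt (s := Set.univ)
  refine this.congr_fderiv ?_
  ext v
  simp [dpm_apply]

lemma pm_contDiff {n : ℕ} {m : WithTop ℕ∞} (P : Fin n → MvPolynomial (Fin n) ℝ) :
    ContDiff ℝ m (pm P) := by
  rw [contDiff_euclidean]
  intro i
  exact ev_contDiff (P i)

lemma pm_continuous {n : ℕ} (P : Fin n → MvPolynomial (Fin n) ℝ) : Continuous (pm P) :=
  (pm_contDiff (m := 0) P).continuous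

end GR


namespace GR

open Set Topology in
lemma exists_infinite_fiber {V F : Type*} [NormedAddCommGroup V] [NormedSpace ℝ V]
    [FiniteDimensional ℝ V] [NormedAddCommGroup F] [NormedSpace ℝ F] [FiniteDimensional ℝ F]
    (g : V → F) (W : Set V) (hW : IsOpen W) (hne : W.Nonempty)
    (hg : ∀ x ∈ W, ContDiffAt ℝ 1 g x)
    (hk : ∀ x ∈ W, ∃ v, v ≠ 0 ∧ fderiv ℝ g x v = 0) :
    ∃ q, (W ∩ g ⁻¹' {q}).Infinite := by
  haveI : CompleteSpace V := FiniteDimensional.complete ℝ V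
  -- point of maximal rank
  obtain ⟨w, hwW, hmax⟩ : ∃ w ∈ W, ∀ x ∈ W,
      Module.finrank ℝ (LinearMap.range (fderiv ℝ g x : V →ₗ[ℝ] F)) ≤
        Module.finrank ℝ (LinearMap.range (fderiv ℝ g w : V →ₗ[ℝ] F)) := by
    let S : Set ℕ := (fun x => Module.finrank ℝ (LinearMap.range (fderiv ℝ g x : V →ₗ[ℝ] F))) '' W
    have hS : BddAbove S := by
      refine ⟨Module.finrank ℝ F, ?_⟩
      rintro _ ⟨x, _, rfl⟩
      exact Submodule.finrank_le _
    obtain ⟨w, hw, hw'⟩ := Nat.sSup_mem (hne.image _) hS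
    refine ⟨w, hw, fun x hx => ?_⟩
    have := le_csSup hS (mem_image_of_mem _ hx)
    rw [← hw'] at this
    exact this
  set R := LinearMap.range (fderiv ℝ g w : V →ₗ[ℝ] F) with hR
  obtain ⟨π', hπ'⟩ := LinearMap.exists_leftInverse_of_injective R.subtype (by simp)
  set K := LinearMap.ker (fderiv ℝ g w : V →ₗ[ℝ] F) with hK
  obtain ⟨P', hP'⟩ := LinearMap.exists_leftInverse_of_injective K.subtype (by simp)
  let π : F →L[ℝ] R := LinearMap.toContinuousLinearMap π'
  let P : V →L[ℝ] K := LinearMap.toContinuousLinearMap P'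
  have hπ : ∀ r : R, π (r : F) = r := fun r => LinearMap.congr_fun hπ' r
  have hP : ∀ r : K, P (r : V) = r := fun r => LinearMap.congr_fun hP' r
  have hmemK : ∀ u, u ∈ K ↔ fderiv ℝ g w u = 0 := fun u => by simp [hK]
  let Ψ : V → R × K := fun x => (π (g x), P x)
  have hΨd : ∀ x ∈ W, HasFDerivAt Ψ ((π.comp (fderiv ℝ g x)).prod P) x := by
    intro x hx
    have h1 : HasFDerivAt g (fderiv ℝ g x) x :=
      ((hg x hx).differentiableAt one_ne_zero).hasFDerivAt
    exact (π.hasFDerivAt.comp x h1).prodMk P.hasFDerivAt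
  have hΨc : ∀ x ∈ W, ContDiffAt ℝ 1 Ψ x := by
    intro x hx
    exact (π.contDiff.contDiffAt.comp x (hg x hx)).prodMk P.contDiff.contDiffAt
  have hπw : ∀ u, (π (fderiv ℝ g w u) : F) = fderiv ℝ g w u := by
    intro u
    have := hπ ⟨fderiv ℝ g w u, by rw [hR]; exact ⟨u, rfl⟩⟩
    simp only at this
    rw [this]
  have hbij : Function.Bijective ((π.comp (fderiv ℝ g w)).prod P) := by
    constructor
    · rw [injective_iff_map_eq_zero]
      intro u hu
      have h1 : π (fderiv ℝ g w u) = 0 := congrArg Prod.fst hu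
      have h2 : P u = 0 := congrArg Prod.snd hu
      have h3 : u ∈ K := by
        rw [hmemK, ← hπw, h1]; rfl
      have h4 := hP ⟨u, h3⟩
      simp only [h2] at h4
      exact (congrArg Subtype.val h4).symm
    · rintro ⟨⟨r, u, hu⟩, k⟩
      refine ⟨u - (P u : V) + k, ?_⟩
      have hPu : fderiv ℝ g w (P u : V) = 0 := (hmemK _).1 (P u).2
      have hk' : fderiv ℝ g w (k : V) = 0 := (hmemK _).1 k.2
      have hu' : fderiv ℝ g w u = r := hu
      ext
      · simp only [ContinuousLinearMap.prod_apply, ContinuousLinearMap.comp_apply, map_add,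
          map_sub, hPu, hk']
        simp only [map_zero, Prod.fst_add, Prod.fst_sub, sub_zero, add_zero]
        rw [hπw, hu']
      · simp only [ContinuousLinearMap.prod_apply, map_add, map_sub, hP]
        simp
  let L : V ≃L[ℝ] (R × K) := (LinearEquiv.ofBijective
    (((π.comp (fderiv ℝ g w)).prod P : V →L[ℝ] R × K) : V →ₗ[ℝ] R × K) hbij).toContinuousLinearEquiv
  have hL : (L : V →L[ℝ] R × K) = (π.comp (fderiv ℝ g w)).prod P := by
    ext u <;> rfl
  have hLd : HasFDerivAt Ψ (L : V →L[ℝ] R × K) w := by rw [hL]; exact hΨd w hwW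
  let e := (hΨc w hwW).toOpenPartialHomeomorph Ψ hLd one_ne_zero
  have he : ∀ x, e x = Ψ x := fun x => rfl
  have hwe : w ∈ e.source := (hΨc w hwW).mem_toOpenPartialHomeomorph_source hLd one_ne_zero
  -- good neighbourhood
  have hinv : ∀ᶠ x in 𝓝 w, ∃ M : V ≃L[ℝ] (R × K), (M : V →L[ℝ] R × K) = fderiv ℝ Ψ x := by
    have hc : ContinuousAt (fderiv ℝ Ψ) w := ((hΨc w hwW).fderiv_right (m := 0) (by norm_num)).continuousAt
    have hn : range ((↑) : (V ≃L[ℝ] R × K) → V →L[ℝ] R × K) ∈ 𝓝 (fderiv ℝ Ψ w) := by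
      rw [hLd.fderiv]
      exact ContinuousLinearEquiv.nhds L
    exact hc.preimage_mem_nhds hn
  obtain ⟨v, hv0, hv⟩ := hk w hwW
  let v' : K := ⟨v, (hmemK v).2 hv⟩
  let z : ℝ → R × K := fun t => Ψ w + t • ((0 : R), v')
  have hzd : ∀ t, HasDerivAt z ((0 : R), v') t := by
    intro t
    have := ((hasDerivAt_id t).smul_const ((0 : R), v')).const_add (Ψ w)
    simpa [z] using this
  have hz0 : z 0 = Ψ w := by simp [z]
  let γ : ℝ → V := fun t => e.symm (z t)
  have hγ0 : γ 0 = w := by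
    simp only [γ, hz0, ← he]
    exact e.left_inv hwe
  have hztar : ∀ᶠ t in 𝓝 (0 : ℝ), z t ∈ e.target := by
    refine (hzd 0).continuousAt.preimage_mem_nhds ?_
    rw [hz0, ← he]
    exact e.open_target.mem_nhds (e.map_source hwe)
  have hγc : ContinuousAt γ 0 := by
    refine ContinuousAt.comp ?_ (hzd 0).continuousAt
    rw [hz0, ← he]
    exact e.continuousAt_symm (e.map_source hwe)
  have hev : ∀ᶠ t in 𝓝 (0 : ℝ), z t ∈ e.target ∧ γ t ∈ W ∧
      ∃ M : V ≃L[ℝ] (R × K), (M : V →L[ℝ] R × K) = fderiv ℝ Ψ (γ t) := by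
    refine hztar.and (Filter.Eventually.and ?_ ?_)
    · refine hγc.preimage_mem_nhds ?_
      rw [hγ0]; exact hW.mem_nhds hwW
    · have : Filter.Tendsto γ (𝓝 0) (𝓝 w) := by simpa [ContinuousAt, hγ0] using hγc
      exact this.eventually hinv
  obtain ⟨ε, hε, hball⟩ := Metric.eventually_nhds_iff_ball.1 hev
  have hder : ∀ t ∈ Metric.ball (0 : ℝ) ε, HasDerivAt (g ∘ γ) 0 t := by
    intro t ht
    obtain ⟨h1, h2, M, hM⟩ := hball t ht
    have hd : HasFDerivAt Ψ (M : V →L[ℝ] R × K) (γ t) := by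
      rw [hM]; exact ((hΨc _ h2).differentiableAt one_ne_zero).hasFDerivAt
    have hs : HasFDerivAt e.symm (M.symm : R × K →L[ℝ] V) (z t) := e.hasFDerivAt_symm h1 hd
    have hγd : HasDerivAt γ (M.symm ((0 : R), v')) t := hs.comp_hasDerivAt t (hzd t)
    have hMe : (M : V →L[ℝ] R × K) = (π.comp (fderiv ℝ g (γ t))).prod P := by
      rw [hM]; exact (hΨd _ h2).fderiv
    have hker : (LinearMap.ker (fderiv ℝ g (γ t) : V →ₗ[ℝ] F)) =
        (LinearMap.ker ((π.comp (fderiv ℝ g (γ t)) : V →L[ℝ] R) : V →ₗ[ℝ] R)) := by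
      apply Submodule.eq_of_le_of_finrank_le
      · intro u hu
        simp only [LinearMap.mem_ker, ContinuousLinearMap.coe_coe] at hu ⊢
        simp [hu]
      · have e1 := LinearMap.finrank_range_add_finrank_ker (fderiv ℝ g (γ t) : V →ₗ[ℝ] F)
        have e2 := LinearMap.finrank_range_add_finrank_ker
          ((π.comp (fderiv ℝ g (γ t)) : V →L[ℝ] R) : V →ₗ[ℝ] R)
        have e3 : LinearMap.range ((π.comp (fderiv ℝ g (γ t)) : V →L[ℝ] R) : V →ₗ[ℝ] R) = ⊤ := by
          rw [LinearMap.range_eq_top]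
          intro r
          refine ⟨M.symm (r, 0), ?_⟩
          have : (M : V →L[ℝ] R × K) (M.symm (r, 0)) = (r, 0) := by simp
          rw [hMe] at this
          exact congrArg Prod.fst this
        rw [e3, finrank_top] at e2
        have e4 := hmax _ h2
        omega
    have hz' : (M.symm ((0 : R), v')) ∈ LinearMap.ker (fderiv ℝ g (γ t) : V →ₗ[ℝ] F) := by
      rw [hker]
      have : (M : V →L[ℝ] R × K) (M.symm ((0 : R), v')) = (0, v') := by simp
      rw [hMe] at this
      exact congrArg Prod.fst this
    have hgd : HasFDerivAt g (fderiv ℝ g (γ t)) (γ t) :=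
      ((hg _ h2).differentiableAt one_ne_zero).hasFDerivAt
    have := hgd.comp_hasDerivAt t hγd
    have hz'' : fderiv ℝ g (γ t) (M.symm ((0 : R), v')) = 0 := hz'
    rwa [hz''] at this
  have hconst : ∀ t ∈ Metric.ball (0 : ℝ) ε, g (γ t) = g w := by
    intro t ht
    have hpre : IsPreconnected (Metric.ball (0 : ℝ) ε) := (convex_ball 0 ε).isPreconnected
    have := Metric.isOpen_ball.is_const_of_deriv_eq_zero hpre (f := g ∘ γ)
      (fun s hs => (hder s hs).differentiableAt.differentiableWithinAt)
      (fun s hs => (hder s hs).deriv) ht (Metric.mem_ball_self hε)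
    simpa [hγ0] using this
  refine ⟨g w, ?_⟩
  have hinj : InjOn γ (Metric.ball (0 : ℝ) ε) := by
    intro s hs t ht hst
    have h1 := e.symm.injOn (x₁ := z s) (by simpa using (hball s hs).1)
      (x₂ := z t) (by simpa using (hball t ht).1) hst
    have h2 : s • v' = t • v' := by
      have := congrArg Prod.snd h1
      simpa [z] using this
    have hvne : v' ≠ 0 := fun h => hv0 (congrArg Subtype.val h)
    exact smul_left_injective ℝ hvne h2
  have hinf : (γ '' Metric.ball (0 : ℝ) ε).Infinite := by
    refine Infinite.image hinj ?_
    rw [Real.ball_eq_Ioo]; exact Ioo_infinite (by linarith)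
  refine hinf.mono ?_
  rintro _ ⟨t, ht, rfl⟩
  exact ⟨(hball t ht).2.1, hconst t ht⟩

end GR


namespace GR
open MvPolynomial

/-- vanishing ideal of a set -/
noncomputable def van {n : ℕ} (Z : Set (E n)) : Ideal (MvPolynomial (Fin n) ℝ) where
  carrier := {p | ∀ x ∈ Z, ev p x = 0}
  add_mem' := by
    intro a b ha hb x hx
    simp [ha x hx, hb x hx]
  zero_mem' := by intro x _; simp
  smul_mem' := by
    intro c a ha x hx
    simp [ha x hx]

lemma mem_van {n : ℕ} {Z : Set (E n)} {p : MvPolynomial (Fin n) ℝ} :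
    p ∈ van Z ↔ ∀ x ∈ Z, ev p x = 0 := Iff.rfl

lemma van_anti {n : ℕ} {Z Z' : Set (E n)} (h : Z ⊆ Z') : van Z' ≤ van Z :=
  fun _ hp x hx => hp x (h hx)

lemma van_radical {n : ℕ} (Z : Set (E n)) : (van Z).radical = van Z := by
  apply le_antisymm _ Ideal.le_radical
  rintro p ⟨k, hk⟩ x hx
  have := hk x hx
  rw [ev_pow] at this
  by_contra hne; exact pow_ne_zero k hne this

instance van_singleton_prime {n : ℕ} (x : E n) : (van {x}).IsPrime := by
  have : van {x} = RingHom.ker (eval (fun j => x j) : MvPolynomial (Fin n) ℝ →+* ℝ) := by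
    ext p; simp [mem_van, RingHom.mem_ker, ev]
  rw [this]
  exact RingHom.ker_isPrime _

lemma van_singleton_injective {n : ℕ} : Function.Injective (fun x : E n => van {x}) := by
  intro x y h
  ext i
  have : (X i - C (x i) : MvPolynomial (Fin n) ℝ) ∈ van {y} := by
    rw [← (show van {x} = van {y} from h)]
    simp [mem_van]
  have := this y rfl
  simp at this
  linarith

/-- partial fibres -/
def ZZ {n : ℕ} (P : Fin n → MvPolynomial (Fin n) ℝ) (q : E n) (k : ℕ) : Set (E n) :=
  {x | ∀ i : Fin n, i.val < k → ev (P i) x = q i}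

lemma exists_add_single {n : ℕ} {U : Set (E n)} (hU : IsOpen U) {y : E n} (hy : y ∈ U)
    (i : Fin n) {s : ℝ} (hs : s ≠ 0) : ∃ ε > 0, y + EuclideanSpace.single i (ε * s) ∈ U := by
  have hc : Continuous fun ε : ℝ => y + EuclideanSpace.single i (ε * s) := by
    have : (fun ε : ℝ => y + EuclideanSpace.single i (ε * s)) =
        fun ε : ℝ => y + (ε * s) • EuclideanSpace.single i (1 : ℝ) := by
      ext ε j
      simp
    rw [this]; fun_prop
  have hy' : y + EuclideanSpace.single i ((0 : ℝ) * s) = y := by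
    ext j; simp
  have := hc.continuousAt (x := 0) |>.preimage_mem_nhds (t := U) (by
    rw [hy']; exact hU.mem_nhds hy)
  obtain ⟨δ, hδ, hb⟩ := Metric.mem_nhds_iff.1 this
  refine ⟨δ / 2, by positivity, hb ?_⟩
  simp [abs_of_pos hδ]
  exact hδ

lemma min_prime_step {n : ℕ} (P : Fin n → MvPolynomial (Fin n) ℝ) (hP : IsOpenMap (pm P))
    (q : E n) (k : ℕ) (hk : k < n) (p : Ideal (MvPolynomial (Fin n) ℝ))
    (hp : p ∈ (van (ZZ P q (k + 1))).minimalPrimes) :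
    ∃ p' ∈ (van (ZZ P q k)).minimalPrimes, p' < p := by
  haveI : p.IsPrime := hp.1.1
  have hsub : ZZ P q (k + 1) ⊆ ZZ P q k := fun x hx i hi => hx i (by omega)
  have hle : van (ZZ P q k) ≤ p := (van_anti hsub).trans hp.1.2
  obtain ⟨p', hp', hp'le⟩ := Ideal.exists_minimalPrimes_le hle
  refine ⟨p', hp', lt_of_le_of_ne hp'le ?_⟩
  rintro rfl
  have hfin : (van (ZZ P q k)).minimalPrimes.Finite :=
    Ideal.finite_minimalPrimes_of_isNoetherianRing _ _
  have hex : ∀ Q : Ideal (MvPolynomial (Fin n) ℝ), ∃ g, g ∉ p' ∧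
      (Q ∈ (van (ZZ P q k)).minimalPrimes → Q ≠ p' → g ∈ Q) := by
    intro Q
    by_cases hQ : Q ∈ (van (ZZ P q k)).minimalPrimes ∧ Q ≠ p'
    · have : ¬ Q ≤ p' := fun h => hQ.2 (le_antisymm h (hp'.2 hQ.1.1 h))
      obtain ⟨g, hg1, hg2⟩ := SetLike.not_le_iff_exists.1 this
      exact ⟨g, hg2, fun _ _ => hg1⟩
    · refine ⟨1, fun h => ‹p'.IsPrime›.ne_top ((Ideal.eq_top_iff_one _).2 h), fun h1 h2 =>
        absurd ⟨h1, h2⟩ hQ⟩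
  choose g hg1 hg2 using hex
  let G := ∏ Q ∈ hfin.toFinset, g Q
  have hG : G ∉ p' := by
    intro h
    obtain ⟨Q, _, hQ⟩ := (Ideal.IsPrime.prod_mem_iff).1 h
    exact hg1 Q hQ
  have hGmul : ∀ h ∈ p', G * h ∈ van (ZZ P q k) := by
    intro h hh
    rw [← van_radical, ← Ideal.sInf_minimalPrimes, Submodule.mem_sInf]
    intro Q hQ
    by_cases hQp : Q = p'
    · subst hQp; exact Ideal.mul_mem_left _ _ hh
    · refine Ideal.mul_mem_right _ _ ?_
      exact Ideal.mem_of_dvd _ (Finset.dvd_prod_of_mem g (hfin.mem_toFinset.2 hQ)) (hg2 Q hQ hQp)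
  -- a point where G does not vanish
  have : G ∉ van (ZZ P q k) := fun h => hG (hle h)
  rw [mem_van] at this
  push Not at this
  obtain ⟨x, hx, hGx⟩ := this
  let i : Fin n := ⟨k, hk⟩
  have hval : ∀ y ∈ ZZ P q k, ev G y ≠ 0 → ev (P i) y = q i := by
    intro y hy hGy
    have h1 : P i - C (q i) ∈ p' := by
      apply hp.1.2
      intro z hz
      have := hz i (by simp [i])
      simp [this]
    have h2 := hGmul _ h1 y hy
    simp only [ev_mul, ev_sub, ev_C, mul_eq_zero, hGy, false_or] at h2
    linarith
  have hU : IsOpen {y : E n | ev G y ≠ 0} := isOpen_ne_fun (ev_continuous G) continuous_const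
  obtain ⟨ε, hε, z, hz, hzeq⟩ := exists_add_single (hP _ hU) (Set.mem_image_of_mem _ hGx) i
    (one_ne_zero)
  have hzZ : z ∈ ZZ P q k := by
    intro j hj
    have hne : j ≠ i := by
      rintro rfl; simp [i] at hj
    have := congrArg (fun w : E n => w j) hzeq
    simp [hne] at this
    rw [this, hx j hj]
  have h1 := hval z hzZ hz
  have h2 := hval x hx hGx
  have h3 := congrArg (fun w : E n => w i) hzeq
  simp [h1, h2] at h3
  linarith

lemma height_ge {n : ℕ} (P : Fin n → MvPolynomial (Fin n) ℝ) (hP : IsOpenMap (pm P))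
    (q : E n) (k : ℕ) (hk : k ≤ n) : ∀ p ∈ (van (ZZ P q k)).minimalPrimes,
    (k : ℕ∞) ≤ p.height := by
  induction k with
  | zero => intro p _; simp
  | succ k ih =>
    intro p hp
    obtain ⟨p', hp', hlt⟩ := min_prime_step P hP q k hk p hp
    haveI : p.IsPrime := hp.1.1
    haveI : p'.IsPrime := hp'.1.1
    have h1 := Ideal.height_add_one_le_of_lt_of_isPrime hlt
    have h2 := ih (by omega) p' hp'
    push_cast
    exact (add_le_add_left h2 1).trans h1

lemma finite_fiber {n : ℕ} (P : Fin n → MvPolynomial (Fin n) ℝ) (hP : IsOpenMap (pm P))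
    (q : E n) : (pm P ⁻¹' {q}).Finite := by
  have hZ : pm P ⁻¹' {q} = ZZ P q n := by
    ext x
    simp only [Set.mem_preimage, Set.mem_singleton_iff, ZZ, Set.mem_setOf_eq]
    constructor
    · rintro rfl i _; rfl
    · intro h; ext i; exact h i i.2
  rw [hZ]
  have hfin : (van (ZZ P q n)).minimalPrimes.Finite :=
    Ideal.finite_minimalPrimes_of_isNoetherianRing _ _
  refine Set.Finite.of_finite_image (f := fun x : E n => van {x}) (hfin.subset ?_)
    van_singleton_injective.injOn
  rintro _ ⟨x, hx, rfl⟩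
  have hle : van (ZZ P q n) ≤ van {x} := van_anti (by simpa using hx)
  obtain ⟨p, hp, hple⟩ := Ideal.exists_minimalPrimes_le hle
  rcases eq_or_lt_of_le hple with h | h
  · simpa [← h] using hp
  · exfalso
    haveI : p.IsPrime := hp.1.1
    have h1 := Ideal.height_add_one_le_of_lt_of_isPrime h
    have h2 := height_ge P hP q n le_rfl p hp
    have h3 := Ideal.height_le_ringKrullDim_of_isPrime (I := van {x})
    rw [MvPolynomial.ringKrullDim_of_isNoetherianRing, ringKrullDim_eq_zero_of_field,
      Nat.card_eq_fintype_card, Fintype.card_fin, zero_add] at h3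
    have h4 : (van {x}).height ≤ (n : ℕ∞) := by exact_mod_cast h3
    have h5 : ((n : ℕ∞) + 1) ≤ n := (add_le_add_left h2 1).trans (h1.trans h4)
    exact absurd h5 (not_le.2 (by exact_mod_cast Nat.lt_succ_self n))

end GR


namespace GR
open MvPolynomial

lemma exists_eval_ne_zero {m : ℕ} {r : MvPolynomial (Fin m) ℝ} (hr : r ≠ 0)
    {U : Set (Fin m → ℝ)} (hU : IsOpen U) {s : Fin m → ℝ} (hs : s ∈ U) :
    ∃ y ∈ U, eval y r ≠ 0 := by
  obtain ⟨y, hy, hy'⟩ := exists_ev_ne_zero hr (U := (WithLp.ofLp : E m → _) ⁻¹' U)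
    (hU.preimage (PiLp.continuous_ofLp 2 _)) (x := WithLp.toLp 2 s) (by simpa using hs)
  exact ⟨_, hy, hy'⟩

lemma exists_bezout {A : Type*} [CommRing A] [IsDomain A] [UniqueFactorizationMonoid A]
    (H G : Polynomial A) (hH : Irreducible H) (hdeg : H.natDegree ≠ 0) (hnd : ¬ H ∣ G) :
    ∃ (u v : Polynomial A) (r : A), r ≠ 0 ∧ u * H + v * G = Polynomial.C r := by
  classical
  letI : NormalizedGCDMonoid A := Classical.choice inferInstance
  let K := FractionRing A
  have hprim : H.IsPrimitive := hH.isPrimitive hdeg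
  have hHK : Irreducible (H.map (algebraMap A K)) :=
    (hprim.irreducible_iff_irreducible_map_fraction_map (K := K)).1 hH
  have hndK : ¬ H.map (algebraMap A K) ∣ G.map (algebraMap A K) := fun h =>
    hnd ((hprim.dvd_iff_fraction_map_dvd_fraction_map K).2 h)
  obtain ⟨u, v, huv⟩ := (hHK.coprime_iff_not_dvd).2 hndK
  obtain ⟨b, hb, hbu⟩ := IsLocalization.integerNormalization_spec (nonZeroDivisors A) u
  obtain ⟨c, hc, hcv⟩ := IsLocalization.integerNormalization_spec (nonZeroDivisors A) v
  refine ⟨Polynomial.C c * IsLocalization.integerNormalization (nonZeroDivisors A) u,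
    Polynomial.C b * IsLocalization.integerNormalization (nonZeroDivisors A) v, b * c,
    mul_ne_zero (nonZeroDivisors.ne_zero hb) (nonZeroDivisors.ne_zero hc), ?_⟩
  apply Polynomial.map_injective _ (IsFractionRing.injective A K)
  have e1 : b • u = Polynomial.C (algebraMap A K b) * u := by
    ext k; simp [Algebra.smul_def]
  have e2 : c • v = Polynomial.C (algebraMap A K c) * v := by
    ext k; simp [Algebra.smul_def]
  rw [e1] at hbu
  rw [e2] at hcv
  simp only [Polynomial.map_add, Polynomial.map_mul, Polynomial.map_C, hbu, hcv, map_mul]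
  linear_combination (Polynomial.C (algebraMap A K b)) * (Polynomial.C (algebraMap A K c)) * huv

lemma sign_core {m : ℕ} (h g : MvPolynomial (Fin (m + 1)) ℝ) (hh : Irreducible h)
    (hnd : ¬ h ∣ g) (s₀ : Fin m → ℝ) (a b : ℝ)
    (hab : eval (Fin.cons a s₀ : Fin (m + 1) → ℝ) h * eval (Fin.cons b s₀ : Fin (m + 1) → ℝ) h < 0) :
    ∃ y : Fin (m + 1) → ℝ, eval y h = 0 ∧ eval y g ≠ 0 := by
  set H := finSuccEquiv ℝ m h with hHdef
  set G := finSuccEquiv ℝ m g with hGdef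
  have hH : Irreducible H := (MulEquiv.irreducible_iff (finSuccEquiv ℝ m)).2 hh
  have hHG : ¬ H ∣ G := fun hd => hnd ((map_dvd_iff (finSuccEquiv ℝ m)).1 hd)
  have hdeg : H.natDegree ≠ 0 := by
    intro h0
    obtain ⟨c, hc⟩ := Polynomial.natDegree_eq_zero.1 h0
    rw [eval_eq_eval_mv_eval', eval_eq_eval_mv_eval', ← hHdef, ← hc] at hab
    simp only [Polynomial.map_C, Polynomial.eval_C] at hab
    nlinarith [mul_self_nonneg (eval s₀ c)]
  obtain ⟨u, v, r, hr, huv⟩ := exists_bezout H G hH hdeg hHG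
  have hcont : ∀ t : ℝ, Continuous fun s : Fin m → ℝ => eval (Fin.cons t s : Fin (m + 1) → ℝ) h := by
    intro t
    refine (MvPolynomial.continuous_eval h).comp ?_
    refine continuous_pi fun j => ?_
    refine Fin.cases ?_ (fun j => ?_) j
    · simpa using continuous_const
    · simpa using continuous_apply j
  have hU : IsOpen {s : Fin m → ℝ | eval (Fin.cons a s : Fin (m + 1) → ℝ) h *
      eval (Fin.cons b s : Fin (m + 1) → ℝ) h < 0} :=
    isOpen_lt ((hcont a).mul (hcont b)) continuous_const
  obtain ⟨s, hs, hrs⟩ := exists_eval_ne_zero hr hU hab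
  have hct : Continuous fun t : ℝ => eval (Fin.cons t s : Fin (m + 1) → ℝ) h := by
    simp only [eval_eq_eval_mv_eval']
    exact Polynomial.continuous _
  obtain ⟨t, ht⟩ : ∃ t, eval (Fin.cons t s : Fin (m + 1) → ℝ) h = 0 := by
    have hs' : eval (Fin.cons a s : Fin (m + 1) → ℝ) h *
      eval (Fin.cons b s : Fin (m + 1) → ℝ) h < 0 := hs
    rcases mul_neg_iff.1 hs' with ⟨h1, h2⟩ | ⟨h1, h2⟩
    · exact mem_range_of_exists_le_of_exists_ge hct ⟨b, h2.le⟩ ⟨a, h1.le⟩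
    · exact mem_range_of_exists_le_of_exists_ge hct ⟨a, h1.le⟩ ⟨b, h2.le⟩
  refine ⟨Fin.cons t s, ht, fun hg => hrs ?_⟩
  have := congrArg (fun p => Polynomial.eval t (Polynomial.map (eval s) p)) huv
  rw [eval_eq_eval_mv_eval'] at ht hg
  simp only [Polynomial.map_add, Polynomial.map_mul, Polynomial.eval_add, Polynomial.eval_mul,
    Polynomial.map_C, Polynomial.eval_C] at this
  rw [← hHdef] at ht
  rw [← hGdef] at hg
  rw [ht, hg] at this
  simpa using this.symm

lemma sign_line {n : ℕ} (h g : MvPolynomial (Fin n) ℝ) (hh : Irreducible h)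
    (hnd : ¬ h ∣ g) (x : Fin n → ℝ) (i : Fin n) (t : ℝ)
    (hab : eval x h * eval (Function.update x i t) h < 0) :
    ∃ y : Fin n → ℝ, eval y h = 0 ∧ eval y g ≠ 0 := by
  obtain ⟨m, rfl⟩ : ∃ m, n = m + 1 := ⟨n - 1, by have := i.2; omega⟩
  let σ := Equiv.swap 0 i
  let e := renameEquiv ℝ σ
  have hσ : ∀ y : Fin (m + 1) → ℝ, (y ∘ σ) ∘ σ = y := by
    intro y; ext j; simp [σ]
  have he : ∀ (y : Fin (m + 1) → ℝ) p, eval y (e p) = eval (y ∘ σ) p := by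
    intro y p
    simp [e, eval_rename]
  have e1 : (Fin.cons (x i) (Fin.tail (x ∘ σ)) : Fin (m + 1) → ℝ) = x ∘ σ := by
    have : x i = (x ∘ σ) 0 := by simp [σ]
    rw [this]; exact Fin.cons_self_tail _
  have e2 : (Fin.cons t (Fin.tail (x ∘ σ)) : Fin (m + 1) → ℝ) = (Function.update x i t) ∘ σ := by
    ext j
    refine Fin.cases ?_ (fun j => ?_) j
    · simp [σ]
    · have : σ j.succ ≠ i := by
        intro h
        have h2 := congrArg σ h
        simp [σ] at h2
      simp [Fin.tail, this]
  obtain ⟨y, hy1, hy2⟩ := sign_core (e h) (e g) ((MulEquiv.irreducible_iff e).2 hh)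
    (fun hd => hnd ((map_dvd_iff e).1 hd)) (Fin.tail (x ∘ σ)) (x i) t (by
      rw [he, he, e1, e2, hσ, hσ]; exact hab)
  rw [he] at hy1 hy2
  exact ⟨_, hy1, hy2⟩

lemma exists_line {n : ℕ} (h : MvPolynomial (Fin n) ℝ) (s : Finset (Fin n)) :
    ∀ x y : Fin n → ℝ, (∀ j, j ∉ s → y j = x j) → eval x h * eval y h < 0 →
    ∃ (z : Fin n → ℝ) (i : Fin n) (t : ℝ), eval z h * eval (Function.update z i t) h < 0 := by
  induction s using Finset.induction_on with
  | empty =>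
    intro x y hxy hlt
    have : y = x := funext fun j => hxy j (by simp)
    subst this
    nlinarith [mul_self_nonneg (eval y h)]
  | insert i s his ih =>
    intro x y hxy hlt
    have hne : h ≠ 0 := by rintro rfl; simp at hlt
    let z := Function.update y i (x i)
    have hU : IsOpen {w : Fin n → ℝ | eval (w + (x - z)) h * eval (w + (y - z)) h < 0} := by
      refine isOpen_lt (Continuous.mul ?_ ?_) continuous_const
      · exact (MvPolynomial.continuous_eval h).comp (by fun_prop)
      · exact (MvPolynomial.continuous_eval h).comp (by fun_prop)
    obtain ⟨w, hw, hw0⟩ := exists_eval_ne_zero hne hU (s := z) (by simpa using hlt)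
    have hw' : eval (w + (x - z)) h * eval (w + (y - z)) h < 0 := hw
    have hup : w + (y - z) = Function.update w i ((w + (y - z)) i) := by
      ext j
      by_cases hj : j = i
      · subst hj; simp
      · simp [hj, z]
    by_cases hc : eval w h * eval (w + (y - z)) h < 0
    · exact ⟨w, i, (w + (y - z)) i, by rw [← hup]; exact hc⟩
    · refine ih (w + (x - z)) w ?_ ?_
      · intro j hj
        by_cases hji : j = i
        · subst hji; simp [z]
        · have := hxy j (by simp [hji, hj])
          simp [z, hji, this]
      · rcases mul_neg_iff.1 hw' with ⟨h1, h2⟩ | ⟨h1, h2⟩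
        · rcases lt_or_gt_of_ne hw0 with h3 | h3
          · exact mul_neg_of_pos_of_neg h1 h3
          · exact absurd (mul_neg_of_pos_of_neg h3 h2) hc
        · rcases lt_or_gt_of_ne hw0 with h3 | h3
          · exact absurd (mul_neg_of_neg_of_pos h3 h2) hc
          · exact mul_neg_of_neg_of_pos h1 h3

lemma exists_factor {n : ℕ} (J : MvPolynomial (Fin n) ℝ) (a b : E n) :
    ev J a * ev J b < 0 → ∃ (h k : MvPolynomial (Fin n) ℝ) (e : ℕ), Irreducible h ∧
      J = h ^ e * k ∧ ¬ h ∣ k ∧ ev h a * ev h b < 0 ∧ Odd e := by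
  induction J using UniqueFactorizationMonoid.induction_on_coprime with
  | h0 => simp
  | h1 hu =>
    intro hlt
    rename_i x
    obtain ⟨c, hc⟩ := (MvPolynomial.isUnit_iff_eq_C_of_isReduced.1 hu)
    exfalso
    rw [hc.2] at hlt
    simp at hlt
    nlinarith [mul_self_nonneg c]
  | hpr i hp =>
    intro hlt
    rename_i p
    have hodd : Odd i := by
      by_contra hne
      rw [Nat.not_odd_iff_even] at hne
      rw [ev_pow, ev_pow, ← mul_pow] at hlt
      exact absurd (hne.pow_nonneg _) (not_le.2 hlt)
    refine ⟨p, 1, i, hp.irreducible, by simp, fun h => hp.not_unit (isUnit_of_dvd_one h), ?_, hodd⟩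
    rw [ev_pow, ev_pow, ← mul_pow] at hlt
    exact hodd.pow_neg_iff.1 hlt
  | hcp hrel hx hy =>
    rename_i x y
    intro hlt
    have hlt' : (ev x a * ev x b) * (ev y a * ev y b) < 0 := by
      simp only [ev_mul] at hlt; nlinarith
    have key : ∀ x y : MvPolynomial (Fin n) ℝ, IsRelPrime x y →
      (∃ (h k : MvPolynomial (Fin n) ℝ) (e : ℕ), Irreducible h ∧
      x = h ^ e * k ∧ ¬ h ∣ k ∧ ev h a * ev h b < 0 ∧ Odd e) →
      (∃ (h k : MvPolynomial (Fin n) ℝ) (e : ℕ), Irreducible h ∧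
      x * y = h ^ e * k ∧ ¬ h ∣ k ∧ ev h a * ev h b < 0 ∧ Odd e) := by
      rintro x y hrel ⟨h, k, e, h1, h2, h3, h4, h5⟩
      refine ⟨h, k * y, e, h1, by rw [h2]; ring, ?_, h4, h5⟩
      intro hd
      rcases h1.prime.dvd_or_dvd hd with hd | hd
      · exact h3 hd
      · refine h1.not_isUnit (hrel ?_ hd)
        rw [h2]
        exact Dvd.dvd.mul_right (dvd_pow_self h h5.pos.ne') k
    rcases mul_neg_iff.1 hlt' with ⟨h1, h2⟩ | ⟨h1, h2⟩
    · rw [mul_comm]; exact key y x hrel.symm (hy h2)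
    · exact key x y hrel (hx h1)

lemma not_dvd_pderiv {n : ℕ} (h : MvPolynomial (Fin n) ℝ) (i : Fin n) (hi : pderiv i h ≠ 0) :
    ¬ h ∣ pderiv i h := by
  rintro ⟨c, hc⟩
  have hh : h ≠ 0 := by rintro rfl; simp at hi
  have hc0 : c ≠ 0 := by rintro rfl; simp [hc] at hi
  have h1 := totalDegree_mul_of_isDomain hh hc0
  rw [← hc] at h1
  obtain ⟨m, hm, hm'⟩ : ∃ m ∈ (pderiv i h).support,
      (pderiv i h).totalDegree = m.sum fun _ e => e :=
    Finset.exists_mem_eq_sup _ (support_nonempty.2 hi) _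
  rw [mem_support_iff, coeff_pderiv] at hm
  have h2 : m + Finsupp.single i 1 ∈ h.support := by
    rw [mem_support_iff]; exact left_ne_zero_of_mul hm
  have h3 := le_totalDegree h2
  rw [Finsupp.sum_add_index' (by simp) (by simp)] at h3
  simp at h3
  omega

/-- a sign changing polynomial changes sign across a smooth hypersurface point -/
lemma exists_smooth_point {n : ℕ} (J : MvPolynomial (Fin n) ℝ) (a b : E n)
    (hlt : ev J a * ev J b < 0) : ∃ (h k : MvPolynomial (Fin n) ℝ) (e : ℕ) (i : Fin n) (x : E n),
      J = h ^ e * k ∧ Odd e ∧ ev h x = 0 ∧ ev k x ≠ 0 ∧ ev (pderiv i h) x ≠ 0 := by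
  obtain ⟨h, k, e, h1, h2, h3, h4, h5⟩ := exists_factor J a b hlt
  obtain ⟨i, hi⟩ : ∃ i, pderiv i h ≠ 0 := by
    by_contra! hcon
    have hd : ∀ x, fderiv ℝ (ev h) x = 0 := by
      intro x
      rw [(ev_hasFDeriv h x).fderiv]
      ext v; simp [dev_apply, hcon]
    have := is_const_of_fderiv_eq_zero
      (fun x => (ev_hasFDeriv h x).differentiableAt) hd a b
    rw [this] at h4
    nlinarith [mul_self_nonneg (ev h b)]
  obtain ⟨z, j, t, hz⟩ := exists_line h Finset.univ (fun j => a j) (fun j => b j) (by simp) h4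
  have hnd : ¬ h ∣ k * pderiv i h := fun hd => (h1.prime.dvd_or_dvd hd).elim h3
    (not_dvd_pderiv h i hi)
  obtain ⟨y, hy1, hy2⟩ := sign_line h _ h1 hnd z j t hz
  refine ⟨h, k, e, i, WithLp.toLp 2 y, h2, h5, hy1, ?_, ?_⟩
  · intro h0
    apply hy2
    rw [map_mul, show eval y k = 0 from h0, zero_mul]
  · intro h0
    apply hy2
    rw [map_mul, show eval y (pderiv i h) = 0 from h0, mul_zero]

end GR


namespace GR
open MvPolynomial

lemma ift {n : ℕ} (Q : Fin n → MvPolynomial (Fin n) ℝ) (y : E n) (hy : (jme Q y).det ≠ 0) :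
    ∃ e : OpenPartialHomeomorph (E n) (E n), (∀ x, e x = pm Q x) ∧ y ∈ e.source ∧
      (∀ z ∈ e.target, ContDiffAt ℝ 1 e.symm z ∧ ∃ M : E n →L[ℝ] E n,
        HasFDerivAt e.symm M z ∧ (∀ v, dpm Q (e.symm z) (M v) = v) ∧
        ∀ v, M (dpm Q (e.symm z) v) = v) := by
  have hM : ∀ x, (jme Q x).det ≠ 0 → ∃ L : E n ≃L[ℝ] E n, (L : E n →L[ℝ] E n) = dpm Q x := by
    intro x hx
    refine ⟨ContinuousLinearMap.toContinuousLinearEquivOfDetNeZero (dpm Q x) (by rwa [dpm_det]), ?_⟩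
    ext v; rfl
  obtain ⟨L, hL⟩ := hM y hy
  have hd : HasFDerivAt (pm Q) (L : E n →L[ℝ] E n) y := by rw [hL]; exact pm_hasFDeriv Q y
  have hc : ContDiffAt ℝ 1 (pm Q) y := (pm_contDiff Q).contDiffAt
  let e := hc.toOpenPartialHomeomorph (pm Q) hd one_ne_zero
  have he : ∀ x, e x = pm Q x := fun x => rfl
  have hye : y ∈ e.source := hc.mem_toOpenPartialHomeomorph_source hd one_ne_zero
  have hO : IsOpen {x : E n | ev (jm Q).det x ≠ 0} :=
    isOpen_ne_fun (ev_continuous _) continuous_const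
  refine ⟨e.restrOpen _ hO, fun x => rfl, ⟨hye, by simpa [ev_jm_det] using hy⟩, ?_⟩
  intro z hz
  have hz1 : z ∈ e.target := by
    have := hz; simp [OpenPartialHomeomorph.restrOpen] at this; exact this.1
  have hz2 : (jme Q (e.symm z)).det ≠ 0 := by
    have := ((e.restrOpen _ hO).map_target hz).2
    rw [← ev_jm_det]; exact this
  obtain ⟨M, hMM⟩ := hM _ hz2
  have hd' : HasFDerivAt e (M : E n →L[ℝ] E n) (e.symm z) := by
    rw [hMM]; exact pm_hasFDeriv Q _
  refine ⟨?_, M.symm, ?_, ?_, ?_⟩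
  · exact e.contDiffAt_symm hz1 hd' ((pm_contDiff Q).contDiffAt)
  · exact e.hasFDerivAt_symm hz1 hd'
  · intro v
    change dpm Q (e.symm z) (M.symm v) = v
    rw [← hMM]; simp
  · intro v
    change M.symm (dpm Q (e.symm z) v) = v
    rw [← hMM]; simp

lemma jme_update {n : ℕ} (P : Fin n → MvPolynomial (Fin n) ℝ) (i j : Fin n) (x : E n) :
    (jme (Function.update P i (X j)) x).det = (jme P x).adjugate j i := by
  rw [Matrix.adjugate_apply]
  congr 1
  ext k l
  by_cases hk : k = i
  · subst hk
    simp [jme, pderiv_X, Pi.single_apply, Matrix.updateRow_apply]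
    by_cases hl : l = j
    · subst hl; simp
    · simp [hl, Ne.symm hl]
  · simp [jme, hk, Matrix.updateRow_apply]

lemma line_deriv {n : ℕ} (P : Fin n → MvPolynomial (Fin n) ℝ) (i j : Fin n) (x v : E n)
    (hv : dpm (Function.update P i (X j)) x v = EuclideanSpace.single i 1) :
    dev (P i) x v * (jme P x).adjugate j i = (jme P x).det := by
  have h1 : ∀ k, dev (Function.update P i (X j) k) x v = (EuclideanSpace.single i 1 : E n) k := by
    intro k; rw [← hv, dpm_apply]
  have h2 : v j = 1 := by
    have := h1 i
    simp [dev_apply, pderiv_X, Pi.single_apply] at this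
    rw [Finset.sum_eq_single j] at this
    · simpa using this
    · intro b _ hb; simp [Ne.symm hb]
    · simp
  have h3 : (jme P x).mulVec v = Pi.single i (dev (P i) x v) := by
    ext k
    have hk' : (jme P x).mulVec v k = dev (P k) x v := by
      simp [dev_apply, jme, Matrix.mulVec, dotProduct]
    rw [hk']
    by_cases hk : k = i
    · subst hk; simp
    · have := h1 k
      simpa [hk] using this
  have h4 := congrArg (fun w => (jme P x).adjugate.mulVec w j) h3
  simp only [Matrix.mulVec_mulVec, Matrix.adjugate_mul] at h4
  simp [Matrix.smul_mulVec, h2] at h4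
  linarith

end GR


namespace GR
open MvPolynomial Topology

lemma one_signed {n : ℕ} (P : Fin n → MvPolynomial (Fin n) ℝ) (hP : IsOpenMap (pm P))
    (y : E n) (i j : Fin n) (hy : (jme P y).adjugate j i ≠ 0) :
    (∀ᶠ x in 𝓝 y, 0 ≤ ev (jm P).det x) ∨ (∀ᶠ x in 𝓝 y, ev (jm P).det x ≤ 0) := by
  obtain ⟨e, he, hye, hsym⟩ := ift (Function.update P i (X j)) y (by rwa [jme_update])
  set b : E n := EuclideanSpace.single i (1 : ℝ) with hb
  set c : E n → ℝ := fun z => ev (P i) (e.symm z) with hc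
  have hcoord : ∀ z ∈ e.target, ∀ k, k ≠ i → ev (P k) (e.symm z) = z k := by
    intro z hz k hk
    have := congrArg (fun w : E n => w k) (e.right_inv hz)
    simp only [he] at this
    simpa [hk] using this
  obtain ⟨r, hr, hB⟩ := Metric.isOpen_iff.1 e.open_target _ (e.map_source hye)
  set B := Metric.ball (e y) r with hBdef
  have hBo : IsOpen B := Metric.isOpen_ball
  have hBc : Convex ℝ B := convex_ball _ _
  have hder : ∀ z t, z + t • b ∈ B → ∃ d : ℝ, HasDerivAt (fun t : ℝ => c (z + t • b)) d t ∧
      d * (jme P (e.symm (z + t • b))).adjugate j i = (jme P (e.symm (z + t • b))).det := by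
    intro z t hz
    obtain ⟨_, M, hM, hMv, _⟩ := hsym _ (hB hz)
    have h1 : HasDerivAt (fun t : ℝ => z + t • b) b t := by
      have := ((hasDerivAt_id t).smul_const b).const_add z
      simpa using this
    have h2 : HasDerivAt (fun t : ℝ => e.symm (z + t • b)) (M b) t := hM.comp_hasDerivAt t h1
    have h3 := (ev_hasFDeriv (P i) (e.symm (z + t • b))).comp_hasDerivAt t h2
    exact ⟨_, h3, line_deriv P i j _ _ (hMv b)⟩
  have hopen : ∀ u ∈ B, ∀ ρ > 0, ∀ s : ℝ, s ≠ 0 → ∃ τ : ℝ, |τ| < ρ ∧ u + τ • b ∈ B ∧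
      ∃ ε > 0, c (u + τ • b) = c u + ε * s := by
    intro u hu ρ hρ s hs
    have hO : IsOpen (e.symm '' (B ∩ Metric.ball u ρ)) :=
      e.isOpen_image_symm_of_subset_target (hBo.inter Metric.isOpen_ball)
        (Set.inter_subset_left.trans hB)
    have hmem : pm P (e.symm u) ∈ pm P '' (e.symm '' (B ∩ Metric.ball u ρ)) :=
      Set.mem_image_of_mem _ (Set.mem_image_of_mem _ ⟨hu, Metric.mem_ball_self hρ⟩)
    obtain ⟨ε, hε, _, ⟨w, ⟨hw1, hw2⟩, rfl⟩, hweq⟩ := exists_add_single (hP _ hO) hmem i hs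
    have hwu : w = u + (w i - u i) • b := by
      ext k
      by_cases hk : k = i
      · subst hk; simp [hb]
      · have := congrArg (fun x : E n => x k) hweq
        simp [hk, hcoord _ (hB hw1) k hk, hcoord _ (hB hu) k hk] at this
        simp [hb, hk, this]
    refine ⟨w i - u i, ?_, ?_, ε, hε, ?_⟩
    · have := (PiLp.norm_apply_le (w - u) i).trans_lt (mem_ball_iff_norm.1 hw2)
      simpa using this
    · rw [← hwu]; exact hw1
    · rw [← hwu]
      have := congrArg (fun x : E n => x i) hweq
      simpa [hc] using this
  have hinj : ∀ z ∈ B, ∀ s : ℝ, 0 < s → z + s • b ∈ B → c (z + s • b) - c z ≠ 0 := by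
    intro z hz s hs hzs heq
    have hseg : ∀ t ∈ Set.Icc 0 s, z + t • b ∈ B := by
      intro t ht
      have := hBc.add_smul_mem hz hzs (t := t / s) ⟨div_nonneg ht.1 hs.le, (div_le_one hs).2 ht.2⟩
      rwa [smul_smul, div_mul_cancel₀ _ hs.ne'] at this
    have hcont : ContinuousOn (fun t : ℝ => c (z + t • b)) (Set.Icc 0 s) := by
      intro t ht
      obtain ⟨d, hd, _⟩ := hder z t (hseg t ht)
      exact hd.continuousAt.continuousWithinAt
    obtain ⟨t, ht, hext⟩ := exists_isLocalExtr_Ioo hs hcont (by simp; linarith)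
    have hu := hseg t ⟨ht.1.le, ht.2.le⟩
    have hadd : ∀ τ : ℝ, z + t • b + τ • b = z + (t + τ) • b := fun τ => by module
    rcases hext with h | h
    · obtain ⟨ρ, hρ, hh⟩ := Metric.eventually_nhds_iff.1 h
      obtain ⟨τ, hτ, _, ε, hε, h2⟩ := hopen _ hu ρ hρ (-1) (by norm_num)
      have := hh (y := t + τ) (by simpa [Real.dist_eq] using hτ)
      simp only at this
      rw [hadd] at h2
      linarith
    · obtain ⟨ρ, hρ, hh⟩ := Metric.eventually_nhds_iff.1 h
      obtain ⟨τ, hτ, _, ε, hε, h2⟩ := hopen _ hu ρ hρ 1 (by norm_num)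
      have := hh (y := t + τ) (by simpa [Real.dist_eq] using hτ)
      simp only at this
      rw [hadd] at h2
      linarith
  -- constant sign
  set A : Set (E n × ℝ) := {p | p.1 ∈ B ∧ 0 < p.2 ∧ p.1 + p.2 • b ∈ B} with hA
  have hAc : Convex ℝ A := by
    rintro ⟨z, s⟩ ⟨h1, h2, h3⟩ ⟨z', s'⟩ ⟨h1', h2', h3'⟩ α β hα hβ hαβ
    refine ⟨hBc h1 h1' hα hβ hαβ, ?_, ?_⟩
    · simp only at h2 h2'
      exact (convex_Ioi (0 : ℝ)) h2 h2' hα hβ hαβ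
    · have := hBc h3 h3' hα hβ hαβ
      simp only at this ⊢
      convert this using 1
      simp only [Prod.fst_add, Prod.smul_fst, Prod.snd_add, Prod.smul_snd, smul_eq_mul]
      module
  have hccont : ContinuousOn c B := by
    refine (ev_continuous (P i)).comp_continuousOn (e.continuousOn_symm.mono hB)
  have hDcont : ContinuousOn (fun p : E n × ℝ => c (p.1 + p.2 • b) - c p.1) A := by
    refine ContinuousOn.sub (hccont.comp (by fun_prop) (fun p hp => hp.2.2))
      (hccont.comp (by fun_prop) (fun p hp => hp.1))
  have hsign : (∀ p ∈ A, 0 < c (p.1 + p.2 • b) - c p.1) ∨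
      (∀ p ∈ A, c (p.1 + p.2 • b) - c p.1 < 0) := by
    by_contra! hcon
    obtain ⟨⟨p, hp, hp'⟩, q, hq, hq'⟩ := hcon
    obtain ⟨w, hw, hw0⟩ := hAc.isPreconnected.intermediate_value hp hq hDcont ⟨hp', hq'⟩
    exact hinj w.1 hw.1 w.2 hw.2.1 hw.2.2 hw0
  have hdsign : (∀ z ∈ B, ∀ d, HasDerivAt (fun t : ℝ => c (z + t • b)) d 0 → 0 ≤ d) ∨
      (∀ z ∈ B, ∀ d, HasDerivAt (fun t : ℝ => c (z + t • b)) d 0 → d ≤ 0) := by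
    have hnear : ∀ z ∈ B, ∀ᶠ t in 𝓝[>] (0 : ℝ), (z, t) ∈ A := by
      intro z hz
      have : ∀ᶠ t in 𝓝 (0 : ℝ), z + t • b ∈ B := by
        have hcc : Continuous fun t : ℝ => z + t • b := by fun_prop
        exact hcc.continuousAt.preimage_mem_nhds (by simpa using hBo.mem_nhds hz)
      filter_upwards [this.filter_mono nhdsWithin_le_nhds, self_mem_nhdsWithin] with t h1 h2
      exact ⟨hz, h2, h1⟩
    rcases hsign with h | h
    · left
      intro z hz d hd
      have ht := hd.hasDerivWithinAt (s := Set.Ioi 0)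
      rw [hasDerivWithinAt_iff_tendsto_slope' (by simp)] at ht
      refine ge_of_tendsto ht ?_
      filter_upwards [hnear z hz, self_mem_nhdsWithin] with t h1 h2
      have := h _ h1
      simp only [slope_def_field, zero_smul, add_zero, sub_zero]
      exact (div_pos this h2).le
    · right
      intro z hz d hd
      have ht := hd.hasDerivWithinAt (s := Set.Ioi 0)
      rw [hasDerivWithinAt_iff_tendsto_slope' (by simp)] at ht
      refine le_of_tendsto ht ?_
      filter_upwards [hnear z hz, self_mem_nhdsWithin] with t h1 h2
      have := h _ h1
      simp only [slope_def_field, zero_smul, add_zero, sub_zero]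
      exact (div_neg_of_neg_of_pos this h2).le
  have hnB : ∀ᶠ x in 𝓝 y, x ∈ e.source ∧ e x ∈ B := by
    refine Filter.Eventually.and (e.open_source.mem_nhds hye) ?_
    exact (e.continuousAt hye).preimage_mem_nhds (hBo.mem_nhds (Metric.mem_ball_self hr))
  have hfin : ∀ x, x ∈ e.source → e x ∈ B → ∃ d, HasDerivAt (fun t : ℝ => c (e x + t • b)) d 0 ∧
      d * ev ((jm P).adjugate j i) x = ev (jm P).det x := by
    intro x hx hxB
    obtain ⟨d, hd, hd'⟩ := hder (e x) 0 (by simpa using hxB)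
    refine ⟨d, hd, ?_⟩
    rw [zero_smul, add_zero, e.left_inv hx] at hd'
    rw [ev_jm_adjugate, ev_jm_det, hd']
  have hac : ContinuousAt (ev ((jm P).adjugate j i)) y := (ev_continuous _).continuousAt
  rw [← ev_jm_adjugate] at hy
  rcases lt_or_gt_of_ne hy with hneg | hpos
  · have h1 := hac.eventually (gt_mem_nhds hneg)
    rcases hdsign with h | h
    · right
      filter_upwards [hnB, h1] with x hx hx'
      obtain ⟨d, hd, hd'⟩ := hfin x hx.1 hx.2
      rw [← hd']; exact mul_nonpos_of_nonneg_of_nonpos (h _ hx.2 d hd) hx'.le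
    · left
      filter_upwards [hnB, h1] with x hx hx'
      obtain ⟨d, hd, hd'⟩ := hfin x hx.1 hx.2
      rw [← hd']; exact mul_nonneg_of_nonpos_of_nonpos (h _ hx.2 d hd) hx'.le
  · have h1 := hac.eventually (lt_mem_nhds hpos)
    rcases hdsign with h | h
    · left
      filter_upwards [hnB, h1] with x hx hx'
      obtain ⟨d, hd, hd'⟩ := hfin x hx.1 hx.2
      rw [← hd']; exact mul_nonneg (h _ hx.2 d hd) hx'.le
    · right
      filter_upwards [hnB, h1] with x hx hx'
      obtain ⟨d, hd, hd'⟩ := hfin x hx.1 hx.2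
      rw [← hd']; exact mul_nonpos_of_nonpos_of_nonneg (h _ hx.2 d hd) hx'.le

end GR


namespace GR
open MvPolynomial Topology

lemma exists_common_ker {n : ℕ} (i : Fin n) (A : Matrix (Fin n) (Fin n) ℝ) (hA : A.adjugate = 0)
    (φ : Fin n → ℝ) : ∃ w : Fin n → ℝ, w ≠ 0 ∧ A.mulVec w = 0 ∧ φ ⬝ᵥ w = 0 := by
  have hdet : A.det = 0 := by
    have := Matrix.mul_adjugate A
    rw [hA, mul_zero] at this
    have := congrFun (congrFun this i) i
    simpa using this.symm
  obtain ⟨u, hu0, hu⟩ := Matrix.exists_vecMul_eq_zero_iff.2 hdet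
  obtain ⟨r, hr⟩ := Function.ne_iff.1 hu0
  have hdet2 : (A.updateRow r φ).det = 0 := by
    rw [← Matrix.cramer_transpose_apply, Matrix.cramer_eq_adjugate_mulVec,
      ← Matrix.adjugate_transpose, hA]
    simp
  obtain ⟨w, hw0, hw⟩ := Matrix.exists_mulVec_eq_zero_iff.2 hdet2
  have h1 : ∀ k, k ≠ r → A.mulVec w k = 0 := by
    intro k hk
    have := congrFun hw k
    simpa [Matrix.mulVec, Matrix.updateRow_ne hk] using this
  have h2 : φ ⬝ᵥ w = 0 := by
    have := congrFun hw r
    simpa [Matrix.mulVec] using this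
  refine ⟨w, hw0, ?_, h2⟩
  have h3 : u ⬝ᵥ A.mulVec w = 0 := by
    rw [Matrix.dotProduct_mulVec, hu, zero_dotProduct]
  rw [dotProduct, Finset.sum_eq_single r (fun k _ hk => by rw [h1 k hk, mul_zero]) (by simp)] at h3
  ext k
  by_cases hk : k = r
  · subst hk
    exact (mul_eq_zero.1 h3).resolve_left hr
  · exact h1 k hk

lemma jme_update_X {n : ℕ} (h : MvPolynomial (Fin n) ℝ) (i : Fin n) (x : E n) :
    (jme (Function.update X i h) x).det = ev (pderiv i h) x := by
  have : jme (Function.update X i h) x =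
      (1 : Matrix (Fin n) (Fin n) ℝ).updateRow i (fun l => ev (pderiv l h) x) := by
    ext k l
    by_cases hk : k = i
    · subst hk; simp [jme]
    · simp [jme, hk, Matrix.updateRow_ne hk, pderiv_X, Pi.single_apply, Matrix.one_apply]
      by_cases hl : k = l <;> simp [hl]
  rw [this, ← Matrix.cramer_transpose_apply]
  simp

lemma sign_change {n : ℕ} (h : MvPolynomial (Fin n) ℝ) (i : Fin n) (x : E n)
    (h0 : ev h x = 0) (hd : ev (pderiv i h) x ≠ 0) (N : Set (E n)) (hN : N ∈ 𝓝 x) :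
    ∃ u ∈ N, ∃ v ∈ N, ev h u * ev h v < 0 := by
  set b : E n := EuclideanSpace.single i (1 : ℝ) with hb
  have h1 : HasDerivAt (fun t : ℝ => x + t • b) b 0 := by
    have := ((hasDerivAt_id (0 : ℝ)).smul_const b).const_add x
    simpa using this
  have h2 : HasDerivAt (fun t : ℝ => ev h (x + t • b)) (ev (pderiv i h) x) 0 := by
    have h3 := (ev_hasFDeriv h (x + (0 : ℝ) • b)).comp_hasDerivAt 0 h1
    have : dev h (x + (0 : ℝ) • b) b = ev (pderiv i h) x := by
      rw [dev_apply, Finset.sum_eq_single i]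
      · simp [hb]
      · intro k _ hk; simp [hb, hk]
      · simp
    rw [this] at h3
    exact h3
  set d := ev (pderiv i h) x
  have hs := hasDerivAt_iff_tendsto_slope.1 h2
  have hs' : ∀ᶠ t in 𝓝[≠] (0 : ℝ), 0 < slope (fun t : ℝ => ev h (x + t • b)) 0 t * d := by
    have := hs.mul_const d
    exact this.eventually (lt_mem_nhds (mul_self_pos.2 hd))
  have hNt : ∀ᶠ t in 𝓝 (0 : ℝ), x + t • b ∈ N :=
    h1.continuousAt.preimage_mem_nhds (by simpa using hN)
  have hp : ∀ᶠ t in 𝓝[>] (0 : ℝ), x + t • b ∈ N ∧ 0 < ev h (x + t • b) * d := by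
    filter_upwards [hs'.filter_mono (nhdsWithin_mono _ (fun t ht => ne_of_gt ht)),
      hNt.filter_mono nhdsWithin_le_nhds, self_mem_nhdsWithin] with t h1 h2 h3
    refine ⟨h2, ?_⟩
    simp only [slope_def_field, zero_smul, add_zero, sub_zero, h0] at h1
    rw [div_mul_eq_mul_div] at h1
    exact (div_pos_iff_of_pos_right h3).1 h1
  have hn : ∀ᶠ t in 𝓝[<] (0 : ℝ), x + t • b ∈ N ∧ ev h (x + t • b) * d < 0 := by
    filter_upwards [hs'.filter_mono (nhdsWithin_mono _ (fun t ht => ne_of_lt ht)),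
      hNt.filter_mono nhdsWithin_le_nhds, self_mem_nhdsWithin] with t h1 h2 h3
    refine ⟨h2, ?_⟩
    simp only [slope_def_field, zero_smul, add_zero, sub_zero, h0] at h1
    rw [div_mul_eq_mul_div] at h1
    by_contra! hcon
    exact absurd h1 (not_lt.2 (div_nonpos_of_nonneg_of_nonpos hcon (le_of_lt h3)))
  obtain ⟨t, ht1, ht2⟩ := hp.exists
  obtain ⟨s, hs1, hs2⟩ := hn.exists
  refine ⟨_, ht1, _, hs1, ?_⟩
  have := mul_neg_of_pos_of_neg ht2 hs2
  have hdd : 0 < d * d := mul_self_pos.2 hd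
  by_contra! hcon
  nlinarith [mul_nonneg hcon hdd.le]

lemma jac_one_signed {n : ℕ} (P : Fin n → MvPolynomial (Fin n) ℝ) (hP : IsOpenMap (pm P))
    (a b : E n) : ¬ ev (jm P).det a * ev (jm P).det b < 0 := by
  intro hlt
  obtain ⟨h, k, e, i, x, hJ, he, hhx, hkx, hdx⟩ := exists_smooth_point _ a b hlt
  set O : Set (E n) := {y | ev k y ≠ 0} ∩ {y | ev (pderiv i h) y ≠ 0} with hO
  have hOo : IsOpen O := (isOpen_ne_fun (ev_continuous _) continuous_const).inter
    (isOpen_ne_fun (ev_continuous _) continuous_const)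
  have hadj : ∀ y ∈ O, ev h y = 0 → (jme P y).adjugate = 0 := by
    intro y hy hhy
    by_contra hne
    have : ∃ j i', (jme P y).adjugate j i' ≠ 0 := by
      by_contra! hcon
      exact hne (by ext j i'; exact hcon j i')
    obtain ⟨j, i', hji⟩ := this
    have hone := one_signed P hP y i' j hji
    have hkk : ∀ᶠ u in 𝓝 y, 0 < ev k u * ev k y := by
      have : ContinuousAt (fun u => ev k u * ev k y) y :=
        ((ev_continuous k).mul continuous_const).continuousAt
      exact this.eventually (lt_mem_nhds (mul_self_pos.2 hy.1))
    have hprod : ∀ u v, ev h u * ev h v < 0 → 0 < ev k u * ev k y → 0 < ev k v * ev k y →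
        ev (jm P).det u * ev (jm P).det v < 0 := by
      intro u v h1 h2 h3
      rw [hJ]
      simp only [ev_mul, ev_pow]
      have h4 : (ev h u * ev h v) ^ e < 0 := he.pow_neg_iff.2 h1
      have h5 : 0 < ev k u * ev k v := by
        have h6 := mul_pos h2 h3
        have hdd : 0 < ev k y * ev k y := mul_self_pos.2 hy.1
        by_contra! hcon
        nlinarith [mul_nonneg (neg_nonneg.2 hcon) hdd.le]
      rw [mul_pow] at h4
      nlinarith [mul_neg_of_neg_of_pos h4 h5]
    rcases hone with h1 | h1
    · obtain ⟨u, hu, v, hv, huv⟩ := sign_change h i y hhy hy.2 _ (h1.and hkk)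
      exact absurd (hprod u v huv hu.2 hv.2) (not_lt.2 (mul_nonneg hu.1 hv.1))
    · obtain ⟨u, hu, v, hv, huv⟩ := sign_change h i y hhy hy.2 _ (h1.and hkk)
      exact absurd (hprod u v huv hu.2 hv.2) (not_lt.2 (mul_nonneg_of_nonpos_of_nonpos hu.1 hv.1))
  obtain ⟨ee, hee, hxe, hsym⟩ := ift (Function.update X i h) x (by rwa [jme_update_X])
  let V : Submodule ℝ (E n) := LinearMap.ker ((EuclideanSpace.proj i : E n →L[ℝ] ℝ) : E n →ₗ[ℝ] ℝ)
  have hV : ∀ v : V, (v : E n) i = 0 := fun v => v.2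
  let sh : V → E n := fun v => ee x + v
  have hshd : ∀ v, HasFDerivAt sh V.subtypeL v := fun v =>
    (V.subtypeL.hasFDerivAt).const_add _
  have hshc : ContDiff ℝ 1 sh := contDiff_const.add V.subtypeL.contDiff
  let g : V → E n := fun v => pm P (ee.symm (sh v))
  let W : Set V := sh ⁻¹' (ee.target ∩ ee.symm ⁻¹' O)
  have hW : IsOpen W := (ee.symm.isOpen_inter_preimage hOo).preimage hshc.continuous
  have hW0 : (0 : V) ∈ W := by
    have h0 : sh 0 = ee x := by simp [sh]
    refine ⟨?_, ?_⟩
    · rw [h0]; exact ee.map_source hxe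
    · change ee.symm (sh 0) ∈ O
      rw [h0, ee.left_inv hxe]; exact ⟨hkx, hdx⟩
  have hhz : ∀ v ∈ W, ev h (ee.symm (sh v)) = 0 := by
    intro v hv
    have h1 := congrArg (fun w : E n => w i) (ee.right_inv hv.1)
    simp only [hee] at h1
    simp [sh, hee, hV v, hhx] at h1
    simp only [sh, hee]
    exact h1
  obtain ⟨q, hq⟩ := exists_infinite_fiber g W hW ⟨0, hW0⟩ (by
      intro v hv
      refine (pm_contDiff P).contDiffAt.comp v ?_
      exact (hsym _ hv.1).1.comp v hshc.contDiffAt) (by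
      intro v hv
      obtain ⟨_, M, hM, hM1, hM2⟩ := hsym _ hv.1
      have hg : HasFDerivAt g ((dpm P (ee.symm (sh v))).comp (M.comp V.subtypeL)) v :=
        (pm_hasFDeriv P _).comp v (hM.comp v (hshd v))
      rw [hg.fderiv]
      set y := ee.symm (sh v) with hy
      obtain ⟨w, hw0, hw1, hw2⟩ := exists_common_ker i (jme P y) (hadj y hv.2 (hhz v hv))
        (fun l => ev (pderiv l h) y)
      let w' : E n := WithLp.toLp 2 w
      have hu : dpm (Function.update X i h) y w' i = 0 := by
        rw [dpm_apply]
        simpa [dev_apply, dotProduct] using hw2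
      refine ⟨⟨dpm (Function.update X i h) y w', hu⟩, ?_, ?_⟩
      · intro h0
        have h1 : dpm (Function.update X i h) y w' = 0 := congrArg Subtype.val h0
        have h2 := hM2 w'
        rw [h1, map_zero] at h2
        apply hw0
        ext l
        have := congrArg (fun z : E n => z l) h2
        simpa [w'] using this.symm
      · change dpm P y (M (dpm (Function.update X i h) y w')) = 0
        rw [hM2]
        ext l
        rw [dpm_apply, dev_apply]
        have := congrFun hw1 l
        simpa [Matrix.mulVec, dotProduct, jme] using this)
  have hinj : Set.InjOn (fun v => ee.symm (sh v)) (W ∩ g ⁻¹' {q}) := by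
    intro v hv v' hv' hvv
    have := ee.symm.injOn (x₁ := sh v) (by simpa using hv.1.1) (x₂ := sh v')
      (by simpa using hv'.1.1) hvv
    exact Subtype.ext (add_left_cancel this)
  refine (hq.image hinj) ((finite_fiber P hP q).subset ?_)
  rintro _ ⟨v, hv, rfl⟩
  exact hv.2

end GR


namespace GR
open MvPolynomial

lemma der_prod {R A ι : Type*} [CommRing R] [CommRing A] [Algebra R A] [DecidableEq ι]
    (D : Derivation R A A) (s : Finset ι) (f : ι → A) :
    D (∏ i ∈ s, f i) = ∑ k ∈ s, ∏ i ∈ s, Function.update f k (D (f k)) i := by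
  induction s using Finset.induction_on with
  | empty => simp
  | insert a s ha ih =>
    rw [Finset.prod_insert ha, D.leibniz, ih, Finset.sum_insert ha, Finset.prod_insert ha,
      add_comm]
    congr 1
    · simp only [Function.update_self, smul_eq_mul]
      rw [mul_comm]
      congr 1
      refine Finset.prod_congr rfl fun i hi => ?_
      rw [Function.update_of_ne]
      rintro rfl; exact ha hi
    · rw [smul_eq_mul, Finset.mul_sum]
      refine Finset.sum_congr rfl fun k hk => ?_
      rw [Finset.prod_insert ha, Function.update_of_ne]
      rintro rfl; exact ha hk

lemma der_det {R A ι : Type*} [CommRing R] [CommRing A] [Algebra R A] [DecidableEq ι] [Fintype ι]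
    (D : Derivation R A A) (M : Matrix ι ι A) :
    D M.det = ∑ k, (M.updateCol k (fun a => D (M a k))).det := by
  simp only [Matrix.det_apply]
  rw [Finset.sum_comm, map_sum]
  refine Finset.sum_congr rfl fun σ _ => ?_
  rw [← Finset.smul_sum]
  have : ∀ (u : ℤˣ) (a : A), D (u • a) = u • D a := by
    intro u a
    rcases Int.units_eq_one_or u with h | h <;> simp [h]
  rw [this, der_prod]
  congr 1
  refine Finset.sum_congr rfl fun k _ => Finset.prod_congr rfl fun i _ => ?_
  by_cases h : i = k
  · subst h; simp
  · simp [h]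

lemma pderiv_pderiv_comm {n : ℕ} (i j : Fin n) (p : MvPolynomial (Fin n) ℝ) :
    pderiv i (pderiv j p) = pderiv j (pderiv i p) := by
  have h : ⁅(pderiv i : Derivation ℝ (MvPolynomial (Fin n) ℝ) (MvPolynomial (Fin n) ℝ)),
      (pderiv j : Derivation ℝ (MvPolynomial (Fin n) ℝ) (MvPolynomial (Fin n) ℝ))⁆ = 0 := by
    apply MvPolynomial.derivation_ext
    intro k
    rw [Derivation.commutator_apply]
    simp only [pderiv_X, Pi.single_apply]
    split_ifs <;> simp
  have := congrArg (fun D => D p) h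
  simp only [Derivation.commutator_apply] at this
  exact sub_eq_zero.1 this

lemma piola {n : ℕ} (P : Fin n → MvPolynomial (Fin n) ℝ) (i : Fin n) :
    ∑ j, pderiv j ((jm P).adjugate j i) = 0 := by
  set B := (jm P).transpose with hB
  have hadj : ∀ j, (jm P).adjugate j i = (B.updateCol i (Pi.single j 1)).det := by
    intro j
    rw [Matrix.adjugate_def, Matrix.of_apply, Matrix.cramer_apply]
  set W : Fin n → Fin n → Fin n → MvPolynomial (Fin n) ℝ := fun k j a =>
    ((B.updateCol i (Pi.single j 1)).updateCol k (Pi.single a 1)).det with hW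
  have hanti : ∀ k, k ≠ i → ∀ j a, W k j a = - W k a j := by
    intro k hk j a
    have : (B.updateCol i (Pi.single j 1)).updateCol k (Pi.single a 1) =
        ((B.updateCol i (Pi.single a 1)).updateCol k (Pi.single j 1)).submatrix id
          (Equiv.swap i k) := by
      ext r c
      simp only [Matrix.submatrix_apply, id, Matrix.updateCol_apply]
      by_cases h1 : c = k
      · subst h1; simp [hk.symm]
      · by_cases h2 : c = i
        · subst h2; simp [hk.symm]
        · simp [h1, h2, Equiv.swap_apply_of_ne_of_ne h2 h1]
    simp only [hW]
    rw [this, Matrix.det_permute', Equiv.Perm.sign_swap hk.symm]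
    simp
  have hder : ∀ j, pderiv j ((jm P).adjugate j i) =
      ∑ k, if k = i then 0 else ∑ a, pderiv j (pderiv a (P k)) * W k j a := by
    intro j
    rw [hadj, der_det]
    refine Finset.sum_congr rfl fun k _ => ?_
    by_cases hk : k = i
    · subst hk
      rw [if_pos rfl]
      apply Matrix.det_eq_zero_of_column_eq_zero k
      intro a
      by_cases h : a = j
      · subst h; simp
      · simp [h]
    · rw [if_neg hk]
      rw [← Matrix.cramer_apply]
      have : (fun a => pderiv j ((B.updateCol i (Pi.single j 1)) a k)) =
          ∑ a, pderiv j (pderiv a (P k)) • (Pi.single a 1 : Fin n → MvPolynomial (Fin n) ℝ) := by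
        ext1 a
        simp [hk, hB, jm, Finset.sum_apply, Pi.single_apply]
      rw [this, map_sum, Finset.sum_apply]
      refine Finset.sum_congr rfl fun a _ => ?_
      rw [map_smul, Pi.smul_apply, Matrix.cramer_apply, smul_eq_mul]
  simp only [hder]
  rw [Finset.sum_comm]
  refine Finset.sum_eq_zero fun k _ => ?_
  by_cases hk : k = i
  · simp [hk]
  simp only [if_neg hk]
  have h2 : ∑ j, ∑ a, pderiv j (pderiv a (P k)) * W k j a =
      - ∑ j, ∑ a, pderiv j (pderiv a (P k)) * W k j a := by
    conv_lhs => rw [Finset.sum_comm]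
    rw [← Finset.sum_neg_distrib]
    refine Finset.sum_congr rfl fun a _ => ?_
    rw [← Finset.sum_neg_distrib]
    refine Finset.sum_congr rfl fun j _ => ?_
    rw [hanti k hk j a, mul_neg, pderiv_pderiv_comm a j]
  exact self_eq_neg.1 h2

end GR


namespace GR
open MvPolynomial MeasureTheory Topology

lemma ibp {n : ℕ} (AP : Fin n → MvPolynomial (Fin n) ℝ) (hdiv : ∑ j, pderiv j (AP j) = 0)
    (G : E n → ℝ) (hG : ContDiff ℝ 1 G) (hGc : HasCompactSupport G) :
    ∫ x, fderiv ℝ G x (pm AP x) = 0 := by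
  have hd : ∀ j, ∀ x, fderiv ℝ (ev (AP j)) x (EuclideanSpace.single j 1) =
      ev (pderiv j (AP j)) x := by
    intro j x
    rw [(ev_hasFDeriv _ _).fderiv, dev_apply, Finset.sum_eq_single j]
    · simp
    · intro k _ hk; simp [hk]
    · simp
  have hGd : Continuous (fderiv ℝ G) := hG.continuous_fderiv one_ne_zero
  have hGdj : ∀ j, Continuous (fun x => fderiv ℝ G x (EuclideanSpace.single j 1)) := fun j =>
    hGd.clm_apply continuous_const
  have hGdc : ∀ j, HasCompactSupport (fun x => fderiv ℝ G x (EuclideanSpace.single j 1)) :=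
    fun j => hGc.fderiv_apply ℝ _
  have hi1 : ∀ j, Integrable (fun x => ev (AP j) x * fderiv ℝ G x (EuclideanSpace.single j 1)) :=
    fun j => ((ev_continuous _).mul (hGdj j)).integrable_of_hasCompactSupport (hGdc j).mul_left
  have hi2 : ∀ j, Integrable (fun x => ev (pderiv j (AP j)) x * G x) :=
    fun j => ((ev_continuous _).mul hG.continuous).integrable_of_hasCompactSupport hGc.mul_left
  have hi3 : ∀ j, Integrable (fun x => ev (AP j) x * G x) :=
    fun j => ((ev_continuous _).mul hG.continuous).integrable_of_hasCompactSupport hGc.mul_left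
  have hib : ∀ j, ∫ x, ev (AP j) x * fderiv ℝ G x (EuclideanSpace.single j 1) =
      - ∫ x, ev (pderiv j (AP j)) x * G x := by
    intro j
    have := integral_mul_fderiv_eq_neg_fderiv_mul_of_integrable (μ := volume)
      (f := ev (AP j)) (g := G) (v := EuclideanSpace.single j (1 : ℝ))
      (by simp only [hd]; exact hi2 j) (hi1 j) (hi3 j)
      (fun x _ => (ev_hasFDeriv _ _).differentiableAt)
      (fun x _ => (hG.differentiable one_ne_zero) x)
    rw [this]
    simp only [hd]
  have hexp : ∀ x, fderiv ℝ G x (pm AP x) =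
      ∑ j, ev (AP j) x * fderiv ℝ G x (EuclideanSpace.single j 1) := by
    intro x
    have : pm AP x = ∑ j, ev (AP j) x • (EuclideanSpace.single j (1 : ℝ) : E n) := by
      ext k
      simp [Finset.sum_apply, Pi.single_apply]
    rw [this, map_sum]
    simp
  simp only [hexp]
  rw [integral_finsetSum _ (fun j _ => hi1 j)]
  simp only [hib]
  rw [Finset.sum_neg_distrib, ← integral_finsetSum _ (fun j _ => hi2 j)]
  simp only [← Finset.sum_mul, ← ev_sum, hdiv]
  simp

lemma key_int {n : ℕ} (P : Fin n → MvPolynomial (Fin n) ℝ) (χ φ : E n → ℝ)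
    (hχ : ContDiff ℝ 1 χ) (hχc : HasCompactSupport χ) (hφ : ContDiff ℝ 1 φ) (z v : E n)
    (hz : ∀ x, fderiv ℝ χ x ≠ 0 → φ (pm P x - z) = 0) :
    ∫ x, χ x * fderiv ℝ φ (pm P x - z) v * ev (jm P).det x = 0 := by
  set AP : Fin n → MvPolynomial (Fin n) ℝ := fun j => ∑ i, (jm P).adjugate j i * C (v i)
  have hdiv : ∑ j, pderiv j (AP j) = 0 := by
    simp only [AP, map_sum]
    rw [Finset.sum_comm]
    refine Finset.sum_eq_zero fun i _ => ?_
    simp only [Derivation.leibniz, pderiv_C, smul_eq_mul, mul_zero, zero_add]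
    rw [← Finset.mul_sum, piola, mul_zero]
  have hφz : ContDiff ℝ 1 (fun x => φ (pm P x - z)) :=
    hφ.comp ((pm_contDiff P).sub contDiff_const)
  have h := ibp AP hdiv (fun x => χ x * φ (pm P x - z)) (hχ.mul hφz) hχc.mul_right
  rw [← h]
  refine integral_congr_ae (Filter.Eventually.of_forall fun x => ?_)
  simp only
  have hu : dpm P x (pm AP x) = ev (jm P).det x • v := by
    have h1 : (pm AP x).ofLp = (jme P x).adjugate.mulVec v := by
      ext j
      simp [AP, Matrix.mulVec, dotProduct, ev_jm_adjugate]
    ext k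
    have h2 : dpm P x (pm AP x) k = (jme P x).mulVec (pm AP x).ofLp k := by
      simp [dpm]
    rw [h2, h1, Matrix.mulVec_mulVec, Matrix.mul_adjugate, ev_jm_det]
    simp [Matrix.smul_mulVec]
  have hd1 : HasFDerivAt (fun x => φ (pm P x - z)) ((fderiv ℝ φ (pm P x - z)).comp (dpm P x)) x :=
    ((hφ.differentiable one_ne_zero _).hasFDerivAt).comp x ((pm_hasFDeriv P x).sub_const z)
  have hd2 : HasFDerivAt χ (fderiv ℝ χ x) x := (hχ.differentiable one_ne_zero _).hasFDerivAt
  have hd3 : HasFDerivAt (fun x => χ x * φ (pm P x - z)) _ x := hd2.mul hd1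
  rw [hd3.fderiv]
  simp only [add_apply, smul_apply, ContinuousLinearMap.comp_apply, hu, map_smul, smul_eq_mul]
  by_cases h0 : fderiv ℝ χ x = 0
  · rw [h0]; simp; ring
  · rw [hz x h0]; simp; ring

lemma int_const {n : ℕ} (P : Fin n → MvPolynomial (Fin n) ℝ) (χ φ : E n → ℝ)
    (hχ : ContDiff ℝ 1 χ) (hχc : HasCompactSupport χ) (hφ : ContDiff ℝ 1 φ)
    (hφc : HasCompactSupport φ) (S : Set (E n)) (hS : Convex ℝ S)
    (hz : ∀ z ∈ S, ∀ x, fderiv ℝ χ x ≠ 0 → φ (pm P x - z) = 0) (a b : E n) (ha : a ∈ S)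
    (hb : b ∈ S) :
    ∫ x, χ x * φ (pm P x - a) * ev (jm P).det x = ∫ x, χ x * φ (pm P x - b) * ev (jm P).det x := by
  have hφd : Continuous (fderiv ℝ φ) := hφ.continuous_fderiv one_ne_zero
  obtain ⟨K, hK⟩ := hφd.bounded_above_of_compact_support (hφc.fderiv ℝ)
  have hpm := pm_continuous P
  have hJ := ev_continuous (jm P).det
  set v := b - a with hv
  set F : ℝ → E n → ℝ := fun t x => χ x * φ (pm P x - (a + t • v)) * ev (jm P).det x with hF
  set F' : ℝ → E n → ℝ := fun t x =>
    χ x * (fderiv ℝ φ (pm P x - (a + t • v)) (-v)) * ev (jm P).det x with hF'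
  have hFc : ∀ t, Continuous (F t) := fun t =>
    (hχ.continuous.mul (hφ.continuous.comp (hpm.sub continuous_const))).mul hJ
  have hF'c : ∀ t, Continuous (F' t) := fun t =>
    (hχ.continuous.mul ((hφd.comp (hpm.sub continuous_const)).clm_apply continuous_const)).mul hJ
  have hder : ∀ t, HasDerivAt (fun t => ∫ x, F t x) (∫ x, F' t x) t := by
    intro t
    refine (hasDerivAt_integral_of_dominated_loc_of_deriv_le (μ := volume) (s := Set.univ)
      (bound := fun x => ‖χ x‖ * (K * ‖v‖) * ‖ev (jm P).det x‖) (F := F) (F' := F')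
      Filter.univ_mem ?_ ?_ ?_ ?_ ?_ ?_).2
    · exact Filter.Eventually.of_forall fun s => (hFc s).aestronglyMeasurable
    · exact (hFc t).integrable_of_hasCompactSupport (hχc.mul_right.mul_right)
    · exact (hF'c t).aestronglyMeasurable
    · refine Filter.Eventually.of_forall fun x s _ => ?_
      simp only [hF', norm_mul]
      gcongr
      refine (ContinuousLinearMap.le_opNorm _ _).trans ?_
      rw [norm_neg]
      gcongr
      exact hK _
    · refine Continuous.integrable_of_hasCompactSupport ?_ ?_
      · exact (hχ.continuous.norm.mul continuous_const).mul hJ.norm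
      · exact (hχc.norm.mul_right).mul_right
    · refine Filter.Eventually.of_forall fun x s _ => ?_
      have h1 : HasDerivAt (fun t : ℝ => pm P x - (a + t • v)) (-v) s := by
        have := (((hasDerivAt_id s).smul_const v).const_add a).const_sub (pm P x)
        simpa using this
      have h2 := ((hφ.differentiable one_ne_zero
        (pm P x - (a + s • v))).hasFDerivAt).comp_hasDerivAt s h1
      exact (h2.const_mul (χ x)).mul_const _
  have hzero : ∀ t ∈ Set.Icc (0 : ℝ) 1, ∫ x, F' t x = 0 := by
    intro t ht
    exact key_int P χ φ hχ hχc hφ _ _ (hz _ (hS.add_smul_sub_mem ha hb ht))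
  have hc := constant_of_has_deriv_right_zero (f := fun t => ∫ x, F t x) (a := 0) (b := 1)
    (fun t _ => (hder t).continuousAt.continuousWithinAt)
    (fun t ht => by
      have := (hder t).hasDerivWithinAt (s := Set.Ici t)
      rwa [hzero t ⟨ht.1, ht.2.le⟩] at this) 1 (by simp)
  simp only [hF, hv] at hc
  simpa using hc.symm

end GR


namespace GR
open MvPolynomial MeasureTheory Topology

lemma exists_det_ne {n : ℕ} (P : Fin n → MvPolynomial (Fin n) ℝ)
    (hfin : ∀ q, (pm P ⁻¹' {q}).Finite) (N : Set (E n)) (hN : IsOpen N) (hne : N.Nonempty) :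
    ∃ x ∈ N, ev (jm P).det x ≠ 0 := by
  by_contra! hcon
  obtain ⟨q, hq⟩ := exists_infinite_fiber (pm P) N hN hne
    (fun x _ => (pm_contDiff P).contDiffAt) (fun x hx => by
      have h0 : (jme P x).det = 0 := by rw [← ev_jm_det]; exact hcon x hx
      obtain ⟨w, hw0, hw⟩ := Matrix.exists_mulVec_eq_zero_iff.2 h0
      refine ⟨WithLp.toLp 2 w, fun h => hw0 ?_, ?_⟩
      · ext l
        exact congrArg (fun z : E n => z l) h
      · rw [(pm_hasFDeriv P x).fderiv]
        ext l
        rw [dpm_apply, dev_apply]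
        have := congrFun hw l
        simpa [Matrix.mulVec, dotProduct, jme] using this)
  exact hq ((hfin q).subset Set.inter_subset_right)

lemma int_ne_zero {n : ℕ} (g : E n → ℝ) (hg : Continuous g) (hc : HasCompactSupport g)
    (hs : (∀ x, 0 ≤ g x) ∨ (∀ x, g x ≤ 0)) (x0 : E n) (hx : g x0 ≠ 0) : ∫ x, g x ≠ 0 := by
  rcases hs with h | h
  · exact (hg.integral_pos_of_hasCompactSupport_nonneg_nonzero hc h hx).ne'
  · have h1 := (hg.neg).integral_pos_of_hasCompactSupport_nonneg_nonzero (μ := volume)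
      (f := fun x => - g x) (x := x0) hc.neg
      (fun x => by simpa using h x) (by simpa using hx)
    rw [integral_neg] at h1
    linarith

lemma exists_bump {n : ℕ} (p : E n) (R : ℝ) (hR : 0 < R) : ∃ χ : E n → ℝ, ContDiff ℝ 1 χ ∧
    HasCompactSupport χ ∧ (∀ x, 0 ≤ χ x) ∧ (∀ x ∈ Metric.closedBall p (R / 2), χ x = 1) ∧
    (∀ x, R ≤ dist x p → χ x = 0) := by
  let χ : ContDiffBump p := ⟨R / 2, R, by positivity, by linarith⟩
  exact ⟨χ, χ.contDiff, χ.hasCompactSupport, fun x => χ.nonneg,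
    fun x hx => χ.one_of_mem_closedBall hx, fun x hx => χ.zero_of_le_dist hx⟩

lemma open_core {n : ℕ} (P : Fin n → MvPolynomial (Fin n) ℝ)
    (hfin : ∀ q, (pm P ⁻¹' {q}).Finite)
    (hJ : (∀ x, 0 ≤ ev (jm P).det x) ∨ (∀ x, ev (jm P).det x ≤ 0)) (p : E n) (R δ : ℝ)
    (hR : 0 < R) (hδ0 : 0 < δ)
    (hδA : ∀ x ∈ Metric.closedBall p R, x ∉ Metric.ball p (R / 2) → 2 * δ ≤ dist (pm P x) (pm P p))
    (y0 : E n) (hy0 : y0 ∈ Metric.ball (pm P p) δ)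
    (hyB : y0 ∈ (pm P '' Metric.closedBall p R)ᶜ) : False := by
  obtain ⟨ηa, hηa, hηB⟩ := Metric.isOpen_iff.1
    ((isCompact_closedBall p R).image (pm_continuous P)).isClosed.isOpen_compl _ hyB
  obtain ⟨η, hη0, hηδ, hηη⟩ : ∃ η > 0, η ≤ δ ∧ η ≤ ηa :=
    ⟨min δ ηa, lt_min hδ0 hηa, min_le_left _ _, min_le_right _ _⟩
  obtain ⟨χ, hχ, hχc, hχ0, hχ1, hχz⟩ := exists_bump p R hR
  obtain ⟨φ, hφ, hφc, hφn, hφ1, hφz⟩ := exists_bump (0 : E n) η hη0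
  have hφ0 : ∀ w : E n, η ≤ ‖w‖ → φ w = 0 := fun w hw => hφz w (by simpa using hw)
  obtain ⟨ρ, hρ, hρδ⟩ := Metric.continuousAt_iff.1 (pm_continuous P).continuousAt δ hδ0
  obtain ⟨x0, hx0N, hx0J⟩ := exists_det_ne P hfin (Metric.ball p (min ρ (R / 2)))
    Metric.isOpen_ball (Metric.nonempty_ball.2 (lt_min hρ (half_pos hR)))
  have hx0p : x0 ∈ Metric.ball p (R / 2) := Metric.ball_subset_ball (min_le_right _ _) hx0N
  have hx0q : pm P x0 ∈ Metric.ball (pm P p) δ :=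
    hρδ (Metric.ball_subset_ball (min_le_left _ _) hx0N)
  have hzz : ∀ z ∈ Metric.ball (pm P p) δ, ∀ x, fderiv ℝ χ x ≠ 0 → φ (pm P x - z) = 0 := by
    intro z hz x hx
    have hxA : x ∈ Metric.closedBall p R ∧ x ∉ Metric.ball p (R / 2) := by
      refine ⟨?_, fun hxb => hx ?_⟩
      · by_contra hxb
        apply hx
        have h1 : χ =ᶠ[𝓝 x] fun _ => 0 := by
          filter_upwards [Metric.isClosed_closedBall.isOpen_compl.mem_nhds hxb] with y hy
          refine hχz y ?_
          rw [Set.mem_compl_iff, Metric.mem_closedBall, not_le] at hy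
          exact hy.le
        rw [h1.fderiv_eq]; simp
      · have h1 : χ =ᶠ[𝓝 x] fun _ => 1 := by
          filter_upwards [Metric.isOpen_ball.mem_nhds hxb] with y hy
          exact hχ1 _ (Metric.ball_subset_closedBall hy)
        rw [h1.fderiv_eq]; simp
    apply hφ0
    by_contra! hlt
    have h3 := hδA x hxA.1 hxA.2
    rw [Metric.mem_ball] at hz
    have h2 : dist (pm P x) z < δ := by
      rw [dist_eq_norm]; exact hlt.trans_le hηδ
    have := dist_triangle (pm P x) z (pm P p)
    linarith
  have hconst := int_const P χ φ hχ hχc hφ hφc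
    (Metric.ball (pm P p) δ) (convex_ball _ _) hzz (pm P x0) y0 hx0q hy0
  have hright : ∫ x, χ x * φ (pm P x - y0) * ev (jm P).det x = 0 := by
    refine integral_eq_zero_of_ae (Filter.Eventually.of_forall fun x => ?_)
    by_cases hx : x ∈ Metric.closedBall p R
    · have : φ (pm P x - y0) = 0 := by
        apply hφ0
        by_contra! hlt
        have h5 : pm P x ∈ Metric.ball y0 ηa := by
          rw [Metric.mem_ball, dist_eq_norm]
          exact hlt.trans_le hηη
        exact hηB h5 (Set.mem_image_of_mem _ hx)
      simp [this]
    · have : χ x = 0 := hχz x (by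
        rw [Metric.mem_closedBall, not_le] at hx; exact hx.le)
      simp [this]
  rw [hright] at hconst
  refine int_ne_zero (fun x => χ x * φ (pm P x - pm P x0) * ev (jm P).det x) ?_ ?_ ?_ x0 ?_ hconst
  · exact (hχ.continuous.mul (hφ.continuous.comp ((pm_continuous P).sub continuous_const))).mul
      (ev_continuous _)
  · exact (hχc.mul_right).mul_right
  · rcases hJ with h | h
    · left; intro x
      exact mul_nonneg (mul_nonneg (hχ0 _) (hφn _)) (h x)
    · right; intro x
      exact mul_nonpos_of_nonneg_of_nonpos (mul_nonneg (hχ0 _) (hφn _)) (h x)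
  · have h1 : χ x0 = 1 := hχ1 _ (Metric.ball_subset_closedBall hx0p)
    have h2 : φ (pm P x0 - pm P x0) = 1 := by
      rw [sub_self]; exact hφ1 _ (Metric.mem_closedBall_self (by positivity))
    simp only [h1, h2]
    simpa using hx0J

lemma open_of {n : ℕ} (P : Fin n → MvPolynomial (Fin n) ℝ)
    (hfin : ∀ q, (pm P ⁻¹' {q}).Finite)
    (hJ : (∀ x, 0 ≤ ev (jm P).det x) ∨ (∀ x, ev (jm P).det x ≤ 0)) : IsOpenMap (pm P) := by
  rw [isOpenMap_iff_nhds_le]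
  intro p V hV
  have hU : pm P ⁻¹' V ∈ 𝓝 p := hV
  have hcl : IsClosed ((pm P ⁻¹' {pm P p}) \ {p}) := ((hfin _).subset Set.diff_subset).isClosed
  have hnb : (pm P ⁻¹' V) ∩ ((pm P ⁻¹' {pm P p}) \ {p})ᶜ ∈ 𝓝 p :=
    Filter.inter_mem hU (hcl.isOpen_compl.mem_nhds (by simp))
  obtain ⟨R, hR, hRs⟩ := Metric.nhds_basis_closedBall.mem_iff.1 hnb
  have hAc : IsCompact (Metric.closedBall p R \ Metric.ball p (R / 2)) := (isCompact_closedBall p R).diff Metric.isOpen_ball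
  have hqA : pm P p ∈ (pm P '' (Metric.closedBall p R \ Metric.ball p (R / 2)))ᶜ := by
    rintro ⟨x, hx, hxp⟩
    refine (hRs hx.1).2 ⟨hxp, ?_⟩
    rintro rfl
    exact hx.2 (Metric.mem_ball_self (by positivity))
  obtain ⟨δ', hδ', hδA⟩ := Metric.isOpen_iff.1
    (hAc.image (pm_continuous P)).isClosed.isOpen_compl _ hqA
  refine Filter.mem_of_superset (Metric.ball_mem_nhds _ (half_pos hδ')) ?_
  intro y0 hy0
  by_contra hyV
  have hyB : y0 ∈ (pm P '' Metric.closedBall p R)ᶜ := by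
    rintro ⟨x, hx, rfl⟩
    exact hyV (hRs hx).1
  refine open_core P hfin hJ p R (δ' / 2) hR (half_pos hδ') ?_ y0 hy0 hyB
  intro x hx hx'
  by_contra! hlt
  have h5 : pm P x ∈ Metric.ball (pm P p) δ' := by
    rw [Metric.mem_ball]
    linarith
  exact hδA h5 (Set.mem_image_of_mem _ ⟨hx, hx'⟩)

end GR


/-- **Theorem (Gamboa–Ronga).** A polynomial map `f : ℝⁿ → ℝⁿ` is open if and
only if all point inverses are finite and the Jacobian does not change sign. -/
theorem gamboa_ronga_polynomial_open_iff
    {n : ℕ} (hn : 1 ≤ n)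
    (f : EuclideanSpace ℝ (Fin n) → EuclideanSpace ℝ (Fin n))
    (hf : ∀ i : Fin n, ∃ P : MvPolynomial (Fin n) ℝ,
      ∀ x, f x i = MvPolynomial.eval (fun j => x j) P) :
    IsOpenMap f ↔
      ((∀ q, (f ⁻¹' {q}).Finite) ∧
        ((∀ p, 0 ≤ (fderiv ℝ f p).det) ∨ (∀ p, (fderiv ℝ f p).det ≤ 0))) := by
  choose P hP using hf
  have hfP : f = GR.pm P := by
    funext x
    ext i
    exact hP i x
  subst hfP
  have hdet : ∀ p, (fderiv ℝ (GR.pm P) p).det = GR.ev (GR.jm P).det p := by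
    intro p
    rw [(GR.pm_hasFDeriv P p).fderiv, GR.dpm_det, GR.ev_jm_det]
  simp only [hdet]
  constructor
  · intro h
    refine ⟨GR.finite_fiber P h, ?_⟩
    by_contra! hcon
    obtain ⟨⟨a, ha⟩, b, hb⟩ := hcon
    exact GR.jac_one_signed P h a b (mul_neg_of_neg_of_pos ha hb)
  · rintro ⟨h1, h2⟩
    exact GR.open_of P h1 h2
end

section
/- Let n ≥ 1 and let f : ℝⁿ → ℝⁿ be a real analytic open map. Let p be a critical point of f (det(df_p) = 0) and suppose there exist an open neighborhood U of p and a real analytic function g : U → ℝ whose derivative dg_q is nonzero for every q ∈ U, such that the critical set of f inside U equals the zero set of g: {q ∈ U : det(df_q) = 0} = {q ∈ U : g(q) = 0}. Suppose moreover that the rank of df_q restricted to the hyperplane ker(dg_q) is the same for all q ∈ U with g(q) = 0 (i.e., f restricted to the critical hypersurface has constant rank near p). Then this constant rank equals n − 1, and f is a local homeomorphism at p: there is an open neighborhood of p on which f restricts to a homeomorphism onto an open set. -/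
open Set Filter Topology Metric
set_option linter.unusedSectionVars false

lemma sign_seq (δ : ℝ) : ∀ (k : ℕ) (φ : ℕ → ℝ → ℝ),
    (∀ i x, |x| < δ → HasDerivAt (φ i) (φ (i+1) x) x) → (∀ i < k, φ i 0 = 0) →
    (∀ x, |x| < δ → 0 < φ k x) → ∀ x, |x| < δ → x ≠ 0 → 0 < x ^ k * φ 0 x := by
  intro k
  induction k with
  | zero => intro φ _ _ h x hx _; simpa using h x hx
  | succ k ih =>
    intro φ hd h0 hpos x hx hx0
    have ih' := ih (fun i => φ (i+1)) (fun i x hx => hd (i+1) x hx)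
      (fun i hi => h0 (i+1) (by omega)) hpos
    have hφ0 := h0 0 (by omega)
    rcases lt_or_gt_of_ne hx0 with hneg | hp
    · obtain ⟨ξ, hξ, he⟩ := exists_hasDerivAt_eq_slope (φ 0) (φ 1) hneg
        (fun y hy => (hd 0 y (by
          rw [abs_lt] at hx ⊢; constructor <;> linarith [hy.1, hy.2])).continuousAt.continuousWithinAt)
        (fun y hy => hd 0 y (by
          rw [abs_lt] at hx ⊢; constructor <;> linarith [hy.1, hy.2]))
      have hξ' := ih' ξ (by rw [abs_lt] at hx ⊢; constructor <;> linarith [hξ.1, hξ.2]) hξ.2.ne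
      have e : φ 0 x = x * φ 1 ξ := by
        rw [he, hφ0]; field_simp; ring
      have hq : 0 < x / ξ := div_pos_of_neg_of_neg hneg hξ.2
      have : x ^ (k+1) * φ 0 x = x ^ 2 * ((x / ξ) ^ k * (ξ ^ k * φ 1 ξ)) := by
        rw [e, div_pow]
        have := hξ.2.ne
        field_simp
        ring
      rw [this]
      exact mul_pos (by positivity) (mul_pos (pow_pos hq _) hξ')
    · obtain ⟨ξ, hξ, he⟩ := exists_hasDerivAt_eq_slope (φ 0) (φ 1) hp
        (fun y hy => (hd 0 y (by
          rw [abs_lt] at hx ⊢; constructor <;> linarith [hy.1, hy.2])).continuousAt.continuousWithinAt)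
        (fun y hy => hd 0 y (by
          rw [abs_lt] at hx ⊢; constructor <;> linarith [hy.1, hy.2]))
      have hξ' := ih' ξ (by rw [abs_lt] at hx ⊢; constructor <;> linarith [hξ.1, hξ.2]) hξ.1.ne'
      have e : φ 0 x = x * φ 1 ξ := by
        rw [he, hφ0]; field_simp; ring
      have hq : 0 < x / ξ := div_pos hp hξ.1
      have : x ^ (k+1) * φ 0 x = x ^ 2 * ((x / ξ) ^ k * (ξ ^ k * φ 1 ξ)) := by
        rw [e, div_pow]
        have := hξ.1.ne'
        field_simp
        ring
      rw [this]
      exact mul_pos (by positivity) (mul_pos (pow_pos hq _) hξ')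

/-- 1-D identity theorem through a tower of derivatives. -/
lemma zero_of_tower {E : Type*} [NormedAddCommGroup E] [NormedSpace ℝ E] [CompleteSpace E]
    (ε : ℝ) (φ : ℕ → ℝ → E)
    (ha : AnalyticOnNhd ℝ (φ 0) (ball 0 ε))
    (hd : ∀ i, ∀ x ∈ ball (0:ℝ) ε, HasDerivAt (φ i) (φ (i+1) x) x)
    (h0 : ∀ i, φ i 0 = 0) : ∀ x ∈ ball (0:ℝ) ε, φ 0 x = 0 := by
  intro x hx
  have hε : (0:ℝ) ∈ ball (0:ℝ) ε := by
    simp only [mem_ball, dist_self]; exact lt_of_le_of_lt dist_nonneg hx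
  have hit : ∀ i, ∀ y ∈ ball (0:ℝ) ε, iteratedDeriv i (φ 0) y = φ i y := by
    intro i
    induction i with
    | zero => intro y _; simp
    | succ i ih =>
      intro y hy
      rw [iteratedDeriv_succ]
      have : iteratedDeriv i (φ 0) =ᶠ[𝓝 y] φ i := by
        filter_upwards [isOpen_ball.mem_nhds hy] with z hz using ih z hz
      rw [this.deriv_eq, (hd i y hy).deriv]
  have htop : analyticOrderAt (φ 0) 0 = ⊤ := by
    rw [ENat.eq_top_iff_forall_ge]
    intro m
    rw [natCast_le_analyticOrderAt_iff_iteratedDeriv_eq_zero (ha 0 hε)]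
    intro i _
    rw [hit i 0 hε, h0]
  rw [analyticOrderAt_eq_top] at htop
  exact ha.eqOn_zero_of_preconnected_of_eventuallyEq_zero
    (convex_ball (0:ℝ) ε).isPreconnected hε htop hx

lemma exists_functional {E : Type*} [NormedAddCommGroup E] [NormedSpace ℝ E]
    [FiniteDimensional ℝ E] (P : Submodule ℝ E) (h2 : 1 < Module.finrank ℝ P)
    (c : E) (hc : c ≠ 0) : ∃ e ∈ P, ∃ a b : E →L[ℝ] ℝ, 0 < a c ∧ 0 < b c ∧ a e < 0 ∧ 0 < b e := by
  obtain ⟨e, heP, he⟩ : ∃ e ∈ P, e ∉ Submodule.span ℝ {c} := by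
    by_contra! hcon
    have : P ≤ Submodule.span ℝ {c} := hcon
    have := Submodule.finrank_mono this
    rw [finrank_span_singleton hc] at this
    omega
  obtain ⟨l2, h2e, h2c⟩ := Submodule.exists_dual_map_eq_bot_of_notMem he inferInstance
  have hl2c : l2 c = 0 := by
    have : l2 c ∈ Submodule.map l2 (Submodule.span ℝ {c}) :=
      Submodule.mem_map_of_mem (Submodule.mem_span_singleton_self c)
    rwa [h2c, Submodule.mem_bot] at this
  obtain ⟨l1, hl1⟩ := SeparatingDual.exists_eq_one (R := ℝ) hc
  let m : E →L[ℝ] ℝ := LinearMap.toContinuousLinearMap l2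
  have hm : ∀ x, m x = l2 x := fun x => rfl
  let s : ℝ := (|l1 e| + 1) / l2 e
  have hs : s * l2 e = |l1 e| + 1 := by simp only [s]; field_simp
  refine ⟨e, heP, l1 - s • m, l1 + s • m, ?_, ?_, ?_, ?_⟩
  · simp [hm, hl2c, hl1]
  · simp [hm, hl2c, hl1]
  · simp [hm, hs]; linarith [le_abs_self (l1 e)]
  · simp [hm, hs]; linarith [neg_abs_le (l1 e)]

section
variable {E R K : Type*} [NormedAddCommGroup E] [NormedSpace ℝ E] [FiniteDimensional ℝ E]
  [NormedAddCommGroup R] [NormedSpace ℝ R] [NormedAddCommGroup K] [NormedSpace ℝ K]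

lemma exists_small {F : ℝ × R × K → E} {V : Set (ℝ × R × K)} (hV : IsOpen (F '' V))
    {q : ℝ × R × K} (hq : q ∈ V) (e : E) : ∃ t > 0, ∃ q' ∈ V, F q' = F q + (t:ℝ) • e := by
  have h1 : Tendsto (fun t : ℝ => F q + t • e) (𝓝[>] 0) (𝓝 (F q)) := by
    have : Continuous (fun t : ℝ => F q + t • e) := by fun_prop
    have := this.tendsto 0
    simp only [zero_smul, add_zero] at this
    exact this.mono_left nhdsWithin_le_nhds
  have h2 := h1.eventually (hV.mem_nhds (mem_image_of_mem F hq))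
  obtain ⟨t, ht, ht0⟩ := (h2.and self_mem_nhdsWithin).exists
  obtain ⟨q', hq', he⟩ := ht
  exact ⟨t, ht0, q', hq', he⟩

lemma line_hasDerivAt {G : Type*} [NormedAddCommGroup G] [NormedSpace ℝ G]
    {D : ℝ × R × K → G} {x : ℝ} {y : R × K} (h : DifferentiableAt ℝ D (x, y)) :
    HasDerivAt (fun s => D (s, y)) (fderiv ℝ D (x, y) (1, 0)) x := by
  have h1 : HasDerivAt (fun s : ℝ => (s, y)) ((1:ℝ), (0 : R × K)) x :=
    (hasDerivAt_id x).prodMk (hasDerivAt_const x y)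
  exact h.hasFDerivAt.comp_hasDerivAt x h1

lemma mem_ball_iff' {z₀ : R} {w₀ : K} {ε : ℝ} {x : ℝ} {y : R × K} :
    (x, y) ∈ ball ((0:ℝ), z₀, w₀) ε ↔ |x| < ε ∧ y ∈ ball (z₀, w₀) ε := by
  rw [← ball_prod_same, mem_prod]; simp

theorem core1 (F : ℝ × R × K → E) (z₀ : R) (w₀ : K) (ε : ℝ) (hε : 0 < ε)
    (hF : AnalyticOnNhd ℝ F (ball (0, z₀, w₀) ε))
    (hopen : ∀ V ⊆ ball (0, z₀, w₀) ε, IsOpen V → IsOpen (F '' V))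
    (π : E →L[ℝ] R) (hπ : ∀ q ∈ ball (0, z₀, w₀) ε, π (F q) = q.2.1)
    (hw : ∀ z w w', (0, z, w) ∈ ball ((0:ℝ), z₀, w₀) ε → (0, z, w') ∈ ball ((0:ℝ), z₀, w₀) ε →
      F (0, z, w) = F (0, z, w')) :
    Module.finrank ℝ (LinearMap.ker π.toLinearMap) ≤ 1 := by
  by_contra! h2
  set B := ball ((0:ℝ), z₀, w₀) ε with hB
  have hB0 : ∀ q ∈ B, (0, q.2) ∈ B := by
    rintro ⟨x, y⟩ hq
    rw [hB, mem_ball_iff'] at hq ⊢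
    exact ⟨by simpa using hε, hq.2⟩
  let Dn : ℕ → ℝ × R × K → E := fun i => Nat.rec (fun q => F q - F (0, q.2))
    (fun _ D q => fderiv ℝ D q (1, 0)) i
  have hD0 : ∀ q, Dn 0 q = F q - F (0, q.2) := fun q => rfl
  have hDs : ∀ i q, Dn (i+1) q = fderiv ℝ (Dn i) q (1, 0) := fun i q => rfl
  have hDa : ∀ i, AnalyticOnNhd ℝ (Dn i) B := by
    intro i
    induction i with
    | zero =>
      intro q hq
      have h1 : AnalyticAt ℝ (fun q : ℝ × R × K => ((0:ℝ), q.2)) q :=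
        AnalyticAt.prod analyticAt_const analyticAt_snd
      exact (hF q hq).sub (AnalyticAt.fun_comp (g := F) (f := fun q : ℝ × R × K => ((0:ℝ), q.2)) (hF _ (hB0 q hq)) h1)
    | succ i ih =>
      intro q hq
      have := ih.fderiv q hq
      exact ((ContinuousLinearMap.apply ℝ E ((1:ℝ), (0 : R × K))).analyticAt _).fun_comp this
  have hline : ∀ i x y, (x, y) ∈ B → HasDerivAt (fun s => Dn i (s, y)) (Dn (i+1) (x, y)) x :=
    fun i x y h => line_hasDerivAt ((hDa i _ h).differentiableAt)
  rcases Classical.em (∀ i, ∀ q ∈ B, q.1 = 0 → Dn i q = 0) with hall | hall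
  · have hDz : ∀ q ∈ B, F q = F (0, q.2) := by
      rintro ⟨x, y⟩ hq
      have hq' := mem_ball_iff'.1 hq
      have := zero_of_tower ε (fun i s => Dn i (s, y)) (by
          intro s hs
          have hs' : (s, y) ∈ B := mem_ball_iff'.2 ⟨by simpa using hs, hq'.2⟩
          exact (hDa 0 _ hs').curry_left)
        (by
          intro i s hs
          have hs' : (s, y) ∈ B := mem_ball_iff'.2 ⟨by simpa using hs, hq'.2⟩
          exact hline i s y hs')
        (fun i => hall i (0, y) (hB0 _ hq) rfl) x (by simpa using hq'.1)
      exact sub_eq_zero.1 this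
    obtain ⟨e, he⟩ : ∃ e : LinearMap.ker π.toLinearMap, e ≠ 0 := by
      have : Nontrivial (LinearMap.ker π.toLinearMap) :=
        Module.nontrivial_of_finrank_pos (R := ℝ) (by omega)
      exact exists_ne 0
    have hc : ((0:ℝ), z₀, w₀) ∈ B := mem_ball_self hε
    obtain ⟨t, ht, q, hq, hqe⟩ := exists_small (hopen B subset_rfl isOpen_ball) hc (e : E)
    have hπe : π (e : E) = 0 := e.2
    have hz : q.2.1 = z₀ := by
      rw [← hπ q hq, hqe]; simp [hπe, hπ _ hc]
    have h3 : F q = F (0, z₀, w₀) := by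
      rw [hDz q hq]
      have := hB0 q hq
      obtain ⟨x, z, w⟩ := q
      simp only at hz this ⊢
      subst hz
      exact hw _ _ _ this hc
    rw [h3] at hqe
    have h4 : t • (e : E) = 0 := by simpa using hqe
    rcases smul_eq_zero.1 h4 with h | h
    · exact ht.ne' h
    · exact he (Subtype.ext h)
  · push Not at hall
    classical
    have hdec : DecidablePred (fun i => ∃ q ∈ B, q.1 = 0 ∧ Dn i q ≠ 0) := Classical.decPred _
    let k := Nat.find hall
    obtain ⟨⟨x₀, z₁, w₁⟩, hqB, hq0, hqne⟩ := Nat.find_spec hall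
    simp only at hq0
    subst hq0
    have hmin : ∀ i < k, ∀ q ∈ B, q.1 = 0 → Dn i q = 0 := by
      intro i hi
      have := Nat.find_min hall hi
      push Not at this
      exact this
    change Dn k (0, z₁, w₁) ≠ 0 at hqne
    obtain ⟨e, heP, a, b, hac, hbc, hae, hbe⟩ := exists_functional _ h2 _ hqne
    have hπe : π (e : E) = 0 := heP
    have hcont : ContinuousAt (Dn k) (0, z₁, w₁) := (hDa k _ hqB).continuousAt
    have e1 : ∀ᶠ q in 𝓝 ((0:ℝ), z₁, w₁), 0 < a (Dn k q) :=
      (a.continuous.continuousAt.comp hcont).eventually (lt_mem_nhds hac)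
    have e2 : ∀ᶠ q in 𝓝 ((0:ℝ), z₁, w₁), 0 < b (Dn k q) :=
      (b.continuous.continuousAt.comp hcont).eventually (lt_mem_nhds hbc)
    obtain ⟨δ, hδ, hball⟩ := Metric.mem_nhds_iff.1
      ((e1.and e2).and (isOpen_ball.mem_nhds hqB))
    have hsub : ball ((0:ℝ), z₁, w₁) δ ⊆ B := fun q hq => (hball hq).2
    have hc : ((0:ℝ), z₁, w₁) ∈ ball ((0:ℝ), z₁, w₁) δ := mem_ball_self hδ
    obtain ⟨t, ht, ⟨x, z, w⟩, hq, hqe⟩ := exists_small (hopen _ hsub isOpen_ball) hc e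
    have hz : z = z₁ := by
      have := hπ _ (hsub hq)
      rw [hqe] at this
      simpa [hπe, hπ _ hqB] using this.symm
    subst hz
    have hDq : Dn 0 (x, z, w) = t • e := by
      rw [hD0, hqe, hw z w w₁ (hB0 _ (hsub hq)) hqB]
      simp
    have hx0 : x ≠ 0 := by
      rintro rfl
      rw [hD0] at hDq
      simp only [sub_self] at hDq
      rcases smul_eq_zero.1 hDq.symm with h | h
      · exact ht.ne' h
      · rw [h] at hae; simp at hae
    have hq' := mem_ball_iff'.1 hq
    have key : ∀ l : E →L[ℝ] ℝ, (∀ q ∈ ball ((0:ℝ), z, w₁) δ, 0 < l (Dn k q)) →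
        0 < x ^ k * l (t • e) := by
      intro l hl
      have := sign_seq δ k (fun i s => l (Dn i (s, z, w)))
        (fun i s hs => l.hasFDerivAt.comp_hasDerivAt s
          (hline i s (z, w) (hsub (mem_ball_iff'.2 ⟨hs, hq'.2⟩))))
        (fun i hi => by
          have : Dn i (0, z, w) = 0 := hmin i hi _ (hB0 _ (hsub hq)) rfl
          simp [this])
        (fun s hs => hl _ (mem_ball_iff'.2 ⟨hs, hq'.2⟩)) x hq'.1 hx0
      simpa only [hDq] using this
    have ka := key a (fun q hq => (hball hq).1.1)
    have kb := key b (fun q hq => (hball hq).1.2)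
    simp only [map_smul, smul_eq_mul] at ka kb
    have := mul_pos ka kb
    have h5 : x ^ k * (t * a e) * (x ^ k * (t * b e)) = (x ^ k * t) ^ 2 * (a e * b e) := by ring
    rw [h5] at this
    have h6 : a e * b e < 0 := mul_neg_of_neg_of_pos hae hbe
    nlinarith [sq_nonneg (x ^ k * t)]

lemma sign_const {X : Type*} [TopologicalSpace X] {S : Set X} (hS : IsPreconnected S)
    {v : X → ℝ} (hv : ContinuousOn v S) (h0 : ∀ q ∈ S, v q ≠ 0) :
    (∀ q ∈ S, 0 < v q) ∨ (∀ q ∈ S, v q < 0) := by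
  by_contra! hcon
  obtain ⟨⟨q, hq, hq'⟩, ⟨q1, hq1, hq1'⟩⟩ := hcon
  obtain ⟨s, hs, hs'⟩ := hS.intermediate_value hq hq1 hv ⟨hq', hq1'⟩
  exact h0 s hs hs'

lemma core2_aux (F : ℝ × R × K → E) (z₀ : R) (w₀ : K) (ε : ℝ) (hε : 0 < ε) [Subsingleton K]
    (hF : AnalyticOnNhd ℝ F (ball (0, z₀, w₀) ε))
    (hopen : ∀ V ⊆ ball (0, z₀, w₀) ε, IsOpen V → IsOpen (F '' V))
    (π : E →L[ℝ] R) (hπ : ∀ q ∈ ball (0, z₀, w₀) ε, π (F q) = q.2.1)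
    (l : E →L[ℝ] ℝ) (e : E) (hπe : π e = 0) (hle : l e = 1)
    (hpos : ∀ q ∈ ball ((0:ℝ), z₀, w₀) ε, 0 < q.1 → 0 < l (fderiv ℝ F q (1, 0)))
    (hneg : (∀ q ∈ ball ((0:ℝ), z₀, w₀) ε, q.1 < 0 → 0 < l (fderiv ℝ F q (1, 0))) ∨
      (∀ q ∈ ball ((0:ℝ), z₀, w₀) ε, q.1 < 0 → l (fderiv ℝ F q (1, 0)) < 0)) :
    InjOn F (ball (0, z₀, w₀) ε) := by
  have hline : ∀ x y, (x, y) ∈ ball ((0:ℝ), z₀, w₀) ε →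
      HasDerivAt (fun s => l (F (s, y))) (l (fderiv ℝ F (x, y) (1, 0))) x :=
    fun x y h => l.hasFDerivAt.comp_hasDerivAt x (line_hasDerivAt ((hF _ h).differentiableAt))
  have hmono : ∀ y ∈ ball (z₀, w₀) ε, StrictMonoOn (fun s => l (F (s, y))) (Ico 0 ε) := by
    intro y hy
    have hm : ∀ s ∈ Ico 0 ε, (s, y) ∈ ball ((0:ℝ), z₀, w₀) ε := fun s hs =>
      mem_ball_iff'.2 ⟨by rw [abs_of_nonneg hs.1]; exact hs.2, hy⟩
    apply strictMonoOn_of_deriv_pos (convex_Ico 0 ε)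
    · exact fun s hs => (hline s y (hm s hs)).continuousAt.continuousWithinAt
    · intro s hs
      rw [interior_Ico] at hs
      rw [(hline s y (hm s ⟨hs.1.le, hs.2⟩)).deriv]
      exact hpos _ (hm s ⟨hs.1.le, hs.2⟩) hs.1
  have hm : ∀ y ∈ ball (z₀, w₀) ε, ∀ s ∈ Ioc (-ε) 0, (s, y) ∈ ball ((0:ℝ), z₀, w₀) ε :=
    fun y hy s hs => mem_ball_iff'.2 ⟨by rw [abs_of_nonpos hs.2]; linarith [hs.1], hy⟩
  rcases hneg with hneg | hneg
  · have hmono' : ∀ y ∈ ball (z₀, w₀) ε, StrictMonoOn (fun s => l (F (s, y))) (Ioc (-ε) 0) := by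
      intro y hy
      apply strictMonoOn_of_deriv_pos (convex_Ioc (-ε) 0)
      · exact fun s hs => (hline s y (hm y hy s hs)).continuousAt.continuousWithinAt
      · intro s hs
        rw [interior_Ioc] at hs
        rw [(hline s y (hm y hy s ⟨hs.1, hs.2.le⟩)).deriv]
        exact hneg _ (hm y hy s ⟨hs.1, hs.2.le⟩) hs.2
    rintro ⟨x, z, w⟩ hq ⟨x', z', w'⟩ hq' heq
    have hzz : z = z' := by
      have h1 := hπ _ hq
      have h2 := hπ _ hq'
      rw [heq] at h1
      exact h1.symm.trans h2
    obtain rfl := hzz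
    obtain rfl := Subsingleton.elim w w'
    have hq := mem_ball_iff'.1 hq
    have hq' := mem_ball_iff'.1 hq'
    have hU := (hmono' _ hq.2).union (hmono _ hq.2) (c := 0)
      ⟨⟨by linarith, le_rfl⟩, fun s hs => hs.2⟩ ⟨⟨le_rfl, hε⟩, fun s hs => hs.1⟩
    have hin : ∀ s, |s| < ε → s ∈ Ioc (-ε) 0 ∪ Ico 0 ε := by
      intro s hs
      rw [abs_lt] at hs
      rcases le_total s 0 with h | h
      · exact Or.inl ⟨hs.1, h⟩
      · exact Or.inr ⟨h, hs.2⟩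
    have := hU.injOn (hin x hq.1) (hin x' hq'.1) (by simp only [heq])
    rw [this]
  · exfalso
    have hanti : ∀ y ∈ ball (z₀, w₀) ε, StrictAntiOn (fun s => l (F (s, y))) (Ioc (-ε) 0) := by
      intro y hy
      apply strictAntiOn_of_deriv_neg (convex_Ioc (-ε) 0)
      · exact fun s hs => (hline s y (hm y hy s hs)).continuousAt.continuousWithinAt
      · intro s hs
        rw [interior_Ioc] at hs
        rw [(hline s y (hm y hy s ⟨hs.1, hs.2.le⟩)).deriv]
        exact hneg _ (hm y hy s ⟨hs.1, hs.2.le⟩) hs.2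
    have hc : ((0:ℝ), z₀, w₀) ∈ ball ((0:ℝ), z₀, w₀) ε := mem_ball_self hε
    obtain ⟨t, ht, ⟨x, z, w⟩, hq, hqe⟩ := exists_small (hopen _ subset_rfl isOpen_ball) hc (-e)
    have hz : z = z₀ := by
      have := hπ _ hq
      rw [hqe] at this
      simpa [hπe, hπ _ hc] using this.symm
    subst hz
    obtain rfl := Subsingleton.elim w w₀
    have hlt : l (F (x, z, w)) < l (F (0, z, w)) := by
      rw [hqe]; simp [hle, ht]
    have hq := mem_ball_iff'.1 hq
    have hx := abs_lt.1 hq.1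
    rcases le_total x 0 with h | h
    · have := (hanti _ hq.2).antitoneOn (a := x) (b := 0) ⟨hx.1, h⟩ ⟨by linarith, le_rfl⟩ h
      linarith
    · have := (hmono _ hq.2).monotoneOn (a := 0) (b := x) ⟨le_rfl, hε⟩ ⟨h, hx.2⟩ h
      linarith

theorem core2 (F : ℝ × R × K → E) (z₀ : R) (w₀ : K) (ε : ℝ) (hε : 0 < ε) [Subsingleton K]
    (hF : AnalyticOnNhd ℝ F (ball (0, z₀, w₀) ε))
    (hopen : ∀ V ⊆ ball (0, z₀, w₀) ε, IsOpen V → IsOpen (F '' V))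
    (π : E →L[ℝ] R) (hπ : ∀ q ∈ ball (0, z₀, w₀) ε, π (F q) = q.2.1)
    (l : E →L[ℝ] ℝ) (e : E) (hπe : π e = 0) (hle : l e = 1)
    (hker : ∀ v, π v = 0 → l v = 0 → v = 0)
    (hne : ∀ q ∈ ball ((0:ℝ), z₀, w₀) ε, q.1 ≠ 0 → fderiv ℝ F q (1, 0) ≠ 0) :
    InjOn F (ball (0, z₀, w₀) ε) := by
  have hπ0 : ∀ q ∈ ball ((0:ℝ), z₀, w₀) ε, π (fderiv ℝ F q (1, 0)) = 0 := by
    rintro ⟨x, y⟩ hq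
    have h1 : HasDerivAt (fun s => π (F (s, y))) (π (fderiv ℝ F (x, y) (1, 0))) x :=
      π.hasFDerivAt.comp_hasDerivAt x (line_hasDerivAt ((hF _ hq).differentiableAt))
    have hc : ContinuousAt (fun s : ℝ => (s, y)) x := by fun_prop
    have h2 : (fun s => π (F (s, y))) =ᶠ[𝓝 x] fun _ => y.1 := by
      filter_upwards [hc.eventually (isOpen_ball.mem_nhds hq)] with s hs using hπ _ hs
    exact h1.unique ((hasDerivAt_const x y.1).congr_of_eventuallyEq h2)
  have hl0 : ∀ q ∈ ball ((0:ℝ), z₀, w₀) ε, q.1 ≠ 0 → l (fderiv ℝ F q (1, 0)) ≠ 0 :=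
    fun q hq hq0 h => hne q hq hq0 (hker _ (hπ0 q hq) h)
  have hcont : ContinuousOn (fun q => l (fderiv ℝ F q (1, 0))) (ball ((0:ℝ), z₀, w₀) ε) :=
    l.continuous.comp_continuousOn (hF.fderiv.continuousOn.clm_apply continuousOn_const)
  have hp := sign_const (S := ball ((0:ℝ), z₀, w₀) ε ∩ {q | 0 < q.1})
    (((convex_ball _ _).inter (convex_halfSpace_gt (LinearMap.fst ℝ ℝ (R × K)).isLinear 0)).isPreconnected)
    (hcont.mono inter_subset_left) (fun q hq => hl0 q hq.1 hq.2.ne')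
  have hn := sign_const (S := ball ((0:ℝ), z₀, w₀) ε ∩ {q | q.1 < 0})
    (((convex_ball _ _).inter (convex_halfSpace_lt (LinearMap.fst ℝ ℝ (R × K)).isLinear 0)).isPreconnected)
    (hcont.mono inter_subset_left) (fun q hq => hl0 q hq.1 hq.2.ne)
  rcases hp with hp | hp
  · exact core2_aux F z₀ w₀ ε hε hF hopen π hπ l e hπe hle (fun q hq h => hp q ⟨hq, h⟩)
      (hn.imp (fun h q hq hq' => h q ⟨hq, hq'⟩) (fun h q hq hq' => h q ⟨hq, hq'⟩))
  · exact core2_aux F z₀ w₀ ε hε hF hopen π hπ (-l) (-e) (by simp [hπe]) (by simp [hle])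
      (fun q hq h => by simpa using hp q ⟨hq, h⟩)
      (hn.symm.imp (fun h q hq hq' => by simpa using h q ⟨hq, hq'⟩)
        (fun h q hq hq' => by simpa using h q ⟨hq, hq'⟩))
end

theorem main_general {E : Type*} [NormedAddCommGroup E] [NormedSpace ℝ E] [FiniteDimensional ℝ E]
    (f : E → E) (hf : ∀ p, AnalyticAt ℝ f p) (hopen : IsOpenMap f)
    (p : E) (U : Set E) (hU : IsOpen U) (hpU : p ∈ U)
    (g : E → ℝ) (hg : ∀ q ∈ U, AnalyticAt ℝ g q) (hgp : g p = 0)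
    (hdg : fderiv ℝ g p ≠ 0)
    (hinj : ∀ q ∈ U, g q ≠ 0 → ∀ v, fderiv ℝ f q v = 0 → v = 0)
    (r : ℕ)
    (hr : ∀ q ∈ U, g q = 0 →
      Module.finrank ℝ
        (Submodule.map (fderiv ℝ f q).toLinearMap
          (LinearMap.ker (fderiv ℝ g q).toLinearMap)) = r) :
    r + 1 = Module.finrank ℝ E ∧ IsLocalHomeomorphOn f {p} := by
  have := FiniteDimensional.complete ℝ E
  set A := fderiv ℝ f p with hA
  set α := fderiv ℝ g p with hα
  let H := LinearMap.ker α.toLinearMap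
  let L := Submodule.map A.toLinearMap H
  let AH : H →ₗ[ℝ] E := A.toLinearMap.domRestrict H
  let K := LinearMap.ker AH
  have hLr : Module.finrank ℝ L = r := hr p hpU hgp
  have hHn : Module.finrank ℝ H + 1 = Module.finrank ℝ E :=
    Module.Dual.finrank_ker_add_one_of_ne_zero (f := α.toLinearMap) (by
      intro h; apply hdg; ext v; exact LinearMap.congr_fun h v)
  have hRK : r + Module.finrank ℝ K = Module.finrank ℝ H := by
    have := AH.finrank_range_add_finrank_ker
    rw [LinearMap.range_domRestrict] at this
    rw [← hLr]; exact this
  obtain ⟨π, hπL⟩ : L.ClosedComplemented := Submodule.ClosedComplemented.of_finiteDimensional L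
  obtain ⟨κ₁, hκ₁⟩ : H.ClosedComplemented := Submodule.ClosedComplemented.of_finiteDimensional H
  obtain ⟨κ₂, hκ₂⟩ : K.ClosedComplemented := Submodule.ClosedComplemented.of_finiteDimensional K
  let κ : E →L[ℝ] K := κ₂.comp κ₁
  let M : E →L[ℝ] ℝ × L × K := α.prod ((π.comp A).prod κ)
  have hMinj : Function.Injective M := by
    rw [injective_iff_map_eq_zero]
    intro v hv
    have h1 : α v = 0 := congrArg Prod.fst hv
    have h2 : π (A v) = 0 := congrArg (fun q => q.2.1) hv
    have h3 : κ v = 0 := congrArg (fun q => q.2.2) hv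
    have hvH : v ∈ H := h1
    have hAv : A v ∈ L := Submodule.mem_map_of_mem hvH
    have h4 : A v = 0 := by
      have := hπL ⟨A v, hAv⟩
      simp only [h2] at this
      exact (congrArg Subtype.val this).symm
    have hvK : (⟨v, hvH⟩ : H) ∈ K := h4
    have h5 : κ v = ⟨⟨v, hvH⟩, hvK⟩ := by
      change κ₂ (κ₁ v) = _
      rw [hκ₁ ⟨v, hvH⟩]
      exact hκ₂ ⟨⟨v, hvH⟩, hvK⟩
    rw [h5] at h3
    exact congrArg (fun k : K => ((k : H) : E)) h3
  have hdim : Module.finrank ℝ E = Module.finrank ℝ (ℝ × L × K) := by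
    rw [Module.finrank_prod, Module.finrank_prod, Module.finrank_self, hLr]
    omega
  let Me : E ≃L[ℝ] ℝ × L × K :=
    (LinearEquiv.ofInjectiveOfFinrankEq M.toLinearMap hMinj hdim).toContinuousLinearEquiv
  have hMe : (Me : E →L[ℝ] ℝ × L × K) = M := by
    ext1 v; rfl
  let Φ₀ : E → ℝ × L × K := fun q => (g q, π (f q), κ q)
  have hΦan : AnalyticAt ℝ Φ₀ p :=
    (hg p hpU).prod (((π.analyticAt _).fun_comp (hf p)).prod (κ.analyticAt _))
  have hΦd : HasFDerivAt Φ₀ M p :=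
    (hg p hpU).differentiableAt.hasFDerivAt.prodMk
      ((π.hasFDerivAt.comp p (hf p).differentiableAt.hasFDerivAt).prodMk κ.hasFDerivAt)
  have hΦs : HasStrictFDerivAt Φ₀ (Me : E →L[ℝ] ℝ × L × K) p := by
    rw [hMe, ← hΦd.fderiv]
    exact hΦan.hasStrictFDerivAt
  let Φ := hΦs.toOpenPartialHomeomorph Φ₀
  have hΦc : ∀ q, Φ q = Φ₀ q := fun q => rfl
  have hpS : p ∈ Φ.source := hΦs.mem_toOpenPartialHomeomorph_source
  have hTan : AnalyticAt ℝ Φ.symm (Φ p) :=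
    Φ.analyticAt_symm' (i := Me) hpS hΦan (by rw [hMe]; exact hΦd.fderiv)
  have hTp : Φ.symm (Φ p) = p := Φ.left_inv hpS
  set z₀ := π (f p) with hz₀
  set w₀ := κ p with hw₀
  have hΦp : Φ p = (0, z₀, w₀) := by rw [hΦc]; simp only [Φ₀, hgp, hz₀, hw₀]
  set T := Φ.symm with hT
  obtain ⟨ε, hε, hball⟩ : ∃ ε > 0, ∀ q ∈ ball ((0:ℝ), z₀, w₀) ε,
      (AnalyticAt ℝ T q ∧ T q ∈ U) ∧ q ∈ Φ.target := by
    have e1 := hTan.eventually_analyticAt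
    have e2 : ∀ᶠ q in 𝓝 (Φ p), T q ∈ U :=
      hTan.continuousAt.eventually (hU.mem_nhds (by rw [hTp]; exact hpU))
    have e3 : ∀ᶠ q in 𝓝 (Φ p), q ∈ Φ.target := Φ.open_target.mem_nhds (Φ.map_source hpS)
    rw [hΦp] at e1 e2 e3
    exact Metric.mem_nhds_iff.1 ((e1.and e2).and e3)
  set B := ball ((0:ℝ), z₀, w₀) ε with hB
  have hΦT : ∀ q ∈ B, Φ₀ (T q) = q := fun q hq => Φ.right_inv (hball q hq).2
  have hgT : ∀ q ∈ B, g (T q) = q.1 := fun q hq => congrArg Prod.fst (hΦT q hq)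
  have hπT : ∀ q ∈ B, π (f (T q)) = q.2.1 := fun q hq => congrArg (fun x => x.2.1) (hΦT q hq)
  have hTd : ∀ q ∈ B, HasFDerivAt T (fderiv ℝ T q) q :=
    fun q hq => (hball q hq).1.1.differentiableAt.hasFDerivAt
  let F : ℝ × L × K → E := fun q => f (T q)
  have hF : AnalyticOnNhd ℝ F B := fun q hq => (hf _).fun_comp (hball q hq).1.1
  have hFd : ∀ q ∈ B, ∀ v, fderiv ℝ F q v = fderiv ℝ f (T q) (fderiv ℝ T q v) := by
    intro q hq v
    have := ((hf (T q)).differentiableAt.hasFDerivAt.comp q (hTd q hq)).fderiv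
    change fderiv ℝ F q = _ at this
    rw [this]; rfl
  have hopenT : ∀ V ⊆ B, IsOpen V → IsOpen (T '' V) := fun V hV hVo =>
    Φ.symm.isOpen_image_of_subset_source hVo (fun q hq => (hball q (hV hq)).2)
  have hopenF : ∀ V ⊆ B, IsOpen V → IsOpen (F '' V) := by
    intro V hV hVo
    have := hopen _ (hopenT V hV hVo)
    rwa [image_image] at this
  -- derivative identities
  have hdgT : ∀ q ∈ B, ∀ v, fderiv ℝ g (T q) (fderiv ℝ T q v) = v.1 := by
    intro q hq v
    have h1 := (hg _ (hball q hq).1.2).differentiableAt.hasFDerivAt.comp q (hTd q hq)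
    have h2 : g ∘ T =ᶠ[𝓝 q] fun q => q.1 := by
      filter_upwards [isOpen_ball.mem_nhds hq] with s hs using hgT s hs
    have h3 := h1.unique ((hasFDerivAt_fst (𝕜 := ℝ) (p := q)).congr_of_eventuallyEq h2)
    exact congrArg (fun l => l v) h3
  have hdπT : ∀ q ∈ B, ∀ v, π (fderiv ℝ f (T q) (fderiv ℝ T q v)) = v.2.1 := by
    intro q hq v
    have h1 := π.hasFDerivAt.comp q
      ((hf (T q)).differentiableAt.hasFDerivAt.comp q (hTd q hq))
    have h2 : π ∘ f ∘ T =ᶠ[𝓝 q] fun q => q.2.1 := by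
      filter_upwards [isOpen_ball.mem_nhds hq] with s hs using hπT s hs
    have h4 : HasFDerivAt (fun q : ℝ × L × K => q.2.1)
        ((ContinuousLinearMap.fst ℝ L K).comp (ContinuousLinearMap.snd ℝ ℝ (L × K))) q :=
      ((ContinuousLinearMap.fst ℝ L K).comp (ContinuousLinearMap.snd ℝ ℝ (L × K))).hasFDerivAt
    have h3 := h1.unique (h4.congr_of_eventuallyEq h2)
    exact congrArg (fun l => l v) h3
  have hdw : ∀ q ∈ B, q.1 = 0 → ∀ w : K, fderiv ℝ F q (0, 0, w) = 0 := by
    intro q hq hq0 w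
    let N := Submodule.map (fderiv ℝ f (T q)).toLinearMap
          (LinearMap.ker (fderiv ℝ g (T q)).toLinearMap)
    have hN : Module.finrank ℝ N = r := hr (T q) (hball q hq).1.2 (by rw [hgT q hq, hq0])
    have hmem : ∀ v : ℝ × L × K, v.1 = 0 → fderiv ℝ f (T q) (fderiv ℝ T q v) ∈ N := by
      intro v hv
      refine Submodule.mem_map_of_mem (f := (fderiv ℝ f (T q)).toLinearMap) ?_
      change fderiv ℝ g (T q) (fderiv ℝ T q v) = 0
      rw [hdgT q hq, hv]
    let πN : N →ₗ[ℝ] L := π.toLinearMap.domRestrict N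
    have hsurj : Function.Surjective πN := fun z =>
      ⟨⟨_, hmem (0, z, 0) rfl⟩, hdπT q hq (0, z, 0)⟩
    have hinjN : Function.Injective πN :=
      (LinearMap.injective_iff_surjective_of_finrank_eq_finrank (by rw [hN, hLr])).2 hsurj
    rw [hFd q hq]
    have := hinjN (a₁ := ⟨_, hmem (0, 0, w) rfl⟩) (a₂ := 0)
      (by rw [map_zero]; exact hdπT q hq (0, 0, w))
    exact congrArg Subtype.val this
  have hw : ∀ z w w', (0, z, w) ∈ B → (0, z, w') ∈ B → F (0, z, w) = F (0, z, w') := by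
    intro z w w' h1 h2
    have hmemB : ∀ s, (0, z, s) ∈ B ↔ dist z z₀ < ε ∧ s ∈ ball w₀ ε := by
      intro s
      rw [hB, mem_ball_iff', ← ball_prod_same, mem_prod]; simp [hε]
    have hz := ((hmemB w).1 h1).1
    have hd : ∀ s ∈ ball w₀ ε, HasFDerivAt (fun s => F (0, z, s)) (0 : K →L[ℝ] E) s := by
      intro s hs
      have hq := (hmemB s).2 ⟨hz, hs⟩
      have h3 : HasFDerivAt (fun s : K => ((0:ℝ), z, s))
          ((0 : K →L[ℝ] ℝ).prod ((0 : K →L[ℝ] L).prod (ContinuousLinearMap.id ℝ K))) s :=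
        (hasFDerivAt_const _ _).prodMk ((hasFDerivAt_const _ _).prodMk (hasFDerivAt_id s))
      have h4 := (hF _ hq).differentiableAt.hasFDerivAt.comp s h3
      have h5 : (fderiv ℝ F (0, z, s)).comp
          ((0 : K →L[ℝ] ℝ).prod ((0 : K →L[ℝ] L).prod (ContinuousLinearMap.id ℝ K))) = 0 := by
        ext1 v
        exact hdw _ hq rfl v
      rw [h5] at h4
      exact h4
    exact isOpen_ball.is_const_of_fderiv_eq_zero (𝕜 := ℝ) (convex_ball w₀ ε).isPreconnected
      (fun s hs => (hd s hs).differentiableAt.differentiableWithinAt)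
      (fun s hs => (hd s hs).fderiv) ((hmemB w).1 h1).2 ((hmemB w').1 h2).2
  have hk1 := core1 F z₀ w₀ ε hε hF hopenF π hπT hw
  have hrange : LinearMap.range π.toLinearMap = ⊤ :=
    LinearMap.range_eq_top.2 (fun z => ⟨z, hπL z⟩)
  have hrn := π.toLinearMap.finrank_range_add_finrank_ker
  rw [hrange, finrank_top, hLr] at hrn
  have hK0 : Module.finrank ℝ K = 0 := by omega
  have hr1 : r + 1 = Module.finrank ℝ E := by omega
  refine ⟨hr1, ?_⟩
  have hsub : Subsingleton K := Module.finrank_zero_iff.1 hK0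
  have hker1 : Module.finrank ℝ (LinearMap.ker π.toLinearMap) = 1 := by omega
  obtain ⟨e, he0, hegen⟩ := finrank_eq_one_iff'.1 hker1
  have he0' : (e : E) ≠ 0 := fun h => he0 (Subtype.ext h)
  obtain ⟨l, hl⟩ := SeparatingDual.exists_eq_one (R := ℝ) he0'
  have hinjF : InjOn F B := by
    refine core2 F z₀ w₀ ε hε hF hopenF π hπT l e e.2 hl ?_ ?_
    · intro v hv hlv
      obtain ⟨c, hc⟩ := hegen ⟨v, hv⟩
      have hc' : c • (e : E) = v := congrArg Subtype.val hc
      rw [← hc', map_smul, hl, smul_eq_mul, mul_one] at hlv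
      rw [← hc', hlv, zero_smul]
    · intro q hq hq0 h
      rw [hFd q hq] at h
      have h1 := hinj (T q) (hball q hq).1.2 (by rwa [hgT q hq]) _ h
      have h2 := hdgT q hq (1, 0)
      rw [h1] at h2
      simp at h2
  rw [isLocalHomeomorphOn_iff_isOpenEmbedding_restrict]
  rintro x rfl
  have hVo := hopenT B subset_rfl isOpen_ball
  have hcB : ((0:ℝ), z₀, w₀) ∈ B := mem_ball_self hε
  refine ⟨T '' B, hVo.mem_nhds ⟨_, hcB, by rw [← hΦp, hTp]⟩, ?_⟩
  have hfc : Continuous f := continuous_iff_continuousAt.2 fun q => (hf q).continuousAt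
  refine .of_continuous_injective_isOpenMap (hfc.comp continuous_subtype_val) ?_
    (hopen.comp hVo.isOpenMap_subtype_val)
  rintro ⟨_, q, hq, rfl⟩ ⟨_, q', hq', rfl⟩ h
  have := hinjF hq hq' h
  subst this
  rfl

/-- **Theorem B(i),(ii), local form (Hirsch).** Let `f : ℝⁿ → ℝⁿ` be a real
analytic open map, `p` a critical point of `f`, and suppose near `p` the
critical set of `f` is the zero set of an analytic function `g` with
nonvanishing derivative, and that the rank of `df` restricted to the tangent
hyperplane `ker dg` is constant on this zero set.  Then this constant rank is
`n - 1` and `f` is a local homeomorphism at `p`. -/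
theorem constant_rank_hypersurface_local_homeomorph
    {n : ℕ} (hn : 1 ≤ n)
    (f : EuclideanSpace ℝ (Fin n) → EuclideanSpace ℝ (Fin n))
    (hf : ∀ p, AnalyticAt ℝ f p) (hopen : IsOpenMap f)
    (p : EuclideanSpace ℝ (Fin n)) (hp : (fderiv ℝ f p).det = 0)
    (U : Set (EuclideanSpace ℝ (Fin n))) (hU : IsOpen U) (hpU : p ∈ U)
    (g : EuclideanSpace ℝ (Fin n) → ℝ) (hg : ∀ q ∈ U, AnalyticAt ℝ g q)
    (hdg : ∀ q ∈ U, fderiv ℝ g q ≠ 0)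
    (hzero : {q ∈ U | (fderiv ℝ f q).det = 0} = {q ∈ U | g q = 0})
    (r : ℕ)
    (hr : ∀ q ∈ U, g q = 0 →
      Module.finrank ℝ
        (Submodule.map (fderiv ℝ f q).toLinearMap
          (LinearMap.ker (fderiv ℝ g q).toLinearMap)) = r) :
    r = n - 1 ∧ IsLocalHomeomorphOn f {p} := by
  have hgp : g p = 0 := by
    have : p ∈ {q ∈ U | g q = 0} := hzero ▸ ⟨hpU, hp⟩
    exact this.2
  have h := main_general f hf hopen p U hU hpU g hg hgp (hdg p hpU) (by
    intro q hq hgq v hv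
    have hdet : (fderiv ℝ f q).det ≠ 0 := by
      intro h0
      have : q ∈ {q ∈ U | g q = 0} := hzero ▸ ⟨hq, h0⟩
      exact hgq this.2
    by_contra hv0
    apply hdet
    by_contra hdet'
    have hu : IsUnit (LinearMap.det (fderiv ℝ f q).toLinearMap) := isUnit_iff_ne_zero.2 hdet'
    have hker := (LinearMap.isUnit_iff_ker_eq_bot _).1
      ((LinearMap.isUnit_iff_isUnit_det _).2 hu)
    have : v ∈ LinearMap.ker (fderiv ℝ f q).toLinearMap := hv
    rw [hker] at this
    exact hv0 this) r hr
  rw [finrank_euclideanSpace_fin] at h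
  exact ⟨by omega, h.2⟩
end
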